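/- Let d ≥ 1, δ ∈ (0,1], p,q ∈ (1,∞), β with d/p + 2/q ≥ β > 1, p_b ≥ βp, and ρ_b ∈ (0,1]. Let a be a Borel map from ℝ^d into the symmetric d×d matrices whose eigenvalues all lie in [δ, δ^{-1}], and let b: ℝ^d → ℝ^d be Borel with b̂ := sup_{0<ρ≤ρ_b} ρ · sup_{x∈ℝ^d} (⨍_{B_ρ(x)} |b|^{p_b} dy)^{1/p_b} < ∞. Then there is a constant N, depending only on d, δ, p, q, β, p_b, ρ_b and b̂, such that for every u ∈ E^{1,2}_{p,q,β} the function ℒu := (1/2)·Σ_{i,j} a^{ij} D_{ij}u + Σ_i b^i D_i u belongs to E_{p,q,β} and ‖ℒu‖_{E_{p,q,β}} ≤ N·‖u‖_{E^{1,2}_{p,q,β}}. -/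

import Mathlib

open MeasureTheory ENNReal NNReal Metric Set Filter Topology

noncomputable section

/-- Euclidean space `ℝ^d`. -/
abbrev Spc (d : ℕ) : Type := EuclideanSpace ℝ (Fin d)

/-- Space-time `ℝ^{d+1} = ℝ × ℝ^d`, a point is `(t, x)`. -/
abbrev SpT (d : ℕ) : Type := ℝ × Spc d

/-- The parabolic cylinder `C_ρ(t₀,x₀) = [t₀, t₀+ρ²) × B_ρ(x₀)`. -/
def pCyl (d : ℕ) (ρ t₀ : ℝ) (x₀ : Spc d) : Set (SpT d) :=
  (Set.Ico t₀ (t₀ + ρ ^ 2)) ×ˢ (Metric.ball x₀ ρ)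

/-- The (unnormalized) norm `‖f‖_{L_{p,q}(A)}
    = (∫_ℝ (∫_{ℝ^d} |f(t,x)|^p 1_A(t,x) dx)^{q/p} dt)^{1/q}`. -/
def lpqNorm (d : ℕ) (p q : ℝ) (f : SpT d → ℝ) (A : Set (SpT d)) : ℝ≥0∞ :=
  (∫⁻ t : ℝ, (∫⁻ x : Spc d, A.indicator (fun z => ENNReal.ofReal |f z| ^ p) (t, x)) ^ (q / p)) ^ (1 / q)

/-- The normalized norm `⨍‖f‖_{L_{p,q}(C)}` over the cylinder `C_ρ(t₀,x₀)`:
    inner integral replaced by the average over the spatial ball, outer one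
    by the average over the time interval. -/
def avgLpq (d : ℕ) (p q ρ t₀ : ℝ) (x₀ : Spc d) (f : SpT d → ℝ) : ℝ≥0∞ :=
  ((∫⁻ t in Set.Ico t₀ (t₀ + ρ ^ 2),
      ((∫⁻ x in Metric.ball x₀ ρ, ENNReal.ofReal |f (t, x)| ^ p) / volume (Metric.ball x₀ ρ)) ^ (q / p))
      / ENNReal.ofReal (ρ ^ 2)) ^ (1 / q)

/-- The parabolic Morrey norm `‖f‖_{E_{p,q,β}}
    = sup { ρ^β ⨍‖f‖_{L_{p,q}(C)} : 0 < ρ ≤ 1, C ∈ ℂ_ρ }`. -/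
def morreyNorm (d : ℕ) (p q β : ℝ) (f : SpT d → ℝ) : ℝ≥0∞ :=
  ⨆ (ρ : ℝ) (_ : 0 < ρ) (_ : ρ ≤ 1) (t₀ : ℝ) (x₀ : Spc d),
    ENNReal.ofReal (ρ ^ β) * avgLpq d p q ρ t₀ x₀ f

/-- The homogeneous parabolic Morrey norm `‖f‖_{Ė_{p,q,β}}` (all radii `ρ > 0`). -/
def morreyNormH (d : ℕ) (p q β : ℝ) (f : SpT d → ℝ) : ℝ≥0∞ :=
  ⨆ (ρ : ℝ) (_ : 0 < ρ) (t₀ : ℝ) (x₀ : Spc d),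
    ENNReal.ofReal (ρ ^ β) * avgLpq d p q ρ t₀ x₀ f

/-- Membership `f ∈ E_{p,q,β}`. -/
def MemE (d : ℕ) (p q β : ℝ) (f : SpT d → ℝ) : Prop :=
  AEStronglyMeasurable f volume ∧ morreyNorm d p q β f ≠ ⊤

/-- Membership `f ∈ Ė_{p,q,β}` (homogeneous). -/
def MemEH (d : ℕ) (p q β : ℝ) (f : SpT d → ℝ) : Prop :=
  AEStronglyMeasurable f volume ∧ morreyNormH d p q β f ≠ ⊤

/-- The elliptic Morrey norm `‖f‖_{E_{p,β}(ℝ^d)}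
    = sup { ρ^β (⨍_{B_ρ(x)} |f|^p)^{1/p} : 0 < ρ ≤ 1, x ∈ ℝ^d }`. -/
def morreyNormE (d : ℕ) (p β : ℝ) (f : Spc d → ℝ) : ℝ≥0∞ :=
  ⨆ (ρ : ℝ) (_ : 0 < ρ) (_ : ρ ≤ 1) (x₀ : Spc d),
    ENNReal.ofReal (ρ ^ β) *
      ((∫⁻ y in Metric.ball x₀ ρ, ENNReal.ofReal |f y| ^ p) / volume (Metric.ball x₀ ρ)) ^ (1 / p)

/-- The homogeneous elliptic Morrey norm on `ℝ^d` (all radii `ρ > 0`). -/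
def morreyNormEH (d : ℕ) (p β : ℝ) (f : Spc d → ℝ) : ℝ≥0∞ :=
  ⨆ (ρ : ℝ) (_ : 0 < ρ) (x₀ : Spc d),
    ENNReal.ofReal (ρ ^ β) *
      ((∫⁻ y in Metric.ball x₀ ρ, ENNReal.ofReal |f y| ^ p) / volume (Metric.ball x₀ ρ)) ^ (1 / p)

/-- A mollifying kernel: nonnegative, smooth, compactly supported in
    `[-1,0) × B_1(0)`, with unit integral. -/
def IsMollifier (d : ℕ) (ζ : SpT d → ℝ) : Prop :=
  ContDiff ℝ (⊤ : ℕ∞) ζ ∧ (∀ z, 0 ≤ ζ z) ∧ (∫ z, ζ z) = 1 ∧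
    Function.support ζ ⊆ (Set.Ico (-1 : ℝ) 0) ×ˢ (Metric.ball (0 : Spc d) 1)

/-- The mollification `f^{(ε)} = f * ζ_ε`, where
    `ζ_ε(t,x) = ε^{-d-2} ζ(t/ε², x/ε)`. -/
def mollify (d : ℕ) (ζ : SpT d → ℝ) (ε : ℝ) (f : SpT d → ℝ) (z : SpT d) : ℝ :=
  ∫ w : SpT d, (ε ^ (-(d : ℝ) - 2) * ζ (w.1 / ε ^ 2, ε⁻¹ • w.2)) * f (z.1 - w.1, z.2 - w.2)

/-- The time direction in space-time. -/
def dirT (d : ℕ) : SpT d := (1, 0)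

/-- The `i`-th spatial direction in space-time. -/
def dirS (d : ℕ) (i : Fin d) : SpT d := (0, EuclideanSpace.single i 1)

/-- `v` is the weak derivative of `u` in the direction `e`. -/
def IsWeakDeriv (d : ℕ) (u v : SpT d → ℝ) (e : SpT d) : Prop :=
  ∀ φ : SpT d → ℝ, ContDiff ℝ (⊤ : ℕ∞) φ → HasCompactSupport φ →
    ∫ z, u z * fderiv ℝ φ z e = - ∫ z, v z * φ z

/-- `v` is the second weak derivative of `u` in the directions `e₁, e₂`. -/
def IsWeakDeriv2 (d : ℕ) (u v : SpT d → ℝ) (e₁ e₂ : SpT d) : Prop :=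
  ∀ φ : SpT d → ℝ, ContDiff ℝ (⊤ : ℕ∞) φ → HasCompactSupport φ →
    ∫ z, u z * fderiv ℝ (fun w => fderiv ℝ φ w e₁) z e₂ = ∫ z, v z * φ z

/-- The magnitude `|Du|` of the spatial gradient. -/
def gradMag (d : ℕ) (Du : Fin d → SpT d → ℝ) (z : SpT d) : ℝ :=
  Real.sqrt (∑ i, (Du i z) ^ 2)

/-- The magnitude `|D²u|` of the spatial Hessian. -/
def hessMag (d : ℕ) (D2u : Fin d → Fin d → SpT d → ℝ) (z : SpT d) : ℝ :=
  Real.sqrt (∑ i, ∑ j, (D2u i j z) ^ 2)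

/-- `u ∈ E^{1,2}_{p,q,β}`, with weak spatial gradient `Du`, weak spatial Hessian
    `D2u`, and weak time derivative `ut`, all in `E_{p,q,β}`. -/
def Mem12 (d : ℕ) (p q β : ℝ) (u : SpT d → ℝ) (Du : Fin d → SpT d → ℝ)
    (D2u : Fin d → Fin d → SpT d → ℝ) (ut : SpT d → ℝ) : Prop :=
  MemE d p q β u ∧ (∀ i, IsWeakDeriv d u (Du i) (dirS d i)) ∧
    (∀ i j, IsWeakDeriv2 d u (D2u i j) (dirS d i) (dirS d j)) ∧
    IsWeakDeriv d u ut (dirT d) ∧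
    (∀ i, MemE d p q β (Du i)) ∧ (∀ i j, MemE d p q β (D2u i j)) ∧ MemE d p q β ut

/-- `u ∈ Ė^{1,2}_{p,q,β}` (homogeneous version). -/
def Mem12H (d : ℕ) (p q β : ℝ) (u : SpT d → ℝ) (Du : Fin d → SpT d → ℝ)
    (D2u : Fin d → Fin d → SpT d → ℝ) (ut : SpT d → ℝ) : Prop :=
  MemEH d p q β u ∧ (∀ i, IsWeakDeriv d u (Du i) (dirS d i)) ∧
    (∀ i j, IsWeakDeriv2 d u (D2u i j) (dirS d i) (dirS d j)) ∧
    IsWeakDeriv d u ut (dirT d) ∧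
    (∀ i, MemEH d p q β (Du i)) ∧ (∀ i j, MemEH d p q β (D2u i j)) ∧ MemEH d p q β ut

/-- The norm `‖u‖_{E^{1,2}_{p,q,β}} = ‖u‖ + ‖Du‖ + ‖D²u‖ + ‖∂ₜu‖`. -/
def norm12 (d : ℕ) (p q β : ℝ) (u : SpT d → ℝ) (Du : Fin d → SpT d → ℝ)
    (D2u : Fin d → Fin d → SpT d → ℝ) (ut : SpT d → ℝ) : ℝ≥0∞ :=
  morreyNorm d p q β u + morreyNorm d p q β (gradMag d Du)
    + morreyNorm d p q β (hessMag d D2u) + morreyNorm d p q β ut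

/-- Membership `f ∈ L_{p,q}(ℝ^{d+1})`. -/
def MemLpq (d : ℕ) (p q : ℝ) (f : SpT d → ℝ) : Prop :=
  AEStronglyMeasurable f volume ∧ lpqNorm d p q f Set.univ ≠ ⊤

/-- `u ∈ W^{1,2}_{p,q}(ℝ^{d+1})`: `u`, its weak spatial gradient `Du`,
    weak spatial Hessian `D2u` and weak time derivative `ut` are in `L_{p,q}`. -/
def MemW12 (d : ℕ) (p q : ℝ) (u : SpT d → ℝ) (Du : Fin d → SpT d → ℝ)
    (D2u : Fin d → Fin d → SpT d → ℝ) (ut : SpT d → ℝ) : Prop :=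
  MemLpq d p q u ∧ (∀ i, IsWeakDeriv d u (Du i) (dirS d i)) ∧
    (∀ i j, IsWeakDeriv2 d u (D2u i j) (dirS d i) (dirS d j)) ∧
    IsWeakDeriv d u ut (dirT d) ∧
    (∀ i, MemLpq d p q (Du i)) ∧ (∀ i j, MemLpq d p q (D2u i j)) ∧ MemLpq d p q ut

/-- Convergence `F ε → v` in `L_r(B)` as `ε ↓ 0`. -/
def TendstoLr (d : ℕ) (r : ℝ) (B : Set (Spc d)) (F : ℝ → Spc d → ℝ) (v : Spc d → ℝ) : Prop :=
  Tendsto (fun ε => (∫⁻ x in B, ENNReal.ofReal |F ε x - v x| ^ r) ^ (1 / r))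
    (𝓝[>] (0 : ℝ)) (𝓝 0)

/-- Minkowski's integral inequality for `ℝ≥0∞`-valued functions. -/
theorem lintegral_rpow_lintegral_le {X Θ : Type*} [MeasurableSpace X] [MeasurableSpace Θ]
    (ν : Measure X) [SFinite ν] (κ : Measure Θ) [IsFiniteMeasure κ] {p : ℝ} (hp : 1 < p)
    {f : X → Θ → ℝ≥0∞} (hf : Measurable (Function.uncurry f)) :
    (∫⁻ x, (∫⁻ θ, f x θ ∂κ) ^ p ∂ν) ^ (1 / p) ≤ ∫⁻ θ, (∫⁻ x, f x θ ^ p ∂ν) ^ (1 / p) ∂κ := by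
  have hp0 : 0 < p := by linarith
  set h : Θ → ℝ≥0∞ := fun θ => (∫⁻ x, f x θ ^ p ∂ν) ^ (1 / p) with hh
  have hfp : Measurable (Function.uncurry fun x θ => f x θ ^ p) := hf.pow_const p
  have hhm : Measurable h := (hfp.lintegral_prod_left').pow_const _
  by_cases hH : ∫⁻ θ, h θ ∂κ = ⊤
  · rw [hH]; exact le_top
  refine _root_.le_of_forall_pos_le_add fun ε hε => ?_
  by_cases hεt : ε = ⊤
  · simp [hεt]
  obtain ⟨e, he0, heκ⟩ : ∃ e : ℝ≥0, 0 < e ∧ e * κ univ ≤ ε := by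
    have hκ : κ univ + 1 ≠ ⊤ := by simp
    have hpos : 0 < ε / (κ univ + 1) := ENNReal.div_pos hε.ne' hκ
    have hne : ε / (κ univ + 1) ≠ ⊤ := ENNReal.div_ne_top hεt (by simp)
    refine ⟨(ε / (κ univ + 1)).toNNReal, ENNReal.toNNReal_pos hpos.ne' hne, ?_⟩
    rw [ENNReal.coe_toNNReal hne]
    calc ε / (κ univ + 1) * κ univ ≤ ε / (κ univ + 1) * (κ univ + 1) := by gcongr; simp
      _ = ε := ENNReal.div_mul_cancel (by simp) hκ
  set k : Θ → ℝ≥0∞ := fun θ => h θ + e with hk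
  have hkm : Measurable k := hhm.add_const _
  have hk0 : ∀ θ, k θ ≠ 0 := fun θ => by simp [hk, he0.ne']
  have hkt : ∀ᵐ θ ∂κ, k θ ≠ ⊤ := by
    filter_upwards [ae_lt_top hhm hH] with θ hθ
    simp [hk, hθ.ne]
  have hkint : ∫⁻ θ, k θ ∂κ ≤ ∫⁻ θ, h θ ∂κ + ε := by
    rw [hk, lintegral_add_left hhm, lintegral_const]; gcongr
  have hpc : p.HolderConjugate (p / (p - 1)) := Real.HolderConjugate.conjExponent hp
  have hq : 1 / (p / (p - 1)) * p = p - 1 := by field_simp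
  have key : ∀ x, (∫⁻ θ, f x θ ∂κ) ^ p
      ≤ (∫⁻ θ, f x θ ^ p * k θ ^ (-(p - 1)) ∂κ) * (∫⁻ θ, k θ ∂κ) ^ (p - 1) := by
    intro x
    have hfx : Measurable (f x) := hf.comp measurable_prodMk_left
    have h1 : ∫⁻ θ, f x θ ∂κ
        ≤ ∫⁻ θ, (f x θ * k θ ^ (-((p - 1) / p))) * k θ ^ ((p - 1) / p) ∂κ := by
      refine lintegral_mono_ae ?_
      filter_upwards [hkt] with θ hθ
      rw [mul_assoc, ← ENNReal.rpow_add _ _ (hk0 θ) hθ]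
      simp
    have h2 := ENNReal.lintegral_mul_le_Lp_mul_Lq κ hpc
      (f := fun θ => f x θ * k θ ^ (-((p - 1) / p))) (g := fun θ => k θ ^ ((p - 1) / p))
      (hfx.mul (hkm.pow_const _)).aemeasurable (hkm.pow_const _).aemeasurable
    calc _ ≤ _ := ENNReal.rpow_le_rpow (h1.trans h2) hp0.le
      _ = _ := by
        rw [ENNReal.mul_rpow_of_nonneg _ _ hp0.le, ← ENNReal.rpow_mul, ← ENNReal.rpow_mul, hq,
          one_div_mul_cancel hp0.ne', ENNReal.rpow_one]
        congr 2
        · ext θ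
          rw [ENNReal.mul_rpow_of_nonneg _ _ hp0.le, ← ENNReal.rpow_mul]
          congr 2; field_simp
        · refine lintegral_congr fun θ => ?_
          rw [← ENNReal.rpow_mul]
          have : (p - 1) / p * (p / (p - 1)) = 1 := by
            have : p - 1 ≠ 0 := by linarith
            field_simp
          rw [this, ENNReal.rpow_one]
  have hmeas : Measurable (Function.uncurry fun x θ => f x θ ^ p * k θ ^ (-(p - 1))) :=
    hfp.mul ((hkm.pow_const _).comp measurable_snd)
  have main : ∫⁻ x, (∫⁻ θ, f x θ ∂κ) ^ p ∂ν ≤ (∫⁻ θ, k θ ∂κ) ^ p := by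
    calc _ ≤ ∫⁻ x, (∫⁻ θ, f x θ ^ p * k θ ^ (-(p - 1)) ∂κ) * (∫⁻ θ, k θ ∂κ) ^ (p - 1) ∂ν :=
          lintegral_mono key
      _ = (∫⁻ θ, (∫⁻ x, f x θ ^ p ∂ν) * k θ ^ (-(p - 1)) ∂κ) * (∫⁻ θ, k θ ∂κ) ^ (p - 1) := by
        rw [lintegral_mul_const _ (by exact hmeas.lintegral_prod_right'), lintegral_lintegral_swap
          hmeas.aemeasurable]
        congr 2
        ext θ
        exact lintegral_mul_const _ ((hf.comp measurable_prodMk_right).pow_const _)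
      _ ≤ (∫⁻ θ, k θ ∂κ) ^ (1 : ℝ) * (∫⁻ θ, k θ ∂κ) ^ (p - 1) := by
        rw [ENNReal.rpow_one]
        gcongr ?_ * _
        refine lintegral_mono_ae ?_
        filter_upwards [hkt] with θ hθ
        calc _ ≤ k θ ^ p * k θ ^ (-(p - 1)) := by
              gcongr
              calc _ = h θ ^ p := by
                    rw [hh]; simp only
                    rw [← ENNReal.rpow_mul, one_div_mul_cancel hp0.ne', ENNReal.rpow_one]
                _ ≤ _ := by gcongr; simp [hk]
          _ = k θ := by
            rw [← ENNReal.rpow_add _ _ (hk0 θ) hθ]; simp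
      _ = _ := by rw [← ENNReal.rpow_add_of_nonneg _ _ zero_le_one (by linarith)]; simp
  calc _ ≤ ((∫⁻ θ, k θ ∂κ) ^ p) ^ (1 / p) := by gcongr
    _ = ∫⁻ θ, k θ ∂κ := by
      rw [← ENNReal.rpow_mul, mul_one_div_cancel hp0.ne', ENNReal.rpow_one]
    _ ≤ _ := hkint

/-- The mixed norm `‖f‖_{L_q(μ; L_p(ν))}` of an `ℝ≥0∞`-valued function. -/
def mixN {T X : Type*} [MeasurableSpace T] [MeasurableSpace X] (p q : ℝ) (μ : Measure T)
    (ν : Measure X) (f : T × X → ℝ≥0∞) : ℝ≥0∞ :=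
  (∫⁻ t, (∫⁻ x, f (t, x) ^ p ∂ν) ^ (q / p) ∂μ) ^ (1 / q)

section mixN
variable {T X : Type*} [MeasurableSpace T] [MeasurableSpace X] {p q : ℝ} {μ : Measure T}
  {ν : Measure X}

theorem mixN_mono_ae (hp : 1 < p) (hq : 1 < q) {f g : T × X → ℝ≥0∞}
    (h : ∀ᵐ t ∂μ, ∀ᵐ x ∂ν, f (t, x) ≤ g (t, x)) : mixN p q μ ν f ≤ mixN p q μ ν g := by
  have hp0 : 0 < p := by linarith
  have hq0 : 0 < q := by linarith
  refine ENNReal.rpow_le_rpow (lintegral_mono_ae ?_) (by positivity)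
  filter_upwards [h] with t ht
  refine ENNReal.rpow_le_rpow (lintegral_mono_ae ?_) (by positivity)
  filter_upwards [ht] with x hx
  exact ENNReal.rpow_le_rpow hx hp0.le

theorem mixN_mono (hp : 1 < p) (hq : 1 < q) {f g : T × X → ℝ≥0∞}
    (h : ∀ z, f z ≤ g z) : mixN p q μ ν f ≤ mixN p q μ ν g :=
  mixN_mono_ae hp hq (.of_forall fun _ => .of_forall fun _ => h _)

theorem mixN_const_mul (hp : 1 < p) (hq : 1 < q) {c : ℝ≥0∞} (hc : c ≠ ⊤) (f : T × X → ℝ≥0∞) :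
    mixN p q μ ν (fun z => c * f z) = c * mixN p q μ ν f := by
  have hp0 : 0 < p := by linarith
  have hq0 : 0 < q := by linarith
  unfold mixN
  have h1 : ∀ t, (∫⁻ x, (c * f (t, x)) ^ p ∂ν) ^ (q / p)
      = c ^ q * (∫⁻ x, f (t, x) ^ p ∂ν) ^ (q / p) := fun t => by
    simp_rw [ENNReal.mul_rpow_of_nonneg _ _ hp0.le]
    rw [lintegral_const_mul' _ _ (ENNReal.rpow_ne_top_of_nonneg hp0.le hc),
      ENNReal.mul_rpow_of_nonneg _ _ (by positivity), ← ENNReal.rpow_mul,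
      mul_div_cancel₀ _ hp0.ne']
  simp_rw [h1]
  rw [lintegral_const_mul' _ _ (ENNReal.rpow_ne_top_of_nonneg hq0.le hc),
    ENNReal.mul_rpow_of_nonneg _ _ (by positivity), ← ENNReal.rpow_mul,
    mul_one_div_cancel hq0.ne', ENNReal.rpow_one]

theorem mixN_const (hp : 1 < p) (hq : 1 < q) [IsProbabilityMeasure μ] [IsProbabilityMeasure ν]
    (c : ℝ≥0∞) : mixN p q μ ν (fun _ => c) = c := by
  have hp0 : 0 < p := by linarith
  have hq0 : 0 < q := by linarith
  simp only [mixN, lintegral_const, measure_univ, mul_one]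
  rw [← ENNReal.rpow_mul, ← ENNReal.rpow_mul]
  have : p * (q / p * (1 / q)) = 1 := by field_simp
  rw [this, ENNReal.rpow_one]

/-- Minkowski's integral inequality in mixed norms. -/
theorem mixN_lintegral_le (hp : 1 < p) (hq : 1 < q) [SFinite μ] [SFinite ν] {Θ : Type*}
    [MeasurableSpace Θ] (κ : Measure Θ) [IsFiniteMeasure κ] {f : Θ → T × X → ℝ≥0∞}
    (hf : Measurable (Function.uncurry f)) :
    mixN p q μ ν (fun z => ∫⁻ θ, f θ z ∂κ) ≤ ∫⁻ θ, mixN p q μ ν (f θ) ∂κ := by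
  have hp0 : 0 < p := by linarith
  have hq0 : 0 < q := by linarith
  have hm : Measurable fun w : (T × Θ) × X => f w.1.2 (w.1.1, w.2) ^ p :=
    (hf.comp (show Measurable fun w : (T × Θ) × X => (w.1.2, (w.1.1, w.2)) by fun_prop)).pow_const p
  have h1 := lintegral_rpow_lintegral_le μ κ hq
    (f := fun t θ => (∫⁻ x, f θ (t, x) ^ p ∂ν) ^ (1 / p))
    ((hm.lintegral_prod_right').pow_const _)
  have e : ∀ a : ℝ≥0∞, (a ^ (1 / p)) ^ q = a ^ (q / p) := fun a => by
    rw [← ENNReal.rpow_mul]; congr 1; field_simp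
  simp only [e] at h1
  refine le_trans ?_ h1
  unfold mixN
  refine ENNReal.rpow_le_rpow (lintegral_mono fun t => ?_) (by positivity)
  rw [← e]
  refine ENNReal.rpow_le_rpow ?_ hq0.le
  exact lintegral_rpow_lintegral_le ν κ hp (f := fun x θ => f θ (t, x))
    (hf.comp (show Measurable fun w : X × Θ => (w.2, (t, w.1)) by fun_prop))

theorem mixN_sum_le (hp : 1 < p) (hq : 1 < q) [SFinite μ] [SFinite ν] {ι : Type*} [Fintype ι]
    {f : ι → T × X → ℝ≥0∞} (hf : ∀ i, Measurable (f i)) :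
    mixN p q μ ν (fun z => ∑ i, f i z) ≤ ∑ i, mixN p q μ ν (f i) := by
  let _ : MeasurableSpace ι := ⊤
  have := mixN_lintegral_le (μ := μ) (ν := ν) hp hq (Measure.count : Measure ι) (f := f)
    (measurable_from_prod_countable_right hf)
  simpa [lintegral_count, tsum_fintype] using this

theorem mixN_add_le (hp : 1 < p) (hq : 1 < q) [SFinite μ] [SFinite ν]
    {f g : T × X → ℝ≥0∞} (hf : Measurable f) (hg : Measurable g) :
    mixN p q μ ν (fun z => f z + g z) ≤ mixN p q μ ν f + mixN p q μ ν g := by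
  have := mixN_sum_le (μ := μ) (ν := ν) hp hq (f := ![f, g])
    (by intro i; fin_cases i <;> simpa)
  simpa using this

theorem lintegral_le_rpow_of_prob {Ω : Type*} [MeasurableSpace Ω] (P : Measure Ω)
    [IsProbabilityMeasure P] (hp : 1 < p) {f : Ω → ℝ≥0∞} (hf : AEMeasurable f P) :
    ∫⁻ x, f x ∂P ≤ (∫⁻ x, f x ^ p ∂P) ^ (1 / p) := by
  have := ENNReal.lintegral_mul_le_Lp_mul_Lq P (Real.HolderConjugate.conjExponent hp) hf
    (aemeasurable_const (b := (1 : ℝ≥0∞)))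
  simpa using this

theorem lintegral_le_mixN (hp : 1 < p) (hq : 1 < q) [IsProbabilityMeasure μ]
    [IsProbabilityMeasure ν] {f : T × X → ℝ≥0∞} (hf : Measurable f) :
    ∫⁻ t, ∫⁻ x, f (t, x) ∂ν ∂μ ≤ mixN p q μ ν f := by
  have hq0 : 0 < q := by linarith
  refine (lintegral_le_rpow_of_prob μ hq hf.lintegral_prod_right'.aemeasurable).trans ?_
  refine ENNReal.rpow_le_rpow (lintegral_mono fun t => ?_) (by positivity)
  have h := lintegral_le_rpow_of_prob ν hp (hf.comp (measurable_prodMk_left (x := t))).aemeasurable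
  calc _ ≤ _ := ENNReal.rpow_le_rpow h hq0.le
    _ = _ := by
      rw [← ENNReal.rpow_mul]; simp only [Function.comp]
      congr 1; ring

/-- Fatou's lemma for mixed norms. -/
theorem mixN_le_of_tendsto (hp : 1 < p) (hq : 1 < q) [SFinite ν] {f : ℕ → T × X → ℝ≥0∞}
    {g : T × X → ℝ≥0∞} (hf : ∀ n, Measurable (f n))
    (h : ∀ᵐ t ∂μ, ∀ᵐ x ∂ν, Tendsto (fun n => f n (t, x)) atTop (𝓝 (g (t, x)))) {C : ℝ≥0∞}
    (hC : ∀ n, mixN p q μ ν (f n) ≤ C) : mixN p q μ ν g ≤ C := by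
  have hp0 : 0 < p := by linarith
  have hq0 : 0 < q := by linarith
  have hmono : ∀ {r : ℝ}, 0 < r → ∀ u : ℕ → ℝ≥0∞,
      (liminf u atTop) ^ r = liminf (fun n => u n ^ r) atTop := fun {r} hr u =>
    (ENNReal.orderIsoRpow r hr).liminf_apply
  have h1 : mixN p q μ ν g ≤ liminf (fun n => mixN p q μ ν (f n)) atTop := by
    unfold mixN
    rw [← hmono (by positivity)]
    refine ENNReal.rpow_le_rpow ?_ (by positivity)
    refine le_trans ?_ (lintegral_liminf_le fun n => ?_)
    · refine lintegral_mono_ae ?_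
      filter_upwards [h] with t ht
      rw [← hmono (by positivity)]
      refine ENNReal.rpow_le_rpow ?_ (by positivity)
      refine le_trans ?_ (lintegral_liminf_le fun n => ?_)
      · refine lintegral_mono_ae ?_
        filter_upwards [ht] with x hx
        rw [← hmono hp0, hx.liminf_eq]
      · exact ((hf n).comp measurable_prodMk_left).pow_const _
    · exact (((hf n).pow_const _).lintegral_prod_right').pow_const _
  refine h1.trans ?_
  calc _ ≤ liminf (fun _ : ℕ => C) atTop := liminf_le_liminf (.of_forall hC)
    _ = C := liminf_const _

end mixN

/-- The uniform probability measure on the time interval `[t₀, t₀ + ρ²)`. -/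
def cylT (ρ t₀ : ℝ) : Measure ℝ :=
  (ENNReal.ofReal (ρ ^ 2))⁻¹ • volume.restrict (Ico t₀ (t₀ + ρ ^ 2))

/-- The uniform probability measure on the ball `B_ρ(x₀)`. -/
def cylX (d : ℕ) (ρ : ℝ) (x₀ : Spc d) : Measure (Spc d) :=
  (volume (ball x₀ ρ))⁻¹ • volume.restrict (ball x₀ ρ)

/-- The parabolic Morrey norm of an `ℝ≥0∞`-valued function. -/
def morreyE (d : ℕ) (p q β : ℝ) (F : SpT d → ℝ≥0∞) : ℝ≥0∞ :=
  ⨆ (ρ : ℝ) (_ : 0 < ρ) (_ : ρ ≤ 1) (t₀ : ℝ) (x₀ : Spc d),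
    ENNReal.ofReal (ρ ^ β) * mixN p q (cylT ρ t₀) (cylX d ρ x₀) F

theorem volume_ball_ne_zero {d : ℕ} {ρ : ℝ} (hρ : 0 < ρ) (x₀ : Spc d) :
    volume (ball x₀ ρ) ≠ 0 := (measure_ball_pos _ _ hρ).ne'

theorem volume_ball_ne_top {d : ℕ} {ρ : ℝ} (x₀ : Spc d) :
    volume (ball x₀ ρ) ≠ ⊤ := measure_ball_lt_top.ne

theorem volume_ball_scale {d : ℕ} {ρ : ℝ} (hρ : 0 < ρ) (x₀ : Spc d) :
    volume (ball x₀ ρ) = ENNReal.ofReal (ρ ^ d) * volume (ball (0 : Spc d) 1) := by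
  rw [Measure.addHaar_ball_of_pos _ _ hρ]; simp

theorem isProbabilityMeasure_cylT {ρ : ℝ} (hρ : 0 < ρ) (t₀ : ℝ) :
    IsProbabilityMeasure (cylT ρ t₀) := by
  refine ⟨?_⟩
  simp only [cylT, Measure.smul_apply, Measure.restrict_apply_univ, Real.volume_Ico,
    add_sub_cancel_left, smul_eq_mul]
  exact ENNReal.inv_mul_cancel (by simp; positivity) (by simp)

theorem isProbabilityMeasure_cylX {d : ℕ} {ρ : ℝ} (hρ : 0 < ρ) (x₀ : Spc d) :
    IsProbabilityMeasure (cylX d ρ x₀) := by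
  refine ⟨?_⟩
  simp only [cylX, Measure.smul_apply, Measure.restrict_apply_univ, smul_eq_mul]
  exact ENNReal.inv_mul_cancel (volume_ball_ne_zero hρ x₀) (volume_ball_ne_top x₀)

instance sFinite_cylT (ρ t₀ : ℝ) : SFinite (cylT ρ t₀) := by unfold cylT; infer_instance

instance sFinite_cylX (d : ℕ) (ρ : ℝ) (x₀ : Spc d) : SFinite (cylX d ρ x₀) := by
  unfold cylX; infer_instance

theorem avgLpq_eq (d : ℕ) (p q ρ t₀ : ℝ) (x₀ : Spc d) (f : SpT d → ℝ) :
    avgLpq d p q ρ t₀ x₀ f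
      = mixN p q (cylT ρ t₀) (cylX d ρ x₀) (fun z => ENNReal.ofReal |f z|) := by
  simp only [avgLpq, mixN, cylT, cylX, lintegral_smul_measure, smul_eq_mul, div_eq_mul_inv,
    mul_comm]

theorem morreyNorm_eq (d : ℕ) (p q β : ℝ) (f : SpT d → ℝ) :
    morreyNorm d p q β f = morreyE d p q β (fun z => ENNReal.ofReal |f z|) := by
  simp only [morreyNorm, morreyE, avgLpq_eq]

theorem ofReal_rpow_neg_mul {ρ : ℝ} (hρ : 0 < ρ) (β : ℝ) :
    ENNReal.ofReal (ρ ^ (-β)) * ENNReal.ofReal (ρ ^ β) = 1 := by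
  rw [← ENNReal.ofReal_mul (by positivity), ← Real.rpow_add hρ]; simp

section
variable {d : ℕ} {p q β : ℝ}

theorem mixN_cyl_le {ρ : ℝ} (hρ : 0 < ρ) (hρ1 : ρ ≤ 1) (t₀ : ℝ) (x₀ : Spc d)
    (F : SpT d → ℝ≥0∞) : mixN p q (cylT ρ t₀) (cylX d ρ x₀) F
      ≤ ENNReal.ofReal (ρ ^ (-β)) * morreyE d p q β F := by
  have h : ENNReal.ofReal (ρ ^ β) * mixN p q (cylT ρ t₀) (cylX d ρ x₀) F
      ≤ morreyE d p q β F :=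
    le_iSup_of_le ρ <| le_iSup_of_le hρ <| le_iSup_of_le hρ1 <| le_iSup_of_le t₀ <|
      le_iSup_of_le x₀ le_rfl
  calc _ = ENNReal.ofReal (ρ ^ (-β)) *
        (ENNReal.ofReal (ρ ^ β) * mixN p q (cylT ρ t₀) (cylX d ρ x₀) F) := by
        rw [← mul_assoc, ofReal_rpow_neg_mul hρ, one_mul]
    _ ≤ _ := by gcongr

theorem morreyE_le {F : SpT d → ℝ≥0∞} {C : ℝ≥0∞}
    (h : ∀ ρ, 0 < ρ → ρ ≤ 1 → ∀ t₀ x₀, mixN p q (cylT ρ t₀) (cylX d ρ x₀) F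
      ≤ ENNReal.ofReal (ρ ^ (-β)) * C) : morreyE d p q β F ≤ C := by
  refine iSup_le fun ρ => iSup_le fun hρ => iSup_le fun hρ1 => iSup_le fun t₀ => iSup_le fun x₀ => ?_
  calc _ ≤ ENNReal.ofReal (ρ ^ β) * (ENNReal.ofReal (ρ ^ (-β)) * C) := by
        gcongr; exact h ρ hρ hρ1 t₀ x₀
    _ = C := by rw [← mul_assoc, mul_comm (ENNReal.ofReal _), ofReal_rpow_neg_mul hρ, one_mul]

theorem ae_cyl_of_ae {P : SpT d → Prop} (h : ∀ᵐ z, P z) (ρ t₀ : ℝ) (x₀ : Spc d) :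
    ∀ᵐ t ∂(cylT ρ t₀), ∀ᵐ x ∂(cylX d ρ x₀), P (t, x) := by
  have h1 : ∀ᵐ t : ℝ, ∀ᵐ x : Spc d, P (t, x) := Measure.ae_ae_of_ae_prod h
  refine Measure.ae_smul_measure (ae_restrict_of_ae ?_) _
  filter_upwards [h1] with t ht
  exact Measure.ae_smul_measure (ae_restrict_of_ae ht) _

theorem morreyE_mono_ae (hp : 1 < p) (hq : 1 < q) {F G : SpT d → ℝ≥0∞}
    (h : ∀ᵐ z, F z ≤ G z) : morreyE d p q β F ≤ morreyE d p q β G :=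
  morreyE_le fun _ hρ hρ1 t₀ x₀ =>
    (mixN_mono_ae hp hq (ae_cyl_of_ae h _ t₀ x₀)).trans (mixN_cyl_le hρ hρ1 t₀ x₀ G)

theorem morreyE_const_mul_le (hp : 1 < p) (hq : 1 < q) {c : ℝ≥0∞} (hc : c ≠ ⊤)
    (F : SpT d → ℝ≥0∞) :
    morreyE d p q β (fun z => c * F z) ≤ c * morreyE d p q β F := by
  refine morreyE_le fun ρ hρ hρ1 t₀ x₀ => ?_
  rw [mixN_const_mul hp hq hc, mul_left_comm]
  gcongr
  exact mixN_cyl_le hρ hρ1 t₀ x₀ F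

theorem morreyE_sum_le (hp : 1 < p) (hq : 1 < q) {ι : Type*} [Fintype ι]
    {F : ι → SpT d → ℝ≥0∞} (hF : ∀ i, Measurable (F i)) :
    morreyE d p q β (fun z => ∑ i, F i z) ≤ ∑ i, morreyE d p q β (F i) := by
  refine morreyE_le fun ρ hρ hρ1 t₀ x₀ => ?_
  refine (mixN_sum_le hp hq hF).trans ?_
  rw [Finset.mul_sum]
  exact Finset.sum_le_sum fun i _ => mixN_cyl_le hρ hρ1 t₀ x₀ _

theorem morreyE_add_le (hp : 1 < p) (hq : 1 < q)
    {F G : SpT d → ℝ≥0∞} (hF : Measurable F) (hG : Measurable G) :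
    morreyE d p q β (fun z => F z + G z) ≤ morreyE d p q β F + morreyE d p q β G := by
  refine morreyE_le fun ρ hρ hρ1 t₀ x₀ => ?_
  refine (mixN_add_le hp hq hF hG).trans ?_
  rw [mul_add]
  exact add_le_add (mixN_cyl_le hρ hρ1 t₀ x₀ _) (mixN_cyl_le hρ hρ1 t₀ x₀ _)

theorem lintegral_cylT_add (ρ t₀ s : ℝ) (f : ℝ → ℝ≥0∞) :
    ∫⁻ t, f (t + s) ∂(cylT ρ t₀) = ∫⁻ t, f t ∂(cylT ρ (t₀ + s)) := by
  simp only [cylT, lintegral_smul_measure]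
  congr 1
  have h := (measurePreserving_add_right (volume : Measure ℝ) s).setLIntegral_comp_preimage_emb
    (MeasurableEquiv.addRight s).measurableEmbedding f (Ico (t₀ + s) (t₀ + s + ρ ^ 2))
  rw [← h]
  congr 2
  ext t; simp only [mem_Ico, mem_preimage]; constructor <;> rintro ⟨h1, h2⟩ <;> constructor <;> linarith

theorem lintegral_cylX_add (ρ : ℝ) (x₀ y : Spc d) (f : Spc d → ℝ≥0∞) :
    ∫⁻ x, f (x + y) ∂(cylX d ρ x₀) = ∫⁻ x, f x ∂(cylX d ρ (x₀ + y)) := by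
  have e : volume (ball (x₀ + y) ρ) = volume (ball x₀ ρ) := by
    rw [Measure.addHaar_ball_center, Measure.addHaar_ball_center volume x₀]
  simp only [cylX, lintegral_smul_measure, e]
  congr 1
  have h := (measurePreserving_add_right (volume : Measure (Spc d)) y).setLIntegral_comp_preimage_emb
    (MeasurableEquiv.addRight y).measurableEmbedding f (ball (x₀ + y) ρ)
  rw [← h]
  congr 2
  ext t; simp

theorem mixN_cyl_add (ρ t₀ : ℝ) (x₀ : Spc d) (F : SpT d → ℝ≥0∞) (w : SpT d) :
    mixN p q (cylT ρ t₀) (cylX d ρ x₀) (fun z => F (z + w))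
      = mixN p q (cylT ρ (t₀ + w.1)) (cylX d ρ (x₀ + w.2)) F := by
  unfold mixN
  rw [← lintegral_cylT_add]
  congr 2
  ext t
  rw [← lintegral_cylX_add]
  rfl

theorem setLIntegral_comp_affine {E : Type*} [NormedAddCommGroup E] [NormedSpace ℝ E]
    [FiniteDimensional ℝ E] [MeasurableSpace E] [BorelSpace E] (μ : Measure E)
    [μ.IsAddHaarMeasure] {r : ℝ} (hr : 0 < r) (x : E) (f : E → ℝ≥0∞) {s t : Set E}
    (hst : (fun y => x + r • y) ⁻¹' t = s) :
    ∫⁻ y in s, f (x + r • y) ∂μ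
      = (ENNReal.ofReal (r ^ Module.finrank ℝ E))⁻¹ * ∫⁻ y in t, f y ∂μ := by
  have hmap : μ.map (fun y => x + r • y) = (ENNReal.ofReal (r ^ Module.finrank ℝ E))⁻¹ • μ := by
    have h1 := Measure.map_addHaar_smul μ hr.ne'
    have : (fun y : E => x + r • y) = (fun y => x + y) ∘ (fun y => r • y) := rfl
    rw [this, ← Measure.map_map (by fun_prop) (by fun_prop), h1, Measure.map_smul, map_add_left_eq_self]
    rw [abs_of_pos (by positivity), ENNReal.ofReal_inv_of_pos (by positivity)]
  have hemb : MeasurableEmbedding fun y : E => x + r • y :=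
    (((Homeomorph.smulOfNeZero r hr.ne').trans (Homeomorph.addLeft x)).measurableEmbedding)
  rw [← hst, ← smul_eq_mul, ← lintegral_smul_measure, ← Measure.restrict_smul, ← hmap,
    hemb.restrict_map, hemb.lintegral_map]

theorem setLIntegral_ball_affine {r : ℝ} (hr : 0 < r) (x : Spc d) (f : Spc d → ℝ≥0∞) :
    ∫⁻ y in ball 0 1, f (x + r • y) = (ENNReal.ofReal (r ^ d))⁻¹ * ∫⁻ y in ball x r, f y := by
  have := setLIntegral_comp_affine volume hr x f (s := ball 0 1) (t := ball x r) (by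
    ext y; simp [norm_smul, abs_of_pos hr, mul_lt_iff_lt_one_right hr])
  simpa using this

theorem setLIntegral_ball_eq_cylX {r : ℝ} (hr : 0 < r) (x : Spc d) (f : Spc d → ℝ≥0∞) :
    ∫⁻ y in ball 0 1, f (x + r • y) = volume (ball (0 : Spc d) 1) * ∫⁻ y, f y ∂(cylX d r x) := by
  have h0 := volume_ball_ne_zero one_pos (0 : Spc d)
  have ht := volume_ball_ne_top (ρ := 1) (0 : Spc d)
  rw [setLIntegral_ball_affine hr, cylX, lintegral_smul_measure, volume_ball_scale hr, smul_eq_mul,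
    ENNReal.mul_inv (Or.inr ht) (Or.inr h0), ← mul_assoc]
  congr 1
  rw [mul_left_comm, ENNReal.mul_inv_cancel h0 ht, mul_one]

theorem setLIntegral_Ico_eq_cylT {r : ℝ} (hr : 0 < r) (t : ℝ) (f : ℝ → ℝ≥0∞) :
    ∫⁻ s in Ico 0 1, f (t + r ^ 2 * s) = ∫⁻ s, f s ∂(cylT r t) := by
  have := setLIntegral_comp_affine volume (pow_pos hr 2) t f (s := Ico 0 1)
    (t := Ico t (t + r ^ 2)) (by
    ext y; simp [pow_pos hr, mul_lt_iff_lt_one_right])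
  simpa [cylT, lintegral_smul_measure] using this

theorem setLIntegral_parabolic_le (hp : 1 < p) (hq : 1 < q) {F : SpT d → ℝ≥0∞}
    (hF : Measurable F) {r : ℝ} (hr : 0 < r) (z : SpT d) :
    ∫⁻ s in Ico (0 : ℝ) 1, ∫⁻ y in ball (0 : Spc d) 1, F (z + (r ^ 2 * s, r • y))
      ≤ volume (ball (0 : Spc d) 1) * mixN p q (cylT r z.1) (cylX d r z.2) F := by
  have := isProbabilityMeasure_cylT hr z.1
  have := isProbabilityMeasure_cylX hr z.2
  have e : ∀ s, ∫⁻ y in ball (0 : Spc d) 1, F (z + (r ^ 2 * s, r • y))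
      = volume (ball (0 : Spc d) 1) * ∫⁻ y, F (z.1 + r ^ 2 * s, y) ∂(cylX d r z.2) := fun s =>
    setLIntegral_ball_eq_cylX hr z.2 fun x => F (z.1 + r ^ 2 * s, x)
  simp_rw [e]
  rw [lintegral_const_mul' _ _ (volume_ball_ne_top _),
    setLIntegral_Ico_eq_cylT hr z.1 fun t => ∫⁻ y, F (t, y) ∂(cylX d r z.2)]
  gcongr
  exact lintegral_le_mixN hp hq hF

end

theorem mixN_restrict {T X : Type*} [MeasurableSpace T] [MeasurableSpace X] {p q : ℝ}
    (hp : 1 < p) (μ : Measure T) (ν : Measure X) {A : Set X} (hA : MeasurableSet A)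
    (F : T × X → ℝ≥0∞) :
    mixN p q μ (ν.restrict A) F = mixN p q μ ν (fun z => A.indicator (fun x => F (z.1, x)) z.2) := by
  have hp0 : 0 < p := by linarith
  unfold mixN
  congr 2
  ext t
  rw [← lintegral_indicator hA]
  congr 2
  ext x
  by_cases hx : x ∈ A <;> simp [hx, hp0]

/-- Balls of radius `2 * ρ` are controlled by the Morrey norm of radius `ρ`. -/
theorem exists_mixN_double_le (d : ℕ) {p q : ℝ} (β : ℝ) (hp : 1 < p) (hq : 1 < q) :
    ∃ N : ℝ≥0, ∀ F : SpT d → ℝ≥0∞, Measurable F → ∀ ρ, 0 < ρ → ρ ≤ 1 → ∀ t₀ x₀,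
      mixN p q (cylT ρ t₀) ((volume (ball x₀ ρ))⁻¹ • volume.restrict (ball x₀ (2 * ρ))) F
        ≤ ENNReal.ofReal (ρ ^ (-β)) * (N * morreyE d p q β F) := by
  obtain ⟨S, -, hSf, hS⟩ := finite_cover_balls_of_compact (isCompact_closedBall (0 : Spc d) 2) one_pos
  have : Fintype S := hSf.fintype
  refine ⟨Fintype.card S, fun F hF ρ hρ hρ1 t₀ x₀ => ?_⟩
  have hvol : ∀ y, volume (ball (x₀ + y) ρ) = volume (ball x₀ ρ) := fun y => by
    rw [Measure.addHaar_ball_center, Measure.addHaar_ball_center volume x₀]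
  set ν : Measure (Spc d) := (volume (ball x₀ ρ))⁻¹ • volume with hν
  have hm : ∀ A : Set (Spc d), MeasurableSet A →
      Measurable fun z : SpT d => A.indicator (fun x => F (z.1, x)) z.2 := fun A hA => by
    have : (fun z : SpT d => A.indicator (fun x => F (z.1, x)) z.2)
        = (Prod.snd ⁻¹' A).indicator F := by
      ext z; by_cases hz : z.2 ∈ A <;> simp [hz]
    rw [this]
    exact hF.indicator (measurable_snd hA)
  rw [← Measure.restrict_smul, ← hν, mixN_restrict hp _ _ measurableSet_ball]
  calc _ ≤ mixN p q (cylT ρ t₀) ν (fun z => ∑ y : S,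
        (ball (x₀ + ρ • (y : Spc d)) ρ).indicator (fun x => F (z.1, x)) z.2) := by
        refine mixN_mono hp hq fun z => ?_
        refine indicator_apply_le' (fun hz => ?_) (fun _ => by positivity)
        have hz' : ρ⁻¹ • (z.2 - x₀) ∈ closedBall (0 : Spc d) 2 := by
          rw [mem_ball, dist_eq_norm] at hz
          rw [mem_closedBall_zero_iff, norm_smul, norm_inv, Real.norm_eq_abs, abs_of_pos hρ,
            inv_mul_le_iff₀ hρ]
          linarith
        obtain ⟨y, hyS, hy⟩ := mem_iUnion₂.1 (hS hz')
        have hmem : z.2 ∈ ball (x₀ + ρ • y) ρ := by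
          rw [mem_ball, dist_eq_norm] at hy ⊢
          have : z.2 - (x₀ + ρ • y) = ρ • (ρ⁻¹ • (z.2 - x₀) - y) := by
            rw [smul_sub, smul_inv_smul₀ hρ.ne']; abel
          rw [this, norm_smul, Real.norm_eq_abs, abs_of_pos hρ]
          nlinarith
        refine le_trans ?_ (Finset.single_le_sum (f := fun y : S =>
          (ball (x₀ + ρ • (y : Spc d)) ρ).indicator (fun x => F (z.1, x)) z.2)
          (fun _ _ => by positivity) (Finset.mem_univ ⟨y, hyS⟩))
        simp only [indicator_of_mem hmem]
        exact le_rfl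
    _ ≤ ∑ y : S, mixN p q (cylT ρ t₀) ν (fun z =>
        (ball (x₀ + ρ • (y : Spc d)) ρ).indicator (fun x => F (z.1, x)) z.2) :=
        mixN_sum_le hp hq fun y => hm _ measurableSet_ball
    _ ≤ ∑ y : S, ENNReal.ofReal (ρ ^ (-β)) * morreyE d p q β F := by
        refine Finset.sum_le_sum fun y _ => ?_
        rw [← mixN_restrict hp _ _ measurableSet_ball, hν, Measure.restrict_smul,
          ← hvol (ρ • (y : Spc d))]
        exact mixN_cyl_le hρ hρ1 t₀ _ F
    _ = _ := by simp [mul_left_comm]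

/-- The unnormalized average `∫_{B_1} f(x + r y) dy`. -/
def ballAv {d : ℕ} (r : ℝ) (f : Spc d → ℝ≥0∞) (x : Spc d) : ℝ≥0∞ :=
  ∫⁻ y in ball (0 : Spc d) 1, f (x + r • y)

section ballAv
variable {d : ℕ}

theorem measurable_ballAv_uncurry {f : Spc d → ℝ≥0∞} (hf : Measurable f) :
    Measurable fun w : ℝ × Spc d => ballAv w.1 f w.2 := by
  have : Measurable fun w : (ℝ × Spc d) × Spc d => f (w.1.2 + w.1.1 • w.2) :=
    hf.comp (by fun_prop)
  exact this.lintegral_prod_right'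

theorem measurable_ballAv {f : Spc d → ℝ≥0∞} (hf : Measurable f) (r : ℝ) :
    Measurable (ballAv r f) :=
  (measurable_ballAv_uncurry hf).comp (measurable_prodMk_left (x := r))

theorem measurable_ballAv_left {f : Spc d → ℝ≥0∞} (hf : Measurable f) (x : Spc d) :
    Measurable fun r => ballAv r f x :=
  (measurable_ballAv_uncurry hf).comp (measurable_prodMk_right (y := x))

theorem ballAv_add {f g : Spc d → ℝ≥0∞} (hf : Measurable f) (r : ℝ) (x : Spc d) :
    ballAv r (fun x => f x + g x) x = ballAv r f x + ballAv r g x :=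
  lintegral_add_left (hf.comp (by fun_prop)) _

theorem ballAv_le_of_subset {r r' : ℝ} (hr : 0 < r) (hr' : 0 < r') {x x' : Spc d}
    (h : ball x r ⊆ ball x' r') (f : Spc d → ℝ≥0∞) :
    ballAv r f x ≤ ENNReal.ofReal ((r' / r) ^ d) * ballAv r' f x' := by
  unfold ballAv
  rw [setLIntegral_ball_affine hr, setLIntegral_ball_affine hr', ← mul_assoc]
  have e : (ENNReal.ofReal (r ^ d))⁻¹
      = ENNReal.ofReal ((r' / r) ^ d) * (ENNReal.ofReal (r' ^ d))⁻¹ := by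
    rw [← ENNReal.ofReal_inv_of_pos (by positivity), ← ENNReal.ofReal_inv_of_pos (by positivity),
      ← ENNReal.ofReal_mul (by positivity)]
    congr 1; rw [div_pow]; field_simp
  rw [e]
  gcongr

theorem ballAv_le_double {r : ℝ} (hr : 0 < r) {x x' : Spc d} (h : ‖x - x'‖ ≤ r)
    (f : Spc d → ℝ≥0∞) : ballAv r f x ≤ 2 ^ d * ballAv (2 * r) f x' := by
  have hs : ball x r ⊆ ball x' (2 * r) := ball_subset_ball' (by rw [dist_eq_norm]; linarith)
  have := ballAv_le_of_subset hr (by positivity) hs f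
  rwa [mul_div_assoc, div_self hr.ne', mul_one, ENNReal.ofReal_pow (by norm_num),
    ENNReal.ofReal_ofNat] at this

theorem ballAv_ballAv_le {f : Spc d → ℝ≥0∞} (hf : Measurable f) {r ρ : ℝ} (hr : 0 < r)
    (hρ : 0 < ρ) (x : Spc d) :
    ballAv ρ (ballAv r f) x
      ≤ volume (ball (0 : Spc d) 1) * 2 ^ d * ballAv (2 * max r ρ) f x := by
  have key : ∀ {a b : ℝ}, 0 < a → 0 < b → a ≤ b →
      ∫⁻ y in ball (0 : Spc d) 1, ballAv b f (x + a • y)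
        ≤ volume (ball (0 : Spc d) 1) * 2 ^ d * ballAv (2 * b) f x := by
    intro a b ha hb hab
    calc _ ≤ ∫⁻ y in ball (0 : Spc d) 1, 2 ^ d * ballAv (2 * b) f x := by
          refine setLIntegral_mono' measurableSet_ball fun y hy => ballAv_le_double hb ?_ f
          rw [mem_ball_zero_iff] at hy
          rw [add_sub_cancel_left, norm_smul, Real.norm_eq_abs, abs_of_pos ha]
          nlinarith [norm_nonneg y]
      _ = _ := by rw [setLIntegral_const]; ring
  rcases le_total r ρ with h | h
  · rw [max_eq_right h]
    refine le_trans (le_of_eq ?_) (key hr hρ h)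
    unfold ballAv
    have hm : Measurable fun w : Spc d × Spc d => f (x + ρ • w.1 + r • w.2) :=
      hf.comp (by fun_prop)
    rw [lintegral_lintegral_swap hm.aemeasurable]
    refine lintegral_congr fun y => lintegral_congr fun z => ?_
    congr 1; abel
  · rw [max_eq_left h]; exact key hρ hr h

theorem lintegral_mul_ballAv {f g : Spc d → ℝ≥0∞} (hf : Measurable f) (hg : Measurable g)
    (r : ℝ) : ∫⁻ x, f x * ballAv r g x = ∫⁻ x, g x * ballAv r f x := by
  have e : ∀ {a b : Spc d → ℝ≥0∞}, Measurable a → Measurable b →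
      ∫⁻ x, a x * ballAv r b x = ∫⁻ y in ball (0 : Spc d) 1, ∫⁻ x, a x * b (x + r • y) := by
    intro a b ha hb
    rw [lintegral_lintegral_swap]
    · refine lintegral_congr fun x => ?_
      exact (lintegral_const_mul _ (hb.comp (by fun_prop))).symm
    · exact ((ha.comp measurable_snd).mul (hb.comp (by fun_prop))).aemeasurable
  rw [e hf hg, e hg hf]
  have hneg := (Measure.measurePreserving_neg (volume : Measure (Spc d))).setLIntegral_comp_preimage_emb
    (MeasurableEquiv.neg (Spc d)).measurableEmbedding
    (fun y => ∫⁻ x, g x * f (x + r • y)) (ball 0 1)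
  rw [← hneg]
  have : Neg.neg ⁻¹' ball (0 : Spc d) 1 = ball 0 1 := by ext; simp
  rw [this]
  refine lintegral_congr fun y => ?_
  refine (lintegral_congr fun x => ?_).trans
    (lintegral_add_right_eq_self (fun x => g x * f (x + r • -y)) (r • y))
  simp [mul_comm]

theorem lintegral_rpow_le_of_le_one {Ω : Type*} [MeasurableSpace Ω] (μ : Measure Ω) {θ : ℝ}
    (h0 : 0 ≤ θ) (h1 : θ ≤ 1) {f : Ω → ℝ≥0∞} (hf : AEMeasurable f μ) :
    ∫⁻ x, f x ^ θ ∂μ ≤ (∫⁻ x, f x ∂μ) ^ θ * μ univ ^ (1 - θ) := by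
  have := ENNReal.lintegral_mul_norm_pow_le hf (aemeasurable_const (b := (1 : ℝ≥0∞))) h0
    (sub_nonneg.2 h1) (by ring)
  simpa using this

theorem ballAv_rpow_le {θ : ℝ} (h0 : 0 ≤ θ) (h1 : θ ≤ 1) {f : Spc d → ℝ≥0∞} (hf : Measurable f)
    (r : ℝ) (x : Spc d) : ballAv r (fun x => f x ^ θ) x
      ≤ volume (ball (0 : Spc d) 1) ^ (1 - θ) * ballAv r f x ^ θ := by
  have := lintegral_rpow_le_of_le_one (volume.restrict (ball (0 : Spc d) 1)) h0 h1
    (f := fun y => f (x + r • y)) (hf.comp (by fun_prop)).aemeasurable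
  rw [Measure.restrict_apply_univ, mul_comm] at this
  exact this

end ballAv

theorem lintegral_Ioc_rpow {a ℓ : ℝ} (ha : -1 < a) (hℓ : 0 ≤ ℓ) :
    ∫⁻ r in Ioc 0 ℓ, ENNReal.ofReal (r ^ a) = ENNReal.ofReal (ℓ ^ (a + 1) / (a + 1)) := by
  have hi := (intervalIntegral.intervalIntegrable_rpow' (a := 0) (b := ℓ) ha)
  rw [intervalIntegrable_iff_integrableOn_Ioc_of_le hℓ] at hi
  rw [← ofReal_integral_eq_lintegral_ofReal hi
    ((ae_restrict_iff' measurableSet_Ioc).2 (.of_forall fun r hr => Real.rpow_nonneg hr.1.le _)),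
    ← intervalIntegral.integral_of_le hℓ, integral_rpow (Or.inl ha),
    Real.zero_rpow (by linarith), sub_zero]

theorem lintegral_Ioi_rpow {a ℓ : ℝ} (ha : a < -1) (hℓ : 0 < ℓ) :
    ∫⁻ r in Ioi ℓ, ENNReal.ofReal (r ^ a) = ENNReal.ofReal (ℓ ^ (a + 1) / (-a - 1)) := by
  rw [← ofReal_integral_eq_lintegral_ofReal (integrableOn_Ioi_rpow_of_lt ha hℓ)
    ((ae_restrict_iff' measurableSet_Ioi).2 (.of_forall fun r hr =>
      Real.rpow_nonneg (hℓ.trans hr).le _)), integral_Ioi_rpow_of_lt ha hℓ]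
  congr 1
  rw [← neg_div_neg_eq, neg_neg]; congr 1; ring

theorem ofReal_rpow_rpow {r : ℝ} (hr : 0 < r) (a b : ℝ) :
    ENNReal.ofReal (r ^ a) ^ b = ENNReal.ofReal (r ^ (a * b)) := by
  rw [ENNReal.ofReal_rpow_of_pos (by positivity), ← Real.rpow_mul hr.le]

theorem ofReal_rpow_mul_rpow {r : ℝ} (hr : 0 < r) (a b : ℝ) :
    ENNReal.ofReal (r ^ a) * ENNReal.ofReal (r ^ b) = ENNReal.ofReal (r ^ (a + b)) := by
  rw [← ENNReal.ofReal_mul (by positivity), ← Real.rpow_add hr]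

/-- A Hedberg type splitting: two competing power bounds integrate to an intermediate power. -/
theorem lintegral_Ioc_le_of_rpow_bounds {D : ℝ → ℝ≥0∞} {c₁ c₂ X : ℝ≥0∞} {R p κ : ℝ}
    (hp : 1 < p) (hκ : κ < 1) (hX : 1 ≤ X)
    (h₁ : ∀ r ∈ Ioc 0 R, D r ≤ c₁ * ENNReal.ofReal (r ^ (-p)))
    (h₂ : ∀ r ∈ Ioc 0 R, D r ≤ c₂ * X * ENNReal.ofReal (r ^ (-κ))) :
    ∫⁻ r in Ioc 0 R, D r
      ≤ (c₁ * ENNReal.ofReal (1 / (p - 1)) + c₂ * ENNReal.ofReal (1 / (1 - κ)) + 1)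
        * X ^ ((p - 1) / (p - κ)) := by
  have hpκ : 0 < p - κ := by linarith
  have hp1 : 0 < p - 1 := by linarith
  have hκ1 : 0 < 1 - κ := by linarith
  rcases eq_or_ne X ⊤ with rfl | hXt
  · rw [ENNReal.top_rpow_of_pos (by positivity), ENNReal.mul_top (by simp)]; exact le_top
  obtain ⟨x, rfl⟩ : ∃ x : ℝ≥0, X = x := ⟨X.toNNReal, (ENNReal.coe_toNNReal hXt).symm⟩
  have hx : 1 ≤ x := by exact_mod_cast hX
  have hx0 : 0 < (x : ℝ) := lt_of_lt_of_le one_pos (by exact_mod_cast hx)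
  set ℓ : ℝ := (x : ℝ) ^ (-1 / (p - κ)) with hℓ
  have hℓ0 : 0 < ℓ := by positivity
  have hxe : (x : ℝ≥0∞) = ENNReal.ofReal ((x : ℝ) ^ (1 : ℝ)) := by simp
  have hxp : (x : ℝ≥0∞) ^ ((p - 1) / (p - κ)) = ENNReal.ofReal ((x : ℝ) ^ ((p - 1) / (p - κ))) := by
    rw [hxe, ofReal_rpow_rpow hx0, one_mul]
  have b1 : ∫⁻ r, (Ioc 0 ℓ).indicator (fun r => c₂ * x * ENNReal.ofReal (r ^ (-κ))) r
      = c₂ * ENNReal.ofReal (1 / (1 - κ)) * (x : ℝ≥0∞) ^ ((p - 1) / (p - κ)) := by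
    rw [lintegral_indicator measurableSet_Ioc, lintegral_const_mul _ (by fun_prop),
      lintegral_Ioc_rpow (by linarith) hℓ0.le, hxp, mul_assoc, mul_assoc, hxe,
      ← ENNReal.ofReal_mul (by positivity), ← ENNReal.ofReal_mul (by positivity), hℓ,
      ← Real.rpow_mul hx0.le, ← mul_div_assoc, ← Real.rpow_add hx0]
    congr 2
    rw [show 1 + -1 / (p - κ) * (-κ + 1) = (p - 1) / (p - κ) by field_simp; ring, neg_add_eq_sub]
    ring
  have b2 : ∫⁻ r, (Ioi ℓ).indicator (fun r => c₁ * ENNReal.ofReal (r ^ (-p))) r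
      = c₁ * ENNReal.ofReal (1 / (p - 1)) * (x : ℝ≥0∞) ^ ((p - 1) / (p - κ)) := by
    rw [lintegral_indicator measurableSet_Ioi, lintegral_const_mul _ (by fun_prop),
      lintegral_Ioi_rpow (by linarith) hℓ0, hxp, mul_assoc,
      ← ENNReal.ofReal_mul (by positivity), hℓ, ← Real.rpow_mul hx0.le]
    congr 2
    rw [show -1 / (p - κ) * (-p + 1) = (p - 1) / (p - κ) by field_simp; ring, neg_neg]
    ring
  calc ∫⁻ r in Ioc 0 R, D r
      ≤ ∫⁻ r in Ioc 0 R, ((Ioc 0 ℓ).indicator (fun r => c₂ * x * ENNReal.ofReal (r ^ (-κ))) r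
          + (Ioi ℓ).indicator (fun r => c₁ * ENNReal.ofReal (r ^ (-p))) r) := by
        refine setLIntegral_mono' measurableSet_Ioc fun r hr => ?_
        rcases le_or_gt r ℓ with h | h
        · rw [indicator_of_mem (mem_Ioc.2 ⟨hr.1, h⟩)]
          exact (h₂ r hr).trans le_self_add
        · rw [indicator_of_mem (mem_Ioi.2 h) ]
          exact (h₁ r hr).trans le_add_self
    _ ≤ ∫⁻ r, ((Ioc 0 ℓ).indicator (fun r => c₂ * x * ENNReal.ofReal (r ^ (-κ))) r
          + (Ioi ℓ).indicator (fun r => c₁ * ENNReal.ofReal (r ^ (-p))) r) :=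
        setLIntegral_le_lintegral _ _
    _ = _ + _ := lintegral_add_left ((by fun_prop : Measurable fun r : ℝ =>
        c₂ * x * ENNReal.ofReal (r ^ (-κ))).indicator measurableSet_Ioc) _
    _ ≤ _ := by
        rw [b1, b2, add_mul, add_mul]
        rw [add_comm (c₂ * _ * _)]
        exact le_self_add

section weight
variable {d : ℕ}

/-- A truncated Riesz type potential of `μ`, shifted by one. -/
def rieszPot (R α : ℝ) (μ : Spc d → ℝ≥0∞) (x : Spc d) : ℝ≥0∞ :=
  1 + ∫⁻ r in Ioc 0 R, ENNReal.ofReal (r ^ (α - 1)) * ballAv r μ x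

theorem measurable_rieszPot {R α : ℝ} {μ : Spc d → ℝ≥0∞} (hμ : Measurable μ) :
    Measurable (rieszPot R α μ) := by
  have : Measurable fun w : Spc d × ℝ => ENNReal.ofReal (w.2 ^ (α - 1)) * ballAv w.2 μ w.1 :=
    (by fun_prop : Measurable fun w : Spc d × ℝ => ENNReal.ofReal (w.2 ^ (α - 1))).mul
      ((measurable_ballAv_uncurry hμ).comp measurable_swap)
  exact measurable_const.add this.lintegral_prod_right'

theorem one_le_rieszPot {R α : ℝ} {μ : Spc d → ℝ≥0∞} (x : Spc d) : 1 ≤ rieszPot R α μ x :=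
  le_self_add

variable {R α s : ℝ} {μ : Spc d → ℝ≥0∞} {K : ℝ≥0}

theorem rpow_mul_ballAv_le_rieszPot (hR : 0 < R) (hα0 : 0 < α) (hα1 : α < 1) (hs : 1 < s)
    (h : ∀ r x, 0 < r → r ≤ 2 * R → ballAv r μ x ≤ K * ENNReal.ofReal (r ^ (-s)))
    {r : ℝ} (hr : 0 < r) (hrR : r ≤ 2 * R) (x : Spc d) :
    ENNReal.ofReal (r ^ α) * ballAv r μ x
      ≤ (2 ^ (d + 1) + K * ENNReal.ofReal ((R / 2) ^ (α - s))) * rieszPot R α μ x := by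
  rcases le_or_gt r (R / 2) with hc | hc
  · have h2 : ENNReal.ofReal (r ^ α) * ballAv r μ x ≤ 2 ^ (d + 1) * rieszPot R α μ x := by
      have hint : ∫⁻ τ in Ioc r (2 * r), ENNReal.ofReal ((2 * r) ^ (α - 1)) * ballAv r μ x
          ≤ 2 ^ d * rieszPot R α μ x := by
        calc _ ≤ ∫⁻ τ in Ioc r (2 * r),
              2 ^ d * (ENNReal.ofReal (τ ^ (α - 1)) * ballAv τ μ x) := by
              refine setLIntegral_mono' measurableSet_Ioc fun τ hτ => ?_
              have hτ0 : 0 < τ := hr.trans hτ.1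
              have e1 : ENNReal.ofReal ((2 * r) ^ (α - 1)) ≤ ENNReal.ofReal (τ ^ (α - 1)) :=
                ENNReal.ofReal_le_ofReal
                  (Real.rpow_le_rpow_of_nonpos hτ0 hτ.2 (by linarith))
              have e2 : ballAv r μ x ≤ 2 ^ d * ballAv τ μ x := by
                refine (ballAv_le_of_subset hr hτ0 (ball_subset_ball hτ.1.le) μ).trans ?_
                gcongr
                rw [ENNReal.ofReal_pow (by positivity)]
                gcongr
                rw [← ENNReal.ofReal_ofNat 2]
                exact ENNReal.ofReal_le_ofReal ((div_le_iff₀ hr).2 hτ.2)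
              calc _ ≤ ENNReal.ofReal (τ ^ (α - 1)) * (2 ^ d * ballAv τ μ x) := by gcongr
                _ = _ := by ring
          _ = 2 ^ d * ∫⁻ τ in Ioc r (2 * r), ENNReal.ofReal (τ ^ (α - 1)) * ballAv τ μ x :=
              lintegral_const_mul' _ _ (by simp)
          _ ≤ 2 ^ d * rieszPot R α μ x := by
              gcongr
              refine le_trans (lintegral_mono_set ?_) le_add_self
              exact Ioc_subset_Ioc hr.le (by linarith)
      rw [setLIntegral_const, Real.volume_Ioc] at hint
      have e3 : ENNReal.ofReal (r ^ α) ≤ 2 * (ENNReal.ofReal ((2 * r) ^ (α - 1))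
          * ENNReal.ofReal (2 * r - r)) := by
        rw [← ENNReal.ofReal_mul (by positivity), ← ENNReal.ofReal_ofNat 2,
          ← ENNReal.ofReal_mul (by norm_num)]
        refine ENNReal.ofReal_le_ofReal ?_
        have : 2 * ((2 * r) ^ (α - 1) * (2 * r - r)) = (2 * r) ^ α := by
          rw [Real.rpow_sub_one (by positivity)]; field_simp; ring
        rw [this]
        exact Real.rpow_le_rpow hr.le (by linarith) hα0.le
      calc _ ≤ 2 * (ENNReal.ofReal ((2 * r) ^ (α - 1))
          * ENNReal.ofReal (2 * r - r)) * ballAv r μ x := by gcongr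
        _ = 2 * (ENNReal.ofReal ((2 * r) ^ (α - 1)) * ballAv r μ x
          * ENNReal.ofReal (2 * r - r)) := by ring
        _ ≤ 2 * (2 ^ d * rieszPot R α μ x) := by gcongr
        _ = _ := by ring
    refine h2.trans ?_
    gcongr
    exact le_self_add
  · calc _ ≤ ENNReal.ofReal (r ^ α) * (K * ENNReal.ofReal (r ^ (-s))) := by
          gcongr; exact h r x hr hrR
      _ = K * ENNReal.ofReal (r ^ (α - s)) := by
          rw [mul_left_comm, ofReal_rpow_mul_rpow hr, sub_eq_add_neg]
      _ ≤ K * ENNReal.ofReal ((R / 2) ^ (α - s)) := by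
          exact mul_le_mul_right (ENNReal.ofReal_le_ofReal
              (Real.rpow_le_rpow_of_nonpos (by positivity) hc.le (by linarith))) _
      _ ≤ (2 ^ (d + 1) + K * ENNReal.ofReal ((R / 2) ^ (α - s))) * 1 := by
          rw [mul_one]; exact le_add_self
      _ ≤ _ := by gcongr; exact one_le_rieszPot x

theorem ballAv_rieszPot_le (hμ : Measurable μ) {ρ : ℝ} (hρ : 0 < ρ) (x : Spc d) :
    ballAv ρ (rieszPot R α μ) x ≤ volume (ball (0 : Spc d) 1) * (1 + 2 ^ d *
      ∫⁻ r in Ioc 0 R, ENNReal.ofReal (r ^ (α - 1)) * ballAv (2 * max r ρ) μ x) := by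
  have hm : Measurable fun w : Spc d × ℝ =>
      ENNReal.ofReal (w.2 ^ (α - 1)) * ballAv w.2 μ (x + ρ • w.1) :=
    (by fun_prop : Measurable fun w : Spc d × ℝ => ENNReal.ofReal (w.2 ^ (α - 1))).mul
      ((measurable_ballAv_uncurry hμ).comp (by fun_prop :
        Measurable fun w : Spc d × ℝ => (w.2, x + ρ • w.1)))
  unfold ballAv rieszPot
  rw [lintegral_add_left measurable_const, setLIntegral_const, one_mul, mul_add, mul_one]
  gcongr
  rw [lintegral_lintegral_swap hm.aemeasurable, ← mul_assoc,
    ← lintegral_const_mul' _ _ (ENNReal.mul_ne_top measure_ball_lt_top.ne (by simp))]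
  refine setLIntegral_mono' measurableSet_Ioc fun r hr => ?_
  rw [lintegral_const_mul' _ _ ENNReal.ofReal_ne_top, mul_left_comm]
  gcongr
  exact ballAv_ballAv_le hμ hr.1 hρ x

theorem ballAv_rieszPot_le_rpow (hμ : Measurable μ) (hR1 : 2 * R ≤ 1)
    (hα0 : 0 < α) (hα1 : α < 1) (hs : 1 < s)
    (h : ∀ r x, 0 < r → r ≤ 2 * R → ballAv r μ x ≤ K * ENNReal.ofReal (r ^ (-s)))
    {ρ : ℝ} (hρ : 0 < ρ) (hρR : ρ ≤ R) (x : Spc d) :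
    ballAv ρ (rieszPot R α μ) x ≤ volume (ball (0 : Spc d) 1) *
      (1 + 2 ^ d * (K * ENNReal.ofReal (1 / α + 1 / (s - α)))) * ENNReal.ofReal (ρ ^ (α - s)) := by
  refine (ballAv_rieszPot_le hμ hρ x).trans ?_
  have hsα : 0 < s - α := by linarith
  have hmain : ∫⁻ r in Ioc 0 R, ENNReal.ofReal (r ^ (α - 1)) * ballAv (2 * max r ρ) μ x
      ≤ K * ENNReal.ofReal (1 / α + 1 / (s - α)) * ENNReal.ofReal (ρ ^ (α - s)) := by
    calc _ ≤ ∫⁻ r in Ioc 0 R, K *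
          ((Ioc 0 ρ).indicator (fun r => ENNReal.ofReal (ρ ^ (-s)) * ENNReal.ofReal (r ^ (α - 1))) r
          + (Ioi ρ).indicator (fun r => ENNReal.ofReal (r ^ (α - 1 - s))) r) := by
          refine setLIntegral_mono' measurableSet_Ioc fun r hr => ?_
          have hm0 : 0 < max r ρ := lt_max_of_lt_right hρ
          have hb : ballAv (2 * max r ρ) μ x ≤ K * ENNReal.ofReal (max r ρ ^ (-s)) := by
            refine (h _ x (by positivity) ?_).trans ?_
            · have := max_le hr.2 hρR; linarith
            · exact mul_le_mul_right (ENNReal.ofReal_le_ofReal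
              (Real.rpow_le_rpow_of_nonpos hm0 (by linarith) (by linarith))) _
          refine (mul_le_mul_right hb _).trans ?_
          rw [mul_left_comm]
          gcongr
          rcases le_or_gt r ρ with hc | hc
          · rw [indicator_of_mem (mem_Ioc.2 ⟨hr.1, hc⟩), max_eq_right hc, mul_comm]
            exact le_self_add
          · rw [indicator_of_mem (mem_Ioi.2 hc), max_eq_left hc.le,
              ofReal_rpow_mul_rpow hr.1, ← sub_eq_add_neg]
            exact le_add_self
      _ ≤ ∫⁻ r, K *
          ((Ioc 0 ρ).indicator (fun r => ENNReal.ofReal (ρ ^ (-s)) * ENNReal.ofReal (r ^ (α - 1))) r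
          + (Ioi ρ).indicator (fun r => ENNReal.ofReal (r ^ (α - 1 - s))) r) :=
          setLIntegral_le_lintegral _ _
      _ = K * (ENNReal.ofReal (ρ ^ (-s)) * ENNReal.ofReal (ρ ^ (α - 1 + 1) / (α - 1 + 1))
          + ENNReal.ofReal (ρ ^ (α - 1 - s + 1) / (-(α - 1 - s) - 1))) := by
          rw [lintegral_const_mul' _ _ (by simp), lintegral_add_left
            ((by fun_prop : Measurable fun r : ℝ => ENNReal.ofReal (ρ ^ (-s))
              * ENNReal.ofReal (r ^ (α - 1))).indicator measurableSet_Ioc),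
            lintegral_indicator measurableSet_Ioc, lintegral_indicator measurableSet_Ioi,
            lintegral_const_mul' _ _ ENNReal.ofReal_ne_top, lintegral_Ioc_rpow (by linarith) hρ.le,
            lintegral_Ioi_rpow (by linarith) hρ]
      _ = _ := by
          have e1 : α - 1 - s + 1 = α - s := by ring
          have e2 : -(α - 1 - s) - 1 = s - α := by ring
          rw [sub_add_cancel, e1, e2, ← ENNReal.ofReal_mul (by positivity),
            ← ENNReal.ofReal_add (by positivity) (by positivity), mul_assoc,
            ← ENNReal.ofReal_mul (by positivity), ← mul_div_assoc, ← Real.rpow_add hρ]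
          congr 2
          rw [show -s + α = α - s by ring]; ring
  have h1 : (1 : ℝ≥0∞) ≤ ENNReal.ofReal (ρ ^ (α - s)) := by
    rw [← ENNReal.ofReal_one]
    exact ENNReal.ofReal_le_ofReal
      (Real.one_le_rpow_of_pos_of_le_one_of_nonpos hρ (by linarith) (by linarith))
  rw [mul_assoc, add_mul, one_mul, mul_assoc]
  gcongr

theorem ballAv_rieszPot_le_self (hμ : Measurable μ) (hR : 0 < R)
    (hα0 : 0 < α) (hα1 : α < 1) (hs : 1 < s)
    (h : ∀ r x, 0 < r → r ≤ 2 * R → ballAv r μ x ≤ K * ENNReal.ofReal (r ^ (-s)))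
    {ρ : ℝ} (hρ : 0 < ρ) (hρR : ρ ≤ R) (x : Spc d) :
    ballAv ρ (rieszPot R α μ) x ≤ volume (ball (0 : Spc d) 1) *
      (1 + 2 ^ d * (ENNReal.ofReal (1 / α) *
        (2 ^ (d + 1) + K * ENNReal.ofReal ((R / 2) ^ (α - s)))
        + 2 * (1 + K * ENNReal.ofReal (R ^ (α - s))))) * rieszPot R α μ x := by
  refine (ballAv_rieszPot_le hμ hρ x).trans ?_
  have hG := one_le_rieszPot (R := R) (α := α) (μ := μ) x
  have hfar : ∫⁻ r in Ioc 0 R, ENNReal.ofReal (r ^ (α - 1)) * ballAv (2 * r) μ x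
      ≤ 2 * (1 + K * ENNReal.ofReal (R ^ (α - s))) * rieszPot R α μ x := by
    set φ : ℝ → ℝ≥0∞ := fun τ => ENNReal.ofReal (τ ^ (α - 1)) * ballAv τ μ x with hφ
    have hcv := setLIntegral_comp_affine (volume : Measure ℝ) two_pos 0 φ
      (s := Ioc 0 R) (t := Ioc 0 (2 * R)) (by ext y; simp)
    have htail : ∫⁻ τ in Ioc R (2 * R), φ τ ≤ K * ENNReal.ofReal (R ^ (α - s)) := by
      calc _ ≤ ∫⁻ τ in Ioc R (2 * R), K * ENNReal.ofReal (R ^ (α - s - 1)) := by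
            refine setLIntegral_mono' measurableSet_Ioc fun τ hτ => ?_
            have hτ0 : 0 < τ := hR.trans hτ.1
            refine (mul_le_mul_right (h τ x hτ0 hτ.2) _).trans ?_
            rw [mul_left_comm, ofReal_rpow_mul_rpow hτ0,
              show α - 1 + -s = α - s - 1 by ring]
            exact mul_le_mul_right (ENNReal.ofReal_le_ofReal
              (Real.rpow_le_rpow_of_nonpos hR hτ.1.le (by linarith))) _
        _ = _ := by
            rw [setLIntegral_const, Real.volume_Ioc, mul_assoc,
              ← ENNReal.ofReal_mul (by positivity), Real.rpow_sub_one hR.ne']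
            congr 2; field_simp; ring
    calc _ ≤ ∫⁻ r in Ioc 0 R, 2 * φ (0 + (2 : ℝ) • r) := by
          refine setLIntegral_mono' measurableSet_Ioc fun r hr => ?_
          rw [hφ, zero_add, smul_eq_mul, ← mul_assoc]
          gcongr
          rw [← ENNReal.ofReal_ofNat 2, ← ENNReal.ofReal_mul (by norm_num)]
          refine ENNReal.ofReal_le_ofReal ?_
          rw [Real.mul_rpow (by norm_num) hr.1.le, ← mul_assoc]
          have : (2 : ℝ) * 2 ^ (α - 1) = 2 ^ α := by
            rw [Real.rpow_sub_one (by norm_num)]; ring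
          rw [this]
          exact le_mul_of_one_le_left (Real.rpow_nonneg hr.1.le _)
            (Real.one_le_rpow (by norm_num) hα0.le)
      _ = ∫⁻ τ in Ioc 0 (2 * R), φ τ := by
          rw [lintegral_const_mul' _ _ (by simp), hcv, ← mul_assoc, Module.finrank_self, pow_one,
            ENNReal.ofReal_ofNat, ENNReal.mul_inv_cancel (by simp) (by simp), one_mul]
      _ ≤ (∫⁻ τ in Ioc 0 R, φ τ) + ∫⁻ τ in Ioc R (2 * R), φ τ := by
          rw [← Ioc_union_Ioc_eq_Ioc hR.le (by linarith : R ≤ 2 * R)]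
          exact lintegral_union_le _ _ _
      _ ≤ rieszPot R α μ x + K * ENNReal.ofReal (R ^ (α - s)) * rieszPot R α μ x :=
          add_le_add le_add_self (htail.trans (le_mul_of_one_le_right' hG))
      _ = 1 * ((1 + K * ENNReal.ofReal (R ^ (α - s))) * rieszPot R α μ x) := by ring
      _ ≤ 2 * ((1 + K * ENNReal.ofReal (R ^ (α - s))) * rieszPot R α μ x) := by
          gcongr; norm_num
      _ = _ := by ring
  have hnear : ∫⁻ r in Ioc 0 ρ, ENNReal.ofReal (r ^ (α - 1)) * ballAv (2 * ρ) μ x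
      ≤ ENNReal.ofReal (1 / α) * (2 ^ (d + 1) + K * ENNReal.ofReal ((R / 2) ^ (α - s)))
        * rieszPot R α μ x := by
    rw [lintegral_mul_const _ (by fun_prop), lintegral_Ioc_rpow (by linarith) hρ.le,
      sub_add_cancel, mul_assoc]
    have hd := rpow_mul_ballAv_le_rieszPot hR hα0 hα1 hs h (r := 2 * ρ) (by positivity)
      (by linarith) x
    calc _ ≤ ENNReal.ofReal (1 / α) * (ENNReal.ofReal ((2 * ρ) ^ α) * ballAv (2 * ρ) μ x) := by
          rw [← mul_assoc, ← ENNReal.ofReal_mul (by positivity), one_div_mul_eq_div]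
          gcongr
          linarith
      _ ≤ _ := by gcongr
  have hmain : ∫⁻ r in Ioc 0 R, ENNReal.ofReal (r ^ (α - 1)) * ballAv (2 * max r ρ) μ x
      ≤ (ENNReal.ofReal (1 / α) * (2 ^ (d + 1) + K * ENNReal.ofReal ((R / 2) ^ (α - s)))
        + 2 * (1 + K * ENNReal.ofReal (R ^ (α - s)))) * rieszPot R α μ x := by
    rw [add_mul]
    refine le_trans ?_ (add_le_add hnear hfar)
    rw [← Ioc_union_Ioc_eq_Ioc hρ.le hρR]
    refine (lintegral_union_le _ _ _).trans (add_le_add ?_ ?_)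
    · exact setLIntegral_mono' measurableSet_Ioc fun r hr => by rw [max_eq_right hr.2]
    · rw [Ioc_union_Ioc_eq_Ioc hρ.le hρR]
      refine le_trans ?_ (lintegral_mono_set (Ioc_subset_Ioc_left hρ.le))
      exact setLIntegral_mono' measurableSet_Ioc fun r hr => by rw [max_eq_left hr.1.le]
  rw [mul_assoc, add_mul, one_mul, mul_assoc]
  gcongr
end weight

/-- A function whose `s`-th power satisfies a Morrey bound has `p`-th power, `p < s`, dominated
by a weight of Muckenhoupt type. -/
theorem exists_weight (d : ℕ) {p s R : ℝ} (hp : 1 < p) (hps : p < s) (hR : 0 < R)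
    (hR1 : 2 * R ≤ 1) (K : ℝ≥0) :
    ∃ C : ℝ≥0, ∀ g : Spc d → ℝ≥0∞, Measurable g →
      (∀ r x, 0 < r → r ≤ 2 * R →
        ballAv r (fun x => g x ^ s) x ≤ K * ENNReal.ofReal (r ^ (-s))) →
      ∃ w : Spc d → ℝ≥0∞, Measurable w ∧ (∀ x, g x ^ p ≤ w x) ∧ (∀ x, ballAv R w x ≤ C) ∧
        ∀ x, ∫⁻ r in Ioc 0 R, ballAv r w x ≤ C * w x ^ ((p - 1) / p) := by
  have hp0 : 0 < p := by linarith
  have hs : 1 < s := by linarith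
  have hs0 : 0 < s := by linarith
  set α : ℝ := min ((s - p) / 2) (1 / 2) with hα
  have hα0 : 0 < α := lt_min (by linarith) (by norm_num)
  have hα1 : α < 1 := (min_le_right _ _).trans_lt (by norm_num)
  have hαs : α ≤ (s - p) / 2 := min_le_left _ _
  have hsα : 0 < s - α := by linarith
  set θ : ℝ := p / (s - α) with hθ
  have hθ0 : 0 < θ := by positivity
  have hθ1 : θ ≤ 1 := (div_le_one hsα).2 (by linarith)
  set τ : ℝ := p / s with hτ
  have hτ0 : 0 < τ := by positivity
  have hτ1 : τ ≤ 1 := (div_le_one hs0).2 hps.le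
  have hατ : α * τ < 1 := by nlinarith
  set V : ℝ≥0∞ := volume (ball (0 : Spc d) 1) with hV
  have hVt : V ≠ ⊤ := measure_ball_lt_top.ne
  set A₁ : ℝ≥0∞ := V * (1 + 2 ^ d * (K * ENNReal.ofReal (1 / α + 1 / (s - α)))) with hA₁
  set A₂ : ℝ≥0∞ := V * (1 + 2 ^ d * (ENNReal.ofReal (1 / α) *
        (2 ^ (d + 1) + K * ENNReal.ofReal ((R / 2) ^ (α - s)))
        + 2 * (1 + K * ENNReal.ofReal (R ^ (α - s))))) with hA₂
  set A₃ : ℝ≥0∞ := 2 ^ (d + 1) + K * ENNReal.ofReal ((R / 2) ^ (α - s)) with hA₃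
  have hA₁t : A₁ ≠ ⊤ := by finiteness
  have hA₂t : A₂ ≠ ⊤ := by finiteness
  have hA₃t : A₃ ≠ ⊤ := by finiteness
  set B₁ : ℝ≥0∞ := V ^ (1 - θ) * A₁ ^ θ with hB₁
  set B₂ : ℝ≥0∞ := V ^ (1 - θ) * A₂ ^ θ with hB₂
  set B₃ : ℝ≥0∞ := V ^ (1 - τ) * (K : ℝ≥0∞) ^ τ with hB₃
  set B₄ : ℝ≥0∞ := V ^ (1 - τ) * A₃ ^ τ with hB₄
  have hfin : ∀ {a c : ℝ≥0∞} {x y : ℝ}, 0 ≤ x → 0 ≤ y → a ≠ ⊤ → c ≠ ⊤ → a ^ x * c ^ y ≠ ⊤ :=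
    fun hx hy ha hc => ENNReal.mul_ne_top (ENNReal.rpow_ne_top_of_nonneg hx ha)
      (ENNReal.rpow_ne_top_of_nonneg hy hc)
  have hB₁t : B₁ ≠ ⊤ := hfin (by linarith) hθ0.le hVt hA₁t
  have hB₂t : B₂ ≠ ⊤ := hfin (by linarith) hθ0.le hVt hA₂t
  have hB₃t : B₃ ≠ ⊤ := hfin (by linarith) hτ0.le hVt (by simp)
  have hB₄t : B₄ ≠ ⊤ := hfin (by linarith) hτ0.le hVt hA₃t
  set C₁ : ℝ≥0∞ := (B₃ + B₁) * ENNReal.ofReal (R ^ (-p)) with hC₁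
  set C₂ : ℝ≥0∞ := (B₃ * ENNReal.ofReal (1 / (p - 1)) + B₄ * ENNReal.ofReal (1 / (1 - α * τ)) + 1)
    + (B₁ * ENNReal.ofReal (1 / (p - 1)) + B₂ * ENNReal.ofReal (1 / (1 - 0)) + 1) with hC₂
  have hC₁t : C₁ ≠ ⊤ := by finiteness
  have hC₂t : C₂ ≠ ⊤ := by finiteness
  refine ⟨(C₁ + C₂).toNNReal, fun g hg h => ?_⟩
  rw [ENNReal.coe_toNNReal (ENNReal.add_ne_top.2 ⟨hC₁t, hC₂t⟩)]
  set μ : Spc d → ℝ≥0∞ := fun x => g x ^ s with hμ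
  have hμm : Measurable μ := by fun_prop
  set G := rieszPot R α μ with hG
  have hGm : Measurable G := measurable_rieszPot hμm
  have hG1 : ∀ x, 1 ≤ G x := one_le_rieszPot
  have hgp : (fun x => g x ^ p) = fun x => μ x ^ τ := by
    funext x; rw [hμ, ← ENNReal.rpow_mul, hτ, mul_div_cancel₀ _ hs0.ne']
  have hd3 : ∀ r ∈ Ioc 0 R, ∀ x, ballAv r (fun x => g x ^ p) x
      ≤ B₃ * ENNReal.ofReal (r ^ (-p)) := by
    intro r hr x
    rw [hgp, hB₃, mul_assoc]
    refine (ballAv_rpow_le hτ0.le hτ1 hμm r x).trans ?_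
    gcongr
    refine (ENNReal.rpow_le_rpow (h r x hr.1 (by linarith [hr.2])) hτ0.le).trans (le_of_eq ?_)
    rw [ENNReal.mul_rpow_of_nonneg _ _ hτ0.le, ofReal_rpow_rpow hr.1, neg_mul, hτ,
      mul_div_cancel₀ _ hs0.ne']
  have hd4 : ∀ r ∈ Ioc 0 R, ∀ x, ballAv r (fun x => g x ^ p) x
      ≤ B₄ * G x ^ τ * ENNReal.ofReal (r ^ (-(α * τ))) := by
    intro r hr x
    rw [hgp, hB₄, mul_assoc, mul_assoc]
    refine (ballAv_rpow_le hτ0.le hτ1 hμm r x).trans ?_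
    gcongr
    have e : ballAv r μ x ≤ A₃ * G x * ENNReal.ofReal (r ^ (-α)) := by
      have := rpow_mul_ballAv_le_rieszPot hR hα0 hα1 hs h hr.1 (by linarith [hr.2]) x
      calc ballAv r μ x = ENNReal.ofReal (r ^ α) * ballAv r μ x * ENNReal.ofReal (r ^ (-α)) := by
            rw [mul_right_comm, ofReal_rpow_mul_rpow hr.1, add_neg_cancel, Real.rpow_zero,
              ENNReal.ofReal_one, one_mul]
        _ ≤ _ := by gcongr
    refine (ENNReal.rpow_le_rpow e hτ0.le).trans (le_of_eq ?_)
    rw [ENNReal.mul_rpow_of_nonneg _ _ hτ0.le, ENNReal.mul_rpow_of_nonneg _ _ hτ0.le,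
      ofReal_rpow_rpow hr.1, neg_mul, mul_assoc]
  have hd1 : ∀ r ∈ Ioc 0 R, ∀ x, ballAv r (fun x => G x ^ θ) x
      ≤ B₁ * ENNReal.ofReal (r ^ (-p)) := by
    intro r hr x
    rw [hB₁, mul_assoc]
    refine (ballAv_rpow_le hθ0.le hθ1 hGm r x).trans ?_
    gcongr
    refine (ENNReal.rpow_le_rpow (ballAv_rieszPot_le_rpow hμm hR1 hα0 hα1 hs h hr.1 hr.2 x)
      hθ0.le).trans (le_of_eq ?_)
    rw [ENNReal.mul_rpow_of_nonneg _ _ hθ0.le, ofReal_rpow_rpow hr.1]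
    congr 3
    rw [hθ]; field_simp; ring
  have hd2 : ∀ r ∈ Ioc 0 R, ∀ x, ballAv r (fun x => G x ^ θ) x
      ≤ B₂ * G x ^ θ * ENNReal.ofReal (r ^ (-(0 : ℝ))) := by
    intro r hr x
    rw [hB₂, neg_zero, Real.rpow_zero, ENNReal.ofReal_one, mul_one, mul_assoc]
    refine (ballAv_rpow_le hθ0.le hθ1 hGm r x).trans ?_
    gcongr
    refine (ENNReal.rpow_le_rpow (ballAv_rieszPot_le_self hμm hR hα0 hα1 hs h hr.1 hr.2 x)
      hθ0.le).trans (le_of_eq ?_)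
    rw [ENNReal.mul_rpow_of_nonneg _ _ hθ0.le]
  have hgpm : Measurable fun x => g x ^ p := by fun_prop
  refine ⟨fun x => g x ^ p + G x ^ θ, hgpm.add (by fun_prop), fun x => le_self_add, fun x => ?_,
    fun x => ?_⟩
  · rw [ballAv_add hgpm]
    refine (add_le_add (hd3 R ⟨hR, le_rfl⟩ x) (hd1 R ⟨hR, le_rfl⟩ x)).trans ?_
    rw [← add_mul]; exact le_self_add
  · have i1 := lintegral_Ioc_le_of_rpow_bounds hp hατ
      (ENNReal.one_le_rpow (hG1 x) hτ0) (fun r hr => hd3 r hr x) (fun r hr => hd4 r hr x)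
    have i2 := lintegral_Ioc_le_of_rpow_bounds hp one_pos
      (ENNReal.one_le_rpow (hG1 x) hθ0) (fun r hr => hd1 r hr x) (fun r hr => hd2 r hr x)
    have e1 : (G x ^ τ) ^ ((p - 1) / (p - α * τ)) = (G x ^ θ) ^ ((p - 1) / p) := by
      rw [← ENNReal.rpow_mul, ← ENNReal.rpow_mul]
      congr 1
      have : p - α * τ = p * (s - α) / s := by rw [hτ]; field_simp
      rw [this, hτ, hθ]; field_simp
    rw [e1] at i1
    rw [show p - 0 = p by ring] at i2
    calc ∫⁻ r in Ioc 0 R, ballAv r (fun x => g x ^ p + G x ^ θ) x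
        = (∫⁻ r in Ioc 0 R, ballAv r (fun x => g x ^ p) x)
          + ∫⁻ r in Ioc 0 R, ballAv r (fun x => G x ^ θ) x := by
          rw [← lintegral_add_left (measurable_ballAv_left hgpm x)]
          exact lintegral_congr fun r => ballAv_add hgpm r x
      _ ≤ _ := add_le_add i1 i2
      _ = C₂ * (G x ^ θ) ^ ((p - 1) / p) := by rw [hC₂]; exact (add_mul _ _ _).symm
      _ ≤ (C₁ + C₂) * (g x ^ p + G x ^ θ) ^ ((p - 1) / p) := by
          gcongr
          · exact le_add_self
          · exact le_add_self

theorem enorm_le_add_lintegral_deriv {φ φ' : ℝ → ℝ} (h : ∀ r, HasDerivAt φ (φ' r) r)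
    (hc : Continuous φ') {R : ℝ} (hR : 0 ≤ R) :
    ‖φ 0‖ₑ ≤ ‖φ R‖ₑ + ∫⁻ r in Ioc 0 R, ‖φ' r‖ₑ := by
  have h1 := intervalIntegral.integral_eq_sub_of_hasDerivAt (a := 0) (b := R)
    (fun x _ => h x) (hc.intervalIntegrable _ _)
  have h2 : φ 0 = φ R - ∫ r in (0 : ℝ)..R, φ' r := by rw [h1]; ring
  rw [h2, intervalIntegral.integral_of_le hR]
  exact (enorm_sub_le).trans (add_le_add_right (enorm_integral_le_lintegral_enorm _) _)

theorem le_of_le_add_mul_rpow {p : ℝ} (hp : 1 < p) {Y a c n : ℝ≥0∞} (hY : Y ≠ ⊤)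
    (h : Y ≤ a + c * (Y ^ ((p - 1) / p) * n ^ (1 / p))) : Y ≤ 2 * a + (2 * c) ^ p * n := by
  have hp0 : 0 < p := by linarith
  rcases le_or_gt Y (2 * a) with h2 | h2
  · exact h2.trans le_self_add
  refine le_trans ?_ le_add_self
  have hY0 : Y ≠ 0 := (bot_le.trans_lt h2).ne'
  have h3 : Y ≤ 2 * c * (Y ^ ((p - 1) / p) * n ^ (1 / p)) := by
    set Z := c * (Y ^ ((p - 1) / p) * n ^ (1 / p)) with hZ
    rw [mul_assoc, ← hZ]
    by_contra! h4
    have : 2 * Y < 2 * Y := by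
      calc 2 * Y ≤ 2 * (a + Z) := by gcongr
        _ = 2 * a + 2 * Z := by ring
        _ < Y + Y := ENNReal.add_lt_add h2 h4
        _ = 2 * Y := by ring
    exact lt_irrefl _ this
  have hYs : Y = Y ^ ((p - 1) / p) * Y ^ (1 / p) := by
    rw [← ENNReal.rpow_add _ _ hY0 hY, ← add_div, sub_add_cancel, div_self hp0.ne',
      ENNReal.rpow_one]
  have hYp0 : Y ^ ((p - 1) / p) ≠ 0 := by simp [ENNReal.rpow_eq_zero_iff, hY0, hY]
  have hYpt : Y ^ ((p - 1) / p) ≠ ⊤ :=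
    ENNReal.rpow_ne_top_of_nonneg (div_nonneg (by linarith) hp0.le) hY
  have h5 : Y ^ (1 / p) ≤ 2 * c * n ^ (1 / p) := by
    rw [← ENNReal.mul_le_mul_iff_right hYp0 hYpt, ← hYs]
    calc Y ≤ _ := h3
      _ = _ := by ring
  have h6 := ENNReal.rpow_le_rpow h5 hp0.le
  rwa [ENNReal.mul_rpow_of_nonneg _ _ hp0.le, ← ENNReal.rpow_mul, ← ENNReal.rpow_mul,
    one_div_mul_cancel hp0.ne', ENNReal.rpow_one, ENNReal.rpow_one] at h6

section trace
variable {d : ℕ}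

theorem volume_mul_enorm_le {f : Spc d → ℝ} (hf : ContDiff ℝ 1 f) {R : ℝ} (hR : 0 ≤ R)
    (x : Spc d) : volume (ball (0 : Spc d) 1) * ‖f x‖ₑ
      ≤ ballAv R (fun x => ‖f x‖ₑ) x
        + ∫⁻ r in Ioc 0 R, ballAv r (fun x => ‖fderiv ℝ f x‖ₑ) x := by
  have hdc : Continuous (fderiv ℝ f) := hf.continuous_fderiv one_ne_zero
  have hfc : Continuous f := hf.continuous
  have key : ∀ y ∈ ball (0 : Spc d) 1, ‖f x‖ₑ
      ≤ ‖f (x + R • y)‖ₑ + ∫⁻ r in Ioc 0 R, ‖fderiv ℝ f (x + r • y)‖ₑ := by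
    intro y hy
    have hd : ∀ r : ℝ, HasDerivAt (fun r : ℝ => f (x + r • y)) (fderiv ℝ f (x + r • y) y) r := by
      intro r
      have h1 : HasDerivAt (fun r : ℝ => x + r • y) y r := by
        simpa using ((hasDerivAt_id r).smul_const y).const_add x
      exact ((hf.differentiable one_ne_zero _).hasFDerivAt).comp_hasDerivAt r h1
    have := enorm_le_add_lintegral_deriv hd (by fun_prop) hR
    simp only [zero_smul, add_zero] at this
    refine this.trans (add_le_add_right (lintegral_mono fun r => ?_) _)
    have hy1 : ‖y‖ₑ ≤ 1 := by
      rw [mem_ball_zero_iff] at hy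
      rw [← ofReal_norm]
      exact ENNReal.ofReal_le_one.2 hy.le
    calc _ ≤ ‖fderiv ℝ f (x + r • y)‖ₑ * ‖y‖ₑ := ContinuousLinearMap.le_opENorm _ _
      _ ≤ _ := mul_le_of_le_one_right' hy1
  have hm : Measurable fun w : Spc d × ℝ => ‖fderiv ℝ f (x + w.2 • w.1)‖ₑ :=
    (by fun_prop : Continuous fun w : Spc d × ℝ => ‖fderiv ℝ f (x + w.2 • w.1)‖ₑ).measurable
  calc _ = ∫⁻ y in ball (0 : Spc d) 1, ‖f x‖ₑ := by rw [setLIntegral_const, mul_comm]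
    _ ≤ _ := setLIntegral_mono' measurableSet_ball key
    _ = _ := by
        rw [lintegral_add_left
          ((by fun_prop : Continuous fun y => ‖f (x + R • y)‖ₑ).measurable),
          lintegral_lintegral_swap hm.aemeasurable]
        rfl

theorem lintegral_weight_mul_lt_top {w : Spc d → ℝ≥0∞} {R : ℝ} (hR : 0 < R)
    {C : ℝ≥0} (h : ∀ x, ballAv R w x ≤ C) {F : Spc d → ℝ≥0} (hF : Continuous F)
    (hFs : HasCompactSupport F) : ∫⁻ x, w x * F x ≠ ⊤ := by
  have hfin : (volume.withDensity w) (tsupport F) < ⊤ := by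
    refine hFs.isCompact.measure_lt_top_of_nhdsWithin fun x _ =>
      ⟨ball x R, mem_nhdsWithin_of_mem_nhds (ball_mem_nhds x hR), ?_⟩
    rw [withDensity_apply _ measurableSet_ball]
    have h1 := h x
    unfold ballAv at h1
    rw [setLIntegral_ball_affine hR] at h1
    by_contra! h2
    rw [top_le_iff.1 h2, ENNReal.mul_top (by simp)] at h1
    exact absurd h1 (by simp)
  obtain ⟨M, hM⟩ := (hFs.isCompact_range hF).bddAbove
  have hM' : ∀ x, (F x : ℝ≥0∞) ≤ M := fun x => by exact_mod_cast hM ⟨x, rfl⟩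
  have hle : ∫⁻ x, w x * F x ≤ M * ∫⁻ x in tsupport F, w x := by
    rw [← lintegral_const_mul' _ _ (by simp), ← lintegral_indicator (isClosed_tsupport F).measurableSet]
    refine lintegral_mono fun x => ?_
    by_cases hx : x ∈ tsupport F
    · simp only [indicator_of_mem hx]
      rw [mul_comm]; exact mul_le_mul_left (hM' x) _
    · simp [image_eq_zero_of_notMem_tsupport hx]
  rw [withDensity_apply _ (isClosed_tsupport F).measurableSet] at hfin
  exact (hle.trans_lt (ENNReal.mul_lt_top (by simp) hfin)).ne

theorem lintegral_weight_mul_le {w F D : Spc d → ℝ≥0∞} (hw : Measurable w) (hF : Measurable F)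
    (hD : Measurable D) {p R : ℝ} {C : ℝ≥0} (h1 : ∀ x, ballAv R w x ≤ C)
    (h2 : ∀ x, ∫⁻ r in Ioc 0 R, ballAv r w x ≤ C * w x ^ ((p - 1) / p))
    (h : ∀ x, volume (ball (0 : Spc d) 1) * F x
      ≤ ballAv R F x + ∫⁻ r in Ioc 0 R, ballAv r D x) :
    volume (ball (0 : Spc d) 1) * ∫⁻ x, w x * F x
      ≤ C * (∫⁻ x, F x) + C * ∫⁻ x, D x * w x ^ ((p - 1) / p) := by
  have hm : Measurable fun z : Spc d × ℝ => w z.1 * ballAv z.2 D z.1 :=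
    (hw.comp measurable_fst).mul
      ((measurable_ballAv_uncurry hD).comp (measurable_snd.prodMk measurable_fst))
  have hwF : Measurable fun x => w x * ballAv R F x := hw.mul (measurable_ballAv hF R)
  calc _ = ∫⁻ x, w x * (volume (ball (0 : Spc d) 1) * F x) := by
        rw [← lintegral_const_mul' _ _ measure_ball_lt_top.ne]
        exact lintegral_congr fun x => mul_left_comm _ _ _
    _ ≤ ∫⁻ x, (w x * ballAv R F x
          + ∫⁻ r in Ioc 0 R, w x * ballAv r D x) := by
        refine lintegral_mono fun x => ?_
        rw [lintegral_const_mul _ (measurable_ballAv_left hD x), ← mul_add]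
        gcongr
        exact h x
    _ = (∫⁻ x, F x * ballAv R w x)
          + ∫⁻ x, D x * ∫⁻ r in Ioc 0 R, ballAv r w x := by
        rw [lintegral_add_left hwF, lintegral_mul_ballAv hw hF,
          lintegral_lintegral_swap hm.aemeasurable]
        congr 1
        have hm2 : Measurable fun z : ℝ × Spc d => D z.2 * ballAv z.1 w z.2 :=
          (hD.comp measurable_snd).mul (measurable_ballAv_uncurry hw)
        calc _ = ∫⁻ r in Ioc 0 R, ∫⁻ x, D x * ballAv r w x :=
              lintegral_congr fun r => lintegral_mul_ballAv hw hD r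
          _ = ∫⁻ x, ∫⁻ r in Ioc 0 R, D x * ballAv r w x :=
              lintegral_lintegral_swap hm2.aemeasurable
          _ = _ := lintegral_congr fun x => lintegral_const_mul _ (measurable_ballAv_left hw x)
    _ ≤ (∫⁻ x, C * F x) + ∫⁻ x, C * (D x * w x ^ ((p - 1) / p)) := by
        refine add_le_add (lintegral_mono fun x => ?_) (lintegral_mono fun x => ?_)
        · rw [mul_comm]; exact mul_le_mul_left (h1 x) _
        · rw [mul_left_comm]; exact mul_le_mul_right (h2 x) _
    _ = _ := by rw [lintegral_const_mul' _ _ (by simp), lintegral_const_mul' _ _ (by simp)]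

theorem exists_trace_const (d : ℕ) {p R : ℝ} (hp : 1 < p) (hR : 0 < R) (C : ℝ≥0) :
    ∃ N : ℝ≥0, ∀ w : Spc d → ℝ≥0∞, Measurable w → (∀ x, ballAv R w x ≤ C) →
      (∀ x, ∫⁻ r in Ioc 0 R, ballAv r w x ≤ C * w x ^ ((p - 1) / p)) →
      ∀ v : Spc d → ℝ, ContDiff ℝ 1 v → HasCompactSupport v →
        ∫⁻ x, w x * ‖v x‖ₑ ^ p ≤ N * ((∫⁻ x, ‖v x‖ₑ ^ p) + ∫⁻ x, ‖fderiv ℝ v x‖ₑ ^ p) := by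
  have hp0 : 0 < p := by linarith
  set V : ℝ≥0∞ := volume (ball (0 : Spc d) 1) with hV
  have hVt : V ≠ ⊤ := measure_ball_lt_top.ne
  have hV0 : V ≠ 0 := (measure_ball_pos _ _ one_pos).ne'
  set c : ℝ≥0∞ := V⁻¹ * C with hc
  have hct : c ≠ ⊤ := ENNReal.mul_ne_top (ENNReal.inv_ne_top.2 hV0) (by simp)
  have hNt : 2 * c + (2 * (c * ENNReal.ofReal p)) ^ p ≠ ⊤ := by
    have := ENNReal.rpow_ne_top_of_nonneg hp0.le
      (ENNReal.mul_ne_top (by simp : (2 : ℝ≥0∞) ≠ ⊤) (ENNReal.mul_ne_top hct ENNReal.ofReal_ne_top)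
        : 2 * (c * ENNReal.ofReal p) ≠ ⊤)
    finiteness
  refine ⟨(2 * c + (2 * (c * ENNReal.ofReal p)) ^ p).toNNReal, fun w hw h1 h2 v hv hvs => ?_⟩
  rw [ENNReal.coe_toNNReal hNt]
  set f : Spc d → ℝ := fun x => ‖v x‖ ^ p with hf
  have hfC : ContDiff ℝ 1 f := hv.norm_rpow hp
  have hfe : ∀ x, ‖f x‖ₑ = ‖v x‖ₑ ^ p := fun x => by
    rw [hf, ← ofReal_norm, ← ofReal_norm, Real.norm_of_nonneg (by positivity),
      ENNReal.ofReal_rpow_of_nonneg (norm_nonneg _) hp0.le]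
  have hdf : ∀ x, ‖fderiv ℝ f x‖ₑ ≤ ENNReal.ofReal p * ‖v x‖ₑ ^ (p - 1) * ‖fderiv ℝ v x‖ₑ := by
    intro x
    have := norm_fderiv_norm_rpow_le (hv.differentiable one_ne_zero) (x := x) hp
    rw [← ofReal_norm, ← ofReal_norm, ← ofReal_norm,
      ENNReal.ofReal_rpow_of_nonneg (norm_nonneg _) (by linarith), ← ENNReal.ofReal_mul hp0.le,
      ← ENNReal.ofReal_mul (by positivity)]
    exact ENNReal.ofReal_le_ofReal this
  have hvm : Measurable fun x => ‖v x‖ₑ := hv.continuous.enorm.measurable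
  have hdm : Measurable fun x => ‖fderiv ℝ v x‖ₑ :=
    (hv.continuous_fderiv one_ne_zero).enorm.measurable
  set Y := ∫⁻ x, w x * ‖v x‖ₑ ^ p with hY
  have hYt : Y ≠ ⊤ := by
    have := lintegral_weight_mul_lt_top hR h1 (F := fun x => ‖v x‖₊ ^ p)
      ((NNReal.continuous_rpow_const hp0.le).comp hv.continuous.nnnorm)
      (hvs.comp_left (g := fun y => ‖y‖₊ ^ p) (by simp [hp0.ne']))
    simp only [ENNReal.coe_rpow_of_nonneg _ hp0.le] at this
    exact this
  have hmain := lintegral_weight_mul_le hw hfC.continuous.enorm.measurable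
    (hfC.continuous_fderiv one_ne_zero).enorm.measurable h1 h2 (volume_mul_enorm_le hfC hR.le)
  simp only [hfe] at hmain
  have hH : ∫⁻ x, ‖fderiv ℝ f x‖ₑ * w x ^ ((p - 1) / p)
      ≤ ENNReal.ofReal p * (Y ^ ((p - 1) / p) * (∫⁻ x, ‖fderiv ℝ v x‖ₑ ^ p) ^ (1 / p)) := by
    calc _ ≤ ∫⁻ x, ENNReal.ofReal p *
          ((w x * ‖v x‖ₑ ^ p) ^ ((p - 1) / p) * (‖fderiv ℝ v x‖ₑ ^ p) ^ (1 / p)) := by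
          refine lintegral_mono fun x => ?_
          refine (mul_le_mul_left (hdf x) _).trans (le_of_eq ?_)
          rw [ENNReal.mul_rpow_of_nonneg _ _ (div_nonneg (by linarith) hp0.le), ← ENNReal.rpow_mul,
            ← ENNReal.rpow_mul, mul_one_div_cancel hp0.ne', mul_div_cancel₀ _ hp0.ne',
            ENNReal.rpow_one]
          ring
      _ = ENNReal.ofReal p * ∫⁻ x,
          (w x * ‖v x‖ₑ ^ p) ^ ((p - 1) / p) * (‖fderiv ℝ v x‖ₑ ^ p) ^ (1 / p) :=
          lintegral_const_mul' _ _ ENNReal.ofReal_ne_top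
      _ ≤ _ := by
          gcongr
          exact ENNReal.lintegral_mul_norm_pow_le (by fun_prop) (by fun_prop)
            (div_nonneg (by linarith) hp0.le) (by positivity) (by field_simp; ring)
  have hYle : Y ≤ c * (∫⁻ x, ‖v x‖ₑ ^ p) + c * ENNReal.ofReal p *
      (Y ^ ((p - 1) / p) * (∫⁻ x, ‖fderiv ℝ v x‖ₑ ^ p) ^ (1 / p)) := by
    calc Y = V⁻¹ * (V * Y) := by rw [← mul_assoc, ENNReal.inv_mul_cancel hV0 hVt, one_mul]
      _ ≤ V⁻¹ * (C * (∫⁻ x, ‖v x‖ₑ ^ p) + C * (ENNReal.ofReal p *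
          (Y ^ ((p - 1) / p) * (∫⁻ x, ‖fderiv ℝ v x‖ₑ ^ p) ^ (1 / p)))) := by
          gcongr
          exact hmain.trans (by gcongr)
      _ = _ := by rw [hc]; ring
  refine (le_of_le_add_mul_rpow hp hYt hYle).trans ?_
  rw [mul_add]
  refine add_le_add ?_ ?_
  · rw [← mul_assoc]; gcongr; exact le_self_add
  · gcongr; exact le_add_self
end trace

section product
variable {d : ℕ} {p q : ℝ}

/-- Morrey functions are multipliers from the Sobolev space `W^1_p` into `L_p`. -/
theorem exists_multiplier_const (d : ℕ) {p s R : ℝ} (hp : 1 < p) (hps : p < s) (hR : 0 < R)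
    (hR1 : 2 * R ≤ 1) (K : ℝ≥0) :
    ∃ N : ℝ≥0, ∀ g : Spc d → ℝ≥0∞, Measurable g →
      (∀ r x, 0 < r → r ≤ 2 * R →
        ballAv r (fun x => g x ^ s) x ≤ K * ENNReal.ofReal (r ^ (-s))) →
      ∀ v : Spc d → ℝ, ContDiff ℝ 1 v → HasCompactSupport v →
        ∫⁻ x, (g x * ‖v x‖ₑ) ^ p ≤
          N * ((∫⁻ x, ‖v x‖ₑ ^ p) + ∫⁻ x, ‖fderiv ℝ v x‖ₑ ^ p) := by
  obtain ⟨C, hC⟩ := exists_weight d hp hps hR hR1 K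
  obtain ⟨N, hN⟩ := exists_trace_const d hp hR C
  refine ⟨N, fun g hg hgs v hv hvs => ?_⟩
  obtain ⟨w, hw, hgw, h1, h2⟩ := hC g hg hgs
  refine le_trans (lintegral_mono fun x => ?_) (hN w hw h1 h2 v hv hvs)
  rw [ENNReal.mul_rpow_of_nonneg _ _ (by linarith)]
  gcongr
  exact hgw x

/-- A localized form of the multiplier inequality. -/
theorem exists_local_multiplier_const (d : ℕ) {p : ℝ} (hp : 1 < p) (N : ℝ≥0) :
    ∃ c : ℝ≥0, ∀ g : Spc d → ℝ≥0∞,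
      (∀ v : Spc d → ℝ, ContDiff ℝ 1 v → HasCompactSupport v →
        ∫⁻ x, (g x * ‖v x‖ₑ) ^ p ≤
          N * ((∫⁻ x, ‖v x‖ₑ ^ p) + ∫⁻ x, ‖fderiv ℝ v x‖ₑ ^ p)) →
      ∀ ρ : ℝ, 0 < ρ → ρ ≤ 1 → ∀ x₀ : Spc d, ∀ v : Spc d → ℝ, ContDiff ℝ 1 v →
        ∫⁻ x in ball x₀ ρ, (g x * ‖v x‖ₑ) ^ p ≤
          ∫⁻ x in ball x₀ (2 * ρ),
            (c * (‖fderiv ℝ v x‖ₑ + ENNReal.ofReal ρ⁻¹ * ‖v x‖ₑ)) ^ p := by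
  have hp0 : 0 < p := by linarith
  let f : ContDiffBump (0 : Spc d) := ⟨1, 3 / 2, by norm_num, by norm_num⟩
  have hfC : ContDiff ℝ 1 f := f.contDiff
  obtain ⟨L, hL⟩ := (f.hasCompactSupport.fderiv (𝕜 := ℝ)).exists_bound_of_continuous
    (hfC.continuous_fderiv one_ne_zero)
  have hL0 : 0 ≤ L := (norm_nonneg _).trans (hL 0)
  refine ⟨(2 * N) ^ (1 / p) * (1 + L.toNNReal), fun g hg ρ hρ hρ1 x₀ v hv => ?_⟩
  set ζ : Spc d → ℝ := fun x => f (ρ⁻¹ • (x - x₀)) with hζ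
  have hζC : ContDiff ℝ 1 ζ := hfC.comp (by fun_prop)
  have hζ1 : ∀ x ∈ ball x₀ ρ, ζ x = 1 := fun x hx => by
    refine f.one_of_mem_closedBall ?_
    rw [mem_closedBall_zero_iff, norm_smul, norm_inv, Real.norm_of_nonneg hρ.le,
      inv_mul_le_iff₀ hρ]
    rw [mem_ball_iff_norm] at hx
    change ‖x - x₀‖ ≤ ρ * 1
    linarith
  have hζ0 : ∀ x ∉ ball x₀ (2 * ρ), ζ x = 0 ∧ fderiv ℝ ζ x = 0 := fun x hx => by
    have hx' : x ∉ tsupport ζ := by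
      have hsub : tsupport ζ ⊆ (fun x => ρ⁻¹ • (x - x₀)) ⁻¹' tsupport f :=
        tsupport_comp_subset_preimage f (by fun_prop)
      intro hmem
      have h2 := hsub hmem
      rw [mem_preimage, f.tsupport_eq, mem_closedBall_zero_iff, norm_smul, norm_inv,
        Real.norm_of_nonneg hρ.le, inv_mul_le_iff₀ hρ] at h2
      rw [mem_ball_iff_norm] at hx
      change ‖x - x₀‖ ≤ ρ * (3 / 2) at h2
      linarith
    exact ⟨image_eq_zero_of_notMem_tsupport hx', by
      by_contra h
      exact hx' (support_fderiv_subset ℝ h)⟩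
  have hζle : ∀ x, ‖ζ x‖ ≤ 1 := fun x => by
    rw [Real.norm_of_nonneg f.nonneg]; exact f.le_one
  have hζd : ∀ x, ‖fderiv ℝ ζ x‖ ≤ L * ρ⁻¹ := fun x => by
    have hinner : HasFDerivAt (fun x : Spc d => ρ⁻¹ • (x - x₀))
        (ρ⁻¹ • ContinuousLinearMap.id ℝ (Spc d)) x :=
      ((hasFDerivAt_id x).sub_const x₀).const_smul ρ⁻¹
    have := ((hfC.differentiable one_ne_zero).differentiableAt (x := ρ⁻¹ • (x - x₀))).hasFDerivAt.comp
      x hinner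
    have h2 : fderiv ℝ ζ x = _ := this.fderiv
    rw [h2, ContinuousLinearMap.comp_smul, ContinuousLinearMap.comp_id, norm_smul, norm_inv,
      Real.norm_of_nonneg hρ.le, mul_comm]
    exact mul_le_mul_of_nonneg_right (hL _) (by positivity)
  have hρi : 1 ≤ ρ⁻¹ := (one_le_inv₀ hρ).2 hρ1
  set G : Spc d → ℝ≥0∞ := fun x => ‖fderiv ℝ v x‖ₑ + ENNReal.ofReal ρ⁻¹ * ‖v x‖ₑ with hG
  have hdv : ∀ x, fderiv ℝ (fun x => ζ x * v x) x = ζ x • fderiv ℝ v x + v x • fderiv ℝ ζ x :=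
    fun x => fderiv_fun_mul (hζC.differentiable one_ne_zero x) (hv.differentiable one_ne_zero x)
  have hL1 : ((1 + L.toNNReal : ℝ≥0) : ℝ≥0∞) = ENNReal.ofReal (1 + L) := by
    rw [ENNReal.ofReal_add zero_le_one hL0, ENNReal.ofReal_one]; rfl
  have hb : ∀ x, ‖ζ x * v x‖ₑ ^ p ≤ (ball x₀ (2 * ρ)).indicator
      (fun x => (((1 + L.toNNReal : ℝ≥0) : ℝ≥0∞) * G x) ^ p) x := fun x => by
    by_cases hx : x ∈ ball x₀ (2 * ρ)
    · rw [indicator_of_mem hx]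
      gcongr
      simp only [hG]
      rw [hL1, ← ofReal_norm, ← ofReal_norm, ← ofReal_norm, ← ENNReal.ofReal_mul (by positivity),
        ← ENNReal.ofReal_add (by positivity) (by positivity), ← ENNReal.ofReal_mul (by positivity)]
      refine ENNReal.ofReal_le_ofReal ?_
      rw [norm_mul]
      have h1 : ‖ζ x‖ * ‖v x‖ ≤ 1 * ‖v x‖ := by gcongr; exact hζle x
      have h2 : 1 * ‖v x‖ ≤ ρ⁻¹ * ‖v x‖ := by gcongr
      have h3 : 0 ≤ L * (‖fderiv ℝ v x‖ + ρ⁻¹ * ‖v x‖) := by positivity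
      nlinarith [norm_nonneg (fderiv ℝ v x)]
    · rw [indicator_of_notMem hx, (hζ0 x hx).1]; simp [hp0]
  have hb' : ∀ x, ‖fderiv ℝ (fun x => ζ x * v x) x‖ₑ ^ p ≤ (ball x₀ (2 * ρ)).indicator
      (fun x => (((1 + L.toNNReal : ℝ≥0) : ℝ≥0∞) * G x) ^ p) x := fun x => by
    by_cases hx : x ∈ ball x₀ (2 * ρ)
    · rw [indicator_of_mem hx, hdv]
      gcongr
      simp only [hG]
      rw [hL1, ← ofReal_norm, ← ofReal_norm, ← ofReal_norm, ← ENNReal.ofReal_mul (by positivity),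
        ← ENNReal.ofReal_add (by positivity) (by positivity), ← ENNReal.ofReal_mul (by positivity)]
      refine ENNReal.ofReal_le_ofReal ((norm_add_le _ _).trans ?_)
      rw [norm_smul, norm_smul]
      have h1 : ‖ζ x‖ * ‖fderiv ℝ v x‖ ≤ 1 * ‖fderiv ℝ v x‖ := by gcongr; exact hζle x
      have h2 : ‖v x‖ * ‖fderiv ℝ ζ x‖ ≤ ‖v x‖ * (L * ρ⁻¹) := by gcongr; exact hζd x
      have h3 : 0 ≤ L * ‖fderiv ℝ v x‖ := by positivity
      have h4 : 0 ≤ ρ⁻¹ * ‖v x‖ := by positivity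
      nlinarith
    · rw [indicator_of_notMem hx, hdv, (hζ0 x hx).1, (hζ0 x hx).2, zero_smul, smul_zero, add_zero,
        ← ofReal_norm, norm_zero, ENNReal.ofReal_zero, ENNReal.zero_rpow_of_pos hp0]
  have hcomp : HasCompactSupport fun x => ζ x * v x :=
    HasCompactSupport.intro (isCompact_closedBall x₀ (2 * ρ)) fun x hx => by
      rw [(hζ0 x fun h => hx (ball_subset_closedBall h)).1, zero_mul]
  have hmain := hg _ (hζC.mul hv) hcomp
  calc ∫⁻ x in ball x₀ ρ, (g x * ‖v x‖ₑ) ^ p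
      = ∫⁻ x in ball x₀ ρ, (g x * ‖ζ x * v x‖ₑ) ^ p :=
        setLIntegral_congr_fun measurableSet_ball fun x hx => by
          simp only [hζ1 x hx, one_mul]
    _ ≤ ∫⁻ x, (g x * ‖ζ x * v x‖ₑ) ^ p := setLIntegral_le_lintegral _ _
    _ ≤ N * ((∫⁻ x, ‖ζ x * v x‖ₑ ^ p) + ∫⁻ x, ‖fderiv ℝ (fun x => ζ x * v x) x‖ₑ ^ p) := hmain
    _ ≤ N * ((∫⁻ x in ball x₀ (2 * ρ), (((1 + L.toNNReal : ℝ≥0) : ℝ≥0∞) * G x) ^ p)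
          + ∫⁻ x in ball x₀ (2 * ρ), (((1 + L.toNNReal : ℝ≥0) : ℝ≥0∞) * G x) ^ p) := by
        rw [← lintegral_indicator measurableSet_ball]
        gcongr with x x
        · exact hb x
        · exact hb' x
    _ = ((2 * N : ℝ≥0) : ℝ≥0∞) *
          ∫⁻ x in ball x₀ (2 * ρ), (((1 + L.toNNReal : ℝ≥0) : ℝ≥0∞) * G x) ^ p := by
        push_cast; ring
    _ = ∫⁻ x in ball x₀ (2 * ρ), ((2 * N : ℝ≥0) : ℝ≥0∞) *
          (((1 + L.toNNReal : ℝ≥0) : ℝ≥0∞) * G x) ^ p :=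
        (lintegral_const_mul' _ _ coe_ne_top).symm
    _ = _ := by
        refine lintegral_congr fun x => ?_
        rw [ENNReal.coe_mul ((2 * N) ^ (1 / p)), mul_assoc,
          ENNReal.mul_rpow_of_nonneg (((2 * N) ^ (1 / p) : ℝ≥0) : ℝ≥0∞) _ hp0.le,
          ENNReal.coe_rpow_of_nonneg _ (by positivity), ← ENNReal.rpow_mul,
          one_div_mul_cancel hp0.ne', ENNReal.rpow_one]

/-- Multiplication by a Morrey function in parabolic Morrey spaces. -/
theorem exists_morreyE_mul_le (d : ℕ) {p q s R : ℝ} (β : ℝ) (hp : 1 < p) (hq : 1 < q) (hps : p < s)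
    (hR : 0 < R) (hR1 : 2 * R ≤ 1) (K : ℝ≥0) :
    ∃ C : ℝ≥0, ∀ g : Spc d → ℝ≥0∞, Measurable g →
      (∀ r x, 0 < r → r ≤ 2 * R →
        ballAv r (fun x => g x ^ s) x ≤ K * ENNReal.ofReal (r ^ (-s))) →
      ∀ V : SpT d → ℝ, ContDiff ℝ 1 V → ∀ W : SpT d → ℝ≥0∞, Measurable W →
        (∀ z : SpT d, ‖fderiv ℝ (fun x => V (z.1, x)) z.2‖ₑ ≤ W z) →
        morreyE d p q β (fun z => g z.2 * ‖V z‖ₑ) ≤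
          C * (morreyE d p q β W + morreyE d p q (β - 1) (fun z => ‖V z‖ₑ)) := by
  obtain ⟨N, hN⟩ := exists_multiplier_const d hp hps hR hR1 K
  obtain ⟨c, hc⟩ := exists_local_multiplier_const d hp N
  obtain ⟨N₁, hN₁⟩ := exists_mixN_double_le d β hp hq
  obtain ⟨N₂, hN₂⟩ := exists_mixN_double_le d (β - 1) hp hq
  refine ⟨c * (N₁ + N₂), fun g hg hgs V hV W hW hVW => ?_⟩
  have hVm : Measurable fun z => ‖V z‖ₑ := hV.continuous.enorm.measurable
  refine morreyE_le fun ρ hρ hρ1 t₀ x₀ => ?_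
  set ν : Measure (Spc d) := (volume (ball x₀ ρ))⁻¹ • volume.restrict (ball x₀ (2 * ρ)) with hν
  have hc' := hc g (hN g hg hgs) ρ hρ hρ1 x₀
  have hstep : mixN p q (cylT ρ t₀) (cylX d ρ x₀) (fun z => g z.2 * ‖V z‖ₑ) ≤
      mixN p q (cylT ρ t₀) ν (fun z => c * (W z + ENNReal.ofReal ρ⁻¹ * ‖V z‖ₑ)) := by
    unfold mixN
    refine ENNReal.rpow_le_rpow (lintegral_mono fun t => ENNReal.rpow_le_rpow ?_ (by positivity))
      (by positivity)
    rw [cylX, hν, lintegral_smul_measure, lintegral_smul_measure]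
    refine mul_le_mul_right ((hc' (fun x => V (t, x)) (hV.comp (by fun_prop))).trans ?_) _
    refine lintegral_mono fun x => ENNReal.rpow_le_rpow (mul_le_mul_right ?_ _) (by positivity)
    exact add_le_add_left (hVW (t, x)) _
  refine hstep.trans ?_
  rw [mixN_const_mul hp hq coe_ne_top]
  have hsplit : mixN p q (cylT ρ t₀) ν (fun z => W z + ENNReal.ofReal ρ⁻¹ * ‖V z‖ₑ) ≤
      ENNReal.ofReal (ρ ^ (-β)) * ((N₁ + N₂) *
        (morreyE d p q β W + morreyE d p q (β - 1) (fun z => ‖V z‖ₑ))) := by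
    refine (mixN_add_le hp hq hW (hVm.const_mul _)).trans ?_
    rw [mixN_const_mul hp hq ENNReal.ofReal_ne_top]
    have h1 := hN₁ W hW ρ hρ hρ1 t₀ x₀
    have h2 := hN₂ _ hVm ρ hρ hρ1 t₀ x₀
    calc _ ≤ ENNReal.ofReal (ρ ^ (-β)) * (N₁ * morreyE d p q β W) + ENNReal.ofReal ρ⁻¹ *
          (ENNReal.ofReal (ρ ^ (-(β - 1))) * (N₂ * morreyE d p q (β - 1) (fun z => ‖V z‖ₑ))) := by
          gcongr
      _ = ENNReal.ofReal (ρ ^ (-β)) * (N₁ * morreyE d p q β W) +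
          ENNReal.ofReal (ρ ^ (-β)) * (N₂ * morreyE d p q (β - 1) (fun z => ‖V z‖ₑ)) := by
          rw [← mul_assoc (ENNReal.ofReal ρ⁻¹), ← ENNReal.ofReal_mul (by positivity),
            ← Real.rpow_neg_one, ← Real.rpow_add hρ]
          congr 4; ring
      _ ≤ _ := by
          rw [← mul_add]
          gcongr
          rw [mul_add, add_mul, add_mul]
          gcongr
          · exact le_self_add
          · exact le_add_self
  calc _ ≤ (c : ℝ≥0∞) * _ := mul_le_mul_right hsplit _
    _ = _ := by push_cast; ring
end product

/-- The integral of `F` over a parabolically rescaled unit cylinder with base point `z`. -/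
def parAv {d : ℕ} (r : ℝ) (F : SpT d → ℝ≥0∞) (z : SpT d) : ℝ≥0∞ :=
  ∫⁻ s in Ico (0 : ℝ) 1, ∫⁻ y in ball (0 : Spc d) 1, F (z + (r ^ 2 * s, r • y))

section parAv
variable {d : ℕ} {p q β : ℝ} {F : SpT d → ℝ≥0∞}

theorem measurable_parAv_uncurry (hF : Measurable F) :
    Measurable (Function.uncurry fun r => parAv r F) := by
  unfold parAv
  have : Measurable fun w : ((ℝ × SpT d) × ℝ) × Spc d =>
      F (w.1.1.2 + (w.1.1.1 ^ 2 * w.1.2, w.1.1.1 • w.2)) := hF.comp (by fun_prop)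
  exact (this.lintegral_prod_right' (ν := volume.restrict (ball (0 : Spc d) 1))).lintegral_prod_right'
    (ν := volume.restrict (Ico (0 : ℝ) 1))

theorem measurable_parAv (hF : Measurable F) (r : ℝ) : Measurable (parAv r F) :=
  (measurable_parAv_uncurry hF).comp measurable_prodMk_left

theorem mixN_parAv_le_radius (hp : 1 < p) (hq : 1 < q) (hF : Measurable F) {r ρ : ℝ} (hr : 0 < r)
    (hr1 : r ≤ 1) (hρ : 0 < ρ) (t₀ : ℝ) (x₀ : Spc d) :
    mixN p q (cylT ρ t₀) (cylX d ρ x₀) (parAv r F) ≤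
      ENNReal.ofReal (r ^ (-β)) * (volume (ball (0 : Spc d) 1) * morreyE d p q β F) := by
  have := isProbabilityMeasure_cylT hρ t₀
  have := isProbabilityMeasure_cylX hρ x₀
  refine (mixN_mono hp hq fun z => ?_).trans (mixN_const hp hq _).le
  refine (setLIntegral_parabolic_le hp hq hF hr z).trans ?_
  calc _ ≤ volume (ball (0 : Spc d) 1) * (ENNReal.ofReal (r ^ (-β)) * morreyE d p q β F) := by
        gcongr; exact mixN_cyl_le hr hr1 _ _ F
    _ = _ := by ring

theorem mixN_parAv_le_cyl (hp : 1 < p) (hq : 1 < q) (hF : Measurable F) (r : ℝ) {ρ : ℝ} (hρ : 0 < ρ)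
    (hρ1 : ρ ≤ 1) (t₀ : ℝ) (x₀ : Spc d) :
    mixN p q (cylT ρ t₀) (cylX d ρ x₀) (parAv r F) ≤
      ENNReal.ofReal (ρ ^ (-β)) * (volume (ball (0 : Spc d) 1) * morreyE d p q β F) := by
  have : IsFiniteMeasure (volume.restrict (ball (0 : Spc d) 1)) :=
    ⟨by simpa using measure_ball_lt_top⟩
  have hm : Measurable fun w : (ℝ × SpT d) × Spc d => F (w.1.2 + (r ^ 2 * w.1.1, r • w.2)) :=
    hF.comp (by fun_prop)
  refine (mixN_lintegral_le hp hq _ (hm.lintegral_prod_right')).trans ?_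
  calc _ ≤ ∫⁻ _ in Ico (0 : ℝ) 1, ∫⁻ _ in ball (0 : Spc d) 1,
        ENNReal.ofReal (ρ ^ (-β)) * morreyE d p q β F := by
        refine lintegral_mono fun s => ?_
        have hms : Measurable fun w : Spc d × SpT d => F (w.2 + (r ^ 2 * s, r • w.1)) :=
          hF.comp (by fun_prop)
        refine (mixN_lintegral_le hp hq _ hms).trans (lintegral_mono fun y => ?_)
        rw [mixN_cyl_add ρ t₀ x₀ F (r ^ 2 * s, r • y)]
        exact mixN_cyl_le hρ hρ1 _ _ F
    _ = _ := by
        simp only [lintegral_const, Measure.restrict_apply MeasurableSet.univ, univ_inter,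
          Real.volume_Ico]
        simp; ring

theorem mixN_lintegral_parAv_le (hp : 1 < p) (hq : 1 < q) (hβ : 1 < β) (hF : Measurable F) {ρ : ℝ}
    (hρ : 0 < ρ) (hρ1 : ρ ≤ 1) (t₀ : ℝ) (x₀ : Spc d) :
    mixN p q (cylT ρ t₀) (cylX d ρ x₀) (fun z => ∫⁻ r in Ioc 0 1, parAv r F z) ≤
      ENNReal.ofReal (ρ ^ (-(β - 1))) * (ENNReal.ofReal (1 + 1 / (β - 1)) *
        (volume (ball (0 : Spc d) 1) * morreyE d p q β F)) := by
  set K := volume (ball (0 : Spc d) 1) * morreyE d p q β F with hK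
  have hρβ : 0 < ρ ^ (-(β - 1)) := Real.rpow_pos_of_pos hρ _
  refine (mixN_lintegral_le hp hq _ (measurable_parAv_uncurry hF)).trans ?_
  calc _ ≤ ∫⁻ r in Ioc 0 ρ ∪ Ioc ρ 1, mixN p q (cylT ρ t₀) (cylX d ρ x₀) (parAv r F) := by
        rw [Ioc_union_Ioc_eq_Ioc hρ.le hρ1]
    _ ≤ (∫⁻ r in Ioc 0 ρ, mixN p q (cylT ρ t₀) (cylX d ρ x₀) (parAv r F)) +
        ∫⁻ r in Ioc ρ 1, mixN p q (cylT ρ t₀) (cylX d ρ x₀) (parAv r F) := lintegral_union_le _ _ _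
    _ ≤ (∫⁻ _ in Ioc 0 ρ, ENNReal.ofReal (ρ ^ (-β)) * K) +
        ∫⁻ r in Ioi ρ, ENNReal.ofReal (r ^ (-β)) * K := by
        refine add_le_add (lintegral_mono fun r => mixN_parAv_le_cyl hp hq hF r hρ hρ1 t₀ x₀) ?_
        refine (setLIntegral_mono' measurableSet_Ioc fun r hr =>
          mixN_parAv_le_radius (β := β) hp hq hF (hρ.trans hr.1) hr.2 hρ t₀ x₀).trans ?_
        exact lintegral_mono_set Ioc_subset_Ioi_self
    _ = (ENNReal.ofReal (ρ ^ (-β) * ρ) + ENNReal.ofReal (ρ ^ (-β + 1) / (β - 1))) * K := by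
        rw [lintegral_mul_const K (f := fun r : ℝ => ENNReal.ofReal (r ^ (-β))) (by fun_prop),
          lintegral_Ioi_rpow (by linarith) hρ, setLIntegral_const, Real.volume_Ioc,
          sub_zero, neg_neg, ENNReal.ofReal_mul (Real.rpow_nonneg hρ.le _)]
        ring
    _ = _ := by
        rw [← mul_assoc _ _ K, ← ENNReal.ofReal_mul hρβ.le, ← ENNReal.ofReal_add (by positivity)
          (div_nonneg (by positivity) (by linarith)), ← Real.rpow_add_one hρ.ne',
          show -(β - 1) = -β + 1 by ring]
        congr 2; ring

/-- The interpolation inequality in parabolic Morrey spaces, for functions controlled by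
parabolic averages. -/
theorem morreyE_sub_one_le (hp : 1 < p) (hq : 1 < q) (hβ : 1 < β) {V : SpT d → ℝ≥0∞}
    (hV : Measurable V) (hF : Measurable F) {C : ℝ≥0}
    (h : ∀ z, V z ≤ C * (parAv 1 V z + ∫⁻ r in Ioc 0 1, parAv r F z)) :
    morreyE d p q (β - 1) V ≤ C * (ENNReal.ofReal (1 + 1 / (β - 1)) * volume (ball (0 : Spc d) 1)) *
      (morreyE d p q β V + morreyE d p q β F) := by
  have hβ1 : 0 < 1 / (β - 1) := one_div_pos.2 (by linarith)
  rw [show (C * (ENNReal.ofReal (1 + 1 / (β - 1)) * volume (ball (0 : Spc d) 1)) *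
      (morreyE d p q β V + morreyE d p q β F) : ℝ≥0∞) = C * (ENNReal.ofReal (1 + 1 / (β - 1)) *
        (volume (ball (0 : Spc d) 1) * morreyE d p q β V) + ENNReal.ofReal (1 + 1 / (β - 1)) *
        (volume (ball (0 : Spc d) 1) * morreyE d p q β F)) by ring]
  refine iSup_le fun ρ => iSup_le fun hρ => iSup_le fun hρ1 => iSup_le fun t₀ => iSup_le fun x₀ => ?_
  have hm : Measurable fun z => ∫⁻ r in Ioc 0 1, parAv r F z :=
    ((measurable_parAv_uncurry hF).comp measurable_swap).lintegral_prod_right'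
      (ν := volume.restrict (Ioc (0 : ℝ) 1))
  have h1 : mixN p q (cylT ρ t₀) (cylX d ρ x₀) V ≤ C * (ENNReal.ofReal (ρ ^ (-(β - 1))) *
      (ENNReal.ofReal (1 + 1 / (β - 1)) * (volume (ball (0 : Spc d) 1) * morreyE d p q β V) +
      ENNReal.ofReal (1 + 1 / (β - 1)) * (volume (ball (0 : Spc d) 1) * morreyE d p q β F))) := by
    refine (mixN_mono hp hq h).trans ?_
    rw [mixN_const_mul hp hq coe_ne_top]
    gcongr
    refine (mixN_add_le hp hq (measurable_parAv hV 1) hm).trans ?_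
    rw [mul_add]
    gcongr
    · refine (mixN_parAv_le_radius (β := β) hp hq hV one_pos le_rfl hρ t₀ x₀).trans ?_
      rw [Real.one_rpow, ENNReal.ofReal_one, ← mul_assoc (ENNReal.ofReal _)]
      gcongr
      rw [← ENNReal.ofReal_mul (by positivity), ← ENNReal.ofReal_one]
      refine ENNReal.ofReal_le_ofReal ?_
      have := Real.one_le_rpow_of_pos_of_le_one_of_nonpos hρ hρ1 (z := -(β - 1)) (by linarith)
      nlinarith
    · exact mixN_lintegral_parAv_le hp hq hβ hF hρ hρ1 t₀ x₀
  refine (mul_le_mul_right h1 _).trans (le_of_eq ?_)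
  rw [mul_left_comm, ← mul_assoc (ENNReal.ofReal (ρ ^ (β - 1))),
    mul_comm (ENNReal.ofReal (ρ ^ (β - 1))),
    ofReal_rpow_neg_mul hρ, one_mul]
end parAv

section representation
variable {d : ℕ}

theorem hasDerivAt_parabolic {v : SpT d → ℝ} (hv : ContDiff ℝ 1 v) (z : SpT d) (s : ℝ) (y : Spc d)
    (r : ℝ) : HasDerivAt (fun r : ℝ => v (z + (r ^ 2 * s, r • y)))
      (fderiv ℝ v (z + (r ^ 2 * s, r • y)) (2 * r * s, y)) r := by
  have h1 : HasDerivAt (fun r : ℝ => z + (r ^ 2 * s, r • y)) (2 * r * s, y) r := by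
    refine HasDerivAt.const_add z (HasDerivAt.prodMk ?_ ?_)
    · simpa using (hasDerivAt_pow 2 r).mul_const s
    · simpa using (hasDerivAt_id r).smul_const y
  exact ((hv.differentiable one_ne_zero) _).hasFDerivAt.comp_hasDerivAt r h1

/-- Integration by parts turns a mixed derivative into a first order derivative. -/
theorem integral_bump_mul_fderiv {η : Spc d → ℝ} (hη : ContDiff ℝ 1 η) (hηs : HasCompactSupport η)
    {v T : SpT d → ℝ} (hv : ContDiff ℝ 1 v) (hT : ContDiff ℝ 1 T) (i : Fin d)
    (hvT : ∀ z, fderiv ℝ v z (dirT d) = fderiv ℝ T z (dirS d i)) (z : SpT d) (s r : ℝ) :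
    ∫ y, η y * fderiv ℝ v (z + (r ^ 2 * s, r • y)) (2 * r * s, y) =
      ∫ y, (η y * fderiv ℝ v (z + (r ^ 2 * s, r • y)) (0, y)
        - 2 * s * (fderiv ℝ η y (EuclideanSpace.single i 1) * T (z + (r ^ 2 * s, r • y)))) := by
  set P : Spc d → SpT d := fun y => z + (r ^ 2 * s, r • y) with hP
  have hPc : Continuous P := by fun_prop
  have hPC : ContDiff ℝ 1 P := by fun_prop
  have hdv : Continuous (fderiv ℝ v) := hv.continuous_fderiv one_ne_zero
  have hdη : Continuous (fderiv ℝ η) := hη.continuous_fderiv one_ne_zero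
  set e : Spc d := EuclideanSpace.single i 1 with he
  set h : Spc d → ℝ := fun y => T (P y) with hh
  have hhC : ContDiff ℝ 1 h := hT.comp hPC
  have hhd : ∀ y, fderiv ℝ h y e = r * fderiv ℝ v (P y) (dirT d) := fun y => by
    have h1 : HasFDerivAt P
        ((0 : Spc d →L[ℝ] ℝ).prod (r • ContinuousLinearMap.id ℝ (Spc d))) y := by
      refine HasFDerivAt.const_add z (HasFDerivAt.prodMk (hasFDerivAt_const _ _) ?_)
      exact (hasFDerivAt_id y).const_smul r
    have h2 := ((hT.differentiable one_ne_zero) (P y)).hasFDerivAt.comp y h1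
    have h3 : fderiv ℝ h y = _ := h2.fderiv
    rw [h3, hvT]
    have : ((0 : Spc d →L[ℝ] ℝ).prod (r • ContinuousLinearMap.id ℝ (Spc d))) e
        = r • dirS d i := by
      simp [dirS, he]
    rw [ContinuousLinearMap.comp_apply, this, map_smul, smul_eq_mul]
  have int : ∀ {f : Spc d → ℝ}, Continuous f → HasCompactSupport f → Integrable f :=
    fun h1 h2 => h1.integrable_of_hasCompactSupport h2
  have hηe : HasCompactSupport fun y => fderiv ℝ η y e :=
    (hηs.fderiv (𝕜 := ℝ)).comp_left (g := fun A : Spc d →L[ℝ] ℝ => A e) rfl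
  have hhdc : Continuous fun y => fderiv ℝ h y e :=
    (hhC.continuous_fderiv one_ne_zero).clm_apply continuous_const
  have hibp : ∫ y, η y * fderiv ℝ h y e = - ∫ y, fderiv ℝ η y e * h y :=
    integral_mul_fderiv_eq_neg_fderiv_mul_of_integrable
      (int ((hdη.clm_apply continuous_const).mul hhC.continuous) hηe.mul_right)
      (int (hη.continuous.mul hhdc) hηs.mul_right)
      (int (hη.continuous.mul hhC.continuous) hηs.mul_right)
      (fun x _ => hη.differentiable one_ne_zero x) (fun x _ => hhC.differentiable one_ne_zero x)
  have hsplit : ∀ y, fderiv ℝ v (P y) (2 * r * s, y)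
      = fderiv ℝ v (P y) (0, y) + 2 * s * (fderiv ℝ h y e) := fun y => by
    have : ((2 * r * s, y) : SpT d) = (0, y) + (2 * r * s) • dirT d := by simp [dirT]
    rw [this, map_add, map_smul, hhd, smul_eq_mul]; ring
  have c1 : Continuous fun y => η y * fderiv ℝ v (P y) (0, y) :=
    hη.continuous.mul ((hdv.comp hPc).clm_apply (by fun_prop))
  have i1 := int c1 hηs.mul_right
  have i2 : Integrable fun y => η y * fderiv ℝ h y e :=
    int (hη.continuous.mul hhdc) hηs.mul_right
  have i3 : Integrable fun y => fderiv ℝ η y e * h y :=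
    int ((hdη.clm_apply (continuous_const (y := e))).mul hhC.continuous) hηe.mul_right
  calc ∫ y, η y * fderiv ℝ v (P y) (2 * r * s, y)
      = ∫ y, (η y * fderiv ℝ v (P y) (0, y) + 2 * s * (η y * fderiv ℝ h y e)) := by
        congr 1; ext y; rw [hsplit]; ring
    _ = (∫ y, η y * fderiv ℝ v (P y) (0, y)) + 2 * s * ∫ y, η y * fderiv ℝ h y e := by
        rw [integral_add i1 (i2.const_mul _), integral_const_mul]
    _ = (∫ y, η y * fderiv ℝ v (P y) (0, y)) - 2 * s * ∫ y, fderiv ℝ η y e * h y := by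
        rw [hibp]; ring
    _ = _ := by rw [integral_sub i1 (i3.const_mul _), integral_const_mul]

theorem eq_integral_sub_integral {η : Spc d → ℝ} (hη : ContDiff ℝ 1 η) (hηs : HasCompactSupport η)
    (hη1 : ∫ y, η y = 1) {v : SpT d → ℝ} (hv : ContDiff ℝ 1 v) (z : SpT d) (s : ℝ) :
    v z = (∫ y, η y * v (z + (s, y))) - ∫ r in (0 : ℝ)..1, ∫ y,
      η y * fderiv ℝ v (z + (r ^ 2 * s, r • y)) (2 * r * s, y) := by
  set ψ : ℝ → Spc d → ℝ := fun r y => η y * fderiv ℝ v (z + (r ^ 2 * s, r • y)) (2 * r * s, y)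
    with hψ
  have hdv : Continuous (fderiv ℝ v) := hv.continuous_fderiv one_ne_zero
  have hψc : Continuous (Function.uncurry ψ) := by
    refine Continuous.mul (hη.continuous.comp continuous_snd) ?_
    exact (hdv.comp (by fun_prop)).clm_apply (by fun_prop)
  have hi : Integrable (Function.uncurry ψ) ((volume.restrict (uIoc (0 : ℝ) 1)).prod
      (volume.restrict (tsupport η))) := by
    rw [Measure.prod_restrict, uIoc_of_le zero_le_one]
    exact (hψc.continuousOn.integrableOn_compact (isCompact_Icc.prod hηs)).mono_set
      (prod_mono Ioc_subset_Icc_self le_rfl)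
  have hz : ∀ r, ∀ y ∉ tsupport η, ψ r y = 0 := fun r y hy => by
    rw [hψ]; simp only [image_eq_zero_of_notMem_tsupport hy, zero_mul]
  have hswap := intervalIntegral_integral_swap hi
  have e1 : ∀ r, ∫ y in tsupport η, ψ r y = ∫ y, ψ r y := fun r =>
    setIntegral_eq_integral_of_forall_compl_eq_zero (hz r)
  have e2 : ∫ y in tsupport η, ∫ r in (0 : ℝ)..1, ψ r y = ∫ y, ∫ r in (0 : ℝ)..1, ψ r y :=
    setIntegral_eq_integral_of_forall_compl_eq_zero fun y hy => by simp [hz _ y hy]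
  simp only [e1, e2] at hswap
  have hftc : ∀ y, ∫ r in (0 : ℝ)..1, ψ r y = η y * v (z + (s, y)) - η y * v z := fun y => by
    have hc : Continuous fun r : ℝ =>
        fderiv ℝ v (z + (r ^ 2 * s, r • y)) (2 * r * s, y) :=
      (hdv.comp (by fun_prop)).clm_apply (by fun_prop)
    have := intervalIntegral.integral_eq_sub_of_hasDerivAt
      (fun r _ => hasDerivAt_parabolic hv z s y r) (hc.intervalIntegrable 0 1)
    rw [hψ]
    simp only [intervalIntegral.integral_const_mul, this]
    simp [mul_sub, show ((0, 0) : SpT d) = 0 from rfl]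
  have int : ∀ {f : Spc d → ℝ}, Continuous f → HasCompactSupport f → Integrable f :=
    fun h1 h2 => h1.integrable_of_hasCompactSupport h2
  rw [hswap]
  simp only [hftc]
  have i1 : Integrable fun y => η y * v (z + (s, y)) :=
    int (hη.continuous.mul (hv.continuous.comp (by fun_prop))) hηs.mul_right
  have i2 : Integrable fun y => η y * v z :=
    int (hη.continuous.mul continuous_const) hηs.mul_right
  rw [integral_sub i1 i2, integral_mul_const, hη1]
  ring

/-- A pointwise bound of a function by parabolic averages of its derivatives. -/
theorem exists_enorm_le_parAv (d : ℕ) : ∃ C : ℝ≥0, ∀ (v T : SpT d → ℝ) (F : SpT d → ℝ≥0∞),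
    ContDiff ℝ 1 v → ContDiff ℝ 1 T → Measurable F → ∀ i : Fin d,
    (∀ z, fderiv ℝ v z (dirT d) = fderiv ℝ T z (dirS d i)) → (∀ z, ‖T z‖ₑ ≤ F z) →
    (∀ z, ∀ y ∈ ball (0 : Spc d) 1, ‖fderiv ℝ v z (0, y)‖ₑ ≤ F z) →
    ∀ z, ‖v z‖ₑ ≤ C * (parAv 1 (fun z => ‖v z‖ₑ) z + ∫⁻ r in Ioc 0 1, parAv r F z) := by
  let f : ContDiffBump (0 : Spc d) := ⟨1 / 4, 1 / 2, by norm_num, by norm_num⟩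
  set η : Spc d → ℝ := f.normed volume with hη
  have hηC : ContDiff ℝ 1 η := f.contDiff_normed
  have hηs : HasCompactSupport η := f.hasCompactSupport_normed
  have hη1 : ∫ y, η y = 1 := f.integral_normed
  have hts : tsupport η ⊆ ball 0 1 := by
    rw [hη, f.tsupport_normed_eq]
    exact closedBall_subset_ball (by change (1 / 2 : ℝ) < 1; norm_num)
  obtain ⟨L₁, hL₁⟩ := hηs.exists_bound_of_continuous hηC.continuous
  obtain ⟨L₂, hL₂⟩ := (hηs.fderiv (𝕜 := ℝ)).exists_bound_of_continuous
    (hηC.continuous_fderiv one_ne_zero)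
  set L : ℝ≥0 := (max L₁ L₂).toNNReal with hL
  have hb1 : ∀ y, ‖η y‖ₑ ≤ L := fun y => by
    rw [← ofReal_norm]; exact ENNReal.ofReal_le_ofReal ((hL₁ y).trans (le_max_left _ _))
  have hb2 : ∀ y (i : Fin d), ‖fderiv ℝ η y (EuclideanSpace.single i 1)‖ₑ ≤ L := fun y i => by
    rw [← ofReal_norm]
    refine ENNReal.ofReal_le_ofReal ((ContinuousLinearMap.le_opNorm _ _).trans ?_)
    rw [PiLp.norm_single, norm_one, mul_one]
    exact (hL₂ y).trans (le_max_right _ _)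
  have hs1 : ∀ y ∉ ball (0 : Spc d) 1, η y = 0 := fun y hy =>
    image_eq_zero_of_notMem_tsupport fun h => hy (hts h)
  have hs2 : ∀ y ∉ ball (0 : Spc d) 1, fderiv ℝ η y = 0 := fun y hy => by
    by_contra h
    exact hy (hts (support_fderiv_subset ℝ h))
  have bound : ∀ {h : Spc d → ℝ} {H : Spc d → ℝ≥0∞}, (∀ y ∉ ball (0 : Spc d) 1, h y = 0) →
      (∀ y ∈ ball (0 : Spc d) 1, ‖h y‖ₑ ≤ H y) → ‖∫ y, h y‖ₑ ≤ ∫⁻ y in ball 0 1, H y := by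
    intro h H h0 hH
    rw [← setIntegral_eq_integral_of_forall_compl_eq_zero h0]
    exact (enorm_integral_le_lintegral_enorm _).trans (setLIntegral_mono' measurableSet_ball hH)
  refine ⟨3 * L, fun v T F hv hT hF i hvT hTF hvF z => ?_⟩
  have key : ∀ s ∈ Ico (0 : ℝ) 1, ‖v z‖ₑ ≤ 3 * L * ((∫⁻ y in ball 0 1, ‖v (z + (s, y))‖ₑ) +
      ∫⁻ r in Ioc (0 : ℝ) 1, ∫⁻ y in ball 0 1, F (z + (r ^ 2 * s, r • y))) := by
    intro s hs
    have hse : ‖(2 * s : ℝ)‖ₑ ≤ 2 := by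
      rw [← ofReal_norm, Real.norm_of_nonneg (by linarith [hs.1]), ← ENNReal.ofReal_ofNat 2]
      exact ENNReal.ofReal_le_ofReal (by linarith [hs.2])
    rw [eq_integral_sub_integral hηC hηs hη1 hv z s]
    refine enorm_sub_le.trans ?_
    rw [mul_add]
    refine add_le_add ?_ ?_
    · refine (bound (fun y hy => by rw [hs1 y hy, zero_mul]) (H := fun y =>
        3 * L * ‖v (z + (s, y))‖ₑ) fun y _ => ?_).trans (lintegral_const_mul' _ _ (by finiteness)).le
      rw [enorm_mul]
      gcongr
      exact (hb1 y).trans (le_mul_of_one_le_left' (by norm_num))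
    · rw [intervalIntegral.integral_of_le zero_le_one, ← lintegral_const_mul' _ _ (by finiteness)]
      refine (enorm_integral_le_lintegral_enorm _).trans (lintegral_mono fun r => ?_)
      dsimp only
      rw [integral_bump_mul_fderiv hηC hηs hv hT i hvT, ← lintegral_const_mul' _ _ (by finiteness)]
      refine bound (fun y hy => by rw [hs1 y hy, hs2 y hy]; simp) fun y hy => ?_
      refine enorm_sub_le.trans ?_
      rw [enorm_mul (η y), enorm_mul (2 * s), enorm_mul (fderiv ℝ η y _)]
      calc _ ≤ L * F (z + (r ^ 2 * s, r • y)) + 2 * (L * F (z + (r ^ 2 * s, r • y))) := by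
            gcongr
            · exact hb1 y
            · exact hvF _ y hy
            · exact hb2 y i
            · exact hTF _
        _ = _ := by ring
  have hvm : Measurable fun z => ‖v z‖ₑ := hv.continuous.enorm.measurable
  have hm : Measurable fun w : (ℝ × ℝ) × Spc d => F (z + (w.1.2 ^ 2 * w.1.1, w.1.2 • w.2)) :=
    hF.comp (by fun_prop)
  have hm2 := hm.lintegral_prod_right' (ν := volume.restrict (ball (0 : Spc d) 1))
  have hm1 : Measurable fun w : ℝ × Spc d => ‖v (z + (w.1, w.2))‖ₑ := hvm.comp (by fun_prop)
  have hm1' := hm1.lintegral_prod_right' (ν := volume.restrict (ball (0 : Spc d) 1))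
  calc ‖v z‖ₑ = ∫⁻ _ in Ico (0 : ℝ) 1, ‖v z‖ₑ := by simp
    _ ≤ ∫⁻ s in Ico (0 : ℝ) 1, 3 * L * ((∫⁻ y in ball 0 1, ‖v (z + (s, y))‖ₑ) +
      ∫⁻ r in Ioc (0 : ℝ) 1, ∫⁻ y in ball 0 1, F (z + (r ^ 2 * s, r • y))) :=
        setLIntegral_mono' measurableSet_Ico key
    _ = _ := by
        have hswap := lintegral_lintegral_swap (μ := volume.restrict (Ico (0 : ℝ) 1))
          (ν := volume.restrict (Ioc (0 : ℝ) 1)) (f := fun s r => ∫⁻ y in ball (0 : Spc d) 1,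
            F (z + (r ^ 2 * s, r • y))) hm2.aemeasurable
        rw [lintegral_const_mul' _ _ (by finiteness), lintegral_add_left hm1', hswap]
        simp [parAv]
end representation

section smooth
variable {d : ℕ}

theorem fderiv_apply_spatial_eq (v : SpT d → ℝ) (z : SpT d) (y : Spc d) :
    fderiv ℝ v z (0, y) = ∑ j, y j * fderiv ℝ v z (dirS d j) := by
  have : ((0, y) : SpT d) = ∑ j, y j • dirS d j := by
    refine Prod.ext ?_ ?_
    · simp [Prod.fst_sum, dirS]
    · ext k
      simp [Prod.snd_sum, dirS, Pi.single_apply]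
  rw [this, map_sum]
  simp

theorem enorm_fderiv_spatial_le (v : SpT d → ℝ) (z : SpT d) (y : Spc d) :
    ‖fderiv ℝ v z (0, y)‖ₑ ≤ ‖y‖ₑ * ∑ j, ‖fderiv ℝ v z (dirS d j)‖ₑ := by
  rw [fderiv_apply_spatial_eq, Finset.mul_sum]
  refine (enorm_sum_le _ _).trans (Finset.sum_le_sum fun j _ => ?_)
  rw [enorm_mul]
  gcongr
  rw [← ofReal_norm, ← ofReal_norm]
  exact ENNReal.ofReal_le_ofReal (PiLp.norm_apply_le y j)

theorem enorm_fderiv_slice_le {v : SpT d → ℝ} (hv : ContDiff ℝ 1 v) (z : SpT d) :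
    ‖fderiv ℝ (fun x => v (z.1, x)) z.2‖ₑ ≤ ∑ j, ‖fderiv ℝ v z (dirS d j)‖ₑ := by
  have h1 : HasFDerivAt (fun x : Spc d => ((z.1, x) : SpT d))
      ((0 : Spc d →L[ℝ] ℝ).prod (ContinuousLinearMap.id ℝ (Spc d))) z.2 :=
    HasFDerivAt.prodMk (hasFDerivAt_const _ _) (hasFDerivAt_id _)
  have h2 := ((hv.differentiable one_ne_zero) (z.1, z.2)).hasFDerivAt.comp z.2 h1
  have h3 : fderiv ℝ (fun x => v (z.1, x)) z.2 = _ := h2.fderiv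
  have hfin : (∑ j, ‖fderiv ℝ v z (dirS d j)‖ₑ) ≠ ⊤ := ENNReal.sum_ne_top.2 fun j _ => enorm_ne_top
  rw [← ofReal_norm]
  refine ENNReal.ofReal_le_of_le_toReal (ContinuousLinearMap.opNorm_le_bound _
    ENNReal.toReal_nonneg fun y => ?_)
  rw [h3]
  have h4 := ENNReal.toReal_mono (by finiteness) (enorm_fderiv_spatial_le v z y)
  rw [ENNReal.toReal_mul, toReal_enorm, toReal_enorm] at h4
  rw [mul_comm]
  simpa using h4

theorem fderiv_fderiv_comm {U : SpT d → ℝ} (hU : ContDiff ℝ (⊤ : ℕ∞) U) (z e e' : SpT d) :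
    fderiv ℝ (fun w => fderiv ℝ U w e) z e' = fderiv ℝ (fun w => fderiv ℝ U w e') z e := by
  have hd : DifferentiableAt ℝ (fderiv ℝ U) z :=
    (hU.fderiv_right (m := 1) (by norm_cast)).differentiable one_ne_zero z
  have h : ∀ e e', fderiv ℝ (fun w => fderiv ℝ U w e) z e' = fderiv ℝ (fderiv ℝ U) z e' e :=
    fun e e' => by rw [fderiv_clm_apply hd (by fun_prop)]; simp
  rw [h, h]
  exact (hU.contDiffAt.isSymmSndFDerivAt
    (by rw [minSmoothness_of_isRCLikeNormedField]
        exact WithTop.coe_le_coe.2 (le_top : (2 : ℕ∞) ≤ ⊤))) e' e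

/-- The drift estimate for smooth functions. -/
theorem exists_morreyE_drift_le (d : ℕ) {p q β s R : ℝ} (hp : 1 < p) (hq : 1 < q) (hβ : 1 < β)
    (hps : p < s) (hR : 0 < R) (hR1 : 2 * R ≤ 1) (K : ℝ≥0) :
    ∃ C : ℝ≥0, ∀ g : Spc d → ℝ≥0∞, Measurable g →
      (∀ r x, 0 < r → r ≤ 2 * R →
        ballAv r (fun x => g x ^ s) x ≤ K * ENNReal.ofReal (r ^ (-s))) →
      ∀ U : SpT d → ℝ, ContDiff ℝ (⊤ : ℕ∞) U → ∀ i,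
        morreyE d p q β (fun z => g z.2 * ‖fderiv ℝ U z (dirS d i)‖ₑ) ≤
          C * (morreyE d p q β (fun z => ‖fderiv ℝ U z (dirS d i)‖ₑ) +
            morreyE d p q β (fun z => ‖fderiv ℝ U z (dirT d)‖ₑ) +
            ∑ j, morreyE d p q β
              (fun z => ‖fderiv ℝ (fun w => fderiv ℝ U w (dirS d i)) z (dirS d j)‖ₑ)) := by
  obtain ⟨C₁, hC₁⟩ := exists_morreyE_mul_le d β hp hq hps hR hR1 K
  obtain ⟨C₂, hC₂⟩ := exists_enorm_le_parAv d
  have hNt : (C₁ * (1 + C₂ * (ENNReal.ofReal (1 + 1 / (β - 1)) * volume (ball (0 : Spc d) 1)))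
      : ℝ≥0∞) ≠ ⊤ := by
    have := volume_ball_ne_top (ρ := 1) (0 : Spc d)
    finiteness
  refine ⟨(C₁ * (1 + C₂ * (ENNReal.ofReal (1 + 1 / (β - 1)) * volume (ball (0 : Spc d) 1)))
      : ℝ≥0∞).toNNReal, fun g hg hgs U hU i => ?_⟩
  rw [ENNReal.coe_toNNReal hNt]
  have hdir : ∀ e, ContDiff ℝ 1 fun z => fderiv ℝ U z e := fun e =>
    (hU.fderiv_right (m := 1) (by norm_cast)).clm_apply contDiff_const
  set v : SpT d → ℝ := fun z => fderiv ℝ U z (dirS d i) with hv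
  set T : SpT d → ℝ := fun z => fderiv ℝ U z (dirT d) with hT
  have hmT : Measurable fun z => ‖T z‖ₑ := (hdir _).continuous.enorm.measurable
  have hmv : Measurable fun z => ‖v z‖ₑ := (hdir _).continuous.enorm.measurable
  have hmd : ∀ j, Measurable fun z => ‖fderiv ℝ v z (dirS d j)‖ₑ := fun j =>
    (((hdir _).continuous_fderiv one_ne_zero).clm_apply continuous_const).enorm.measurable
  set F : SpT d → ℝ≥0∞ := fun z => ‖T z‖ₑ + ∑ j, ‖fderiv ℝ v z (dirS d j)‖ₑ with hF
  have hmS : Measurable fun z => ∑ j, ‖fderiv ℝ v z (dirS d j)‖ₑ :=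
    Finset.measurable_sum _ fun j _ => hmd j
  have hmF : Measurable F := hmT.add hmS
  have hFle : morreyE d p q β F ≤ morreyE d p q β (fun z => ‖T z‖ₑ) +
      ∑ j, morreyE d p q β (fun z => ‖fderiv ℝ v z (dirS d j)‖ₑ) :=
    (morreyE_add_le hp hq hmT hmS).trans (add_le_add_right (morreyE_sum_le hp hq hmd) _)
  have h1 := hC₁ g hg hgs v (hdir _) F hmF fun z =>
    (enorm_fderiv_slice_le (hdir _) z).trans le_add_self
  have h2 := morreyE_sub_one_le hp hq hβ hmv hmF <|
    hC₂ v T F (hdir _) (hdir _) hmF i (fun z => fderiv_fderiv_comm hU z _ _)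
      (fun z => le_self_add) fun z y hy => by
        refine (enorm_fderiv_spatial_le v z y).trans ?_
        refine le_trans ?_ (le_add_self : _ ≤ F z)
        refine mul_le_of_le_one_left' ?_
        rw [← ofReal_norm, ← ENNReal.ofReal_one]
        exact ENNReal.ofReal_le_ofReal (mem_ball_zero_iff.1 hy).le
  set a := morreyE d p q β (fun z => ‖v z‖ₑ)
  set e : ℝ≥0∞ := C₂ * (ENNReal.ofReal (1 + 1 / (β - 1)) * volume (ball (0 : Spc d) 1))
  calc _ ≤ C₁ * (morreyE d p q β F + morreyE d p q (β - 1) (fun z => ‖v z‖ₑ)) := h1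
    _ ≤ C₁ * ((a + morreyE d p q β F) + e * (a + morreyE d p q β F)) := by
        gcongr
        exact le_add_self
    _ = C₁ * (1 + e) * (a + morreyE d p q β F) := by ring
    _ ≤ _ := by
        rw [add_assoc]
        gcongr
end smooth

section mollification
open scoped Convolution
open ContinuousLinearMap (lsmul)
variable {d : ℕ} {p q β : ℝ}

instance isAddHaarMeasure_volume_spT : (volume : Measure (SpT d)).IsAddHaarMeasure := by
  rw [Measure.volume_eq_prod]; infer_instance

theorem locallyIntegrable_of_morreyE (hp : 1 < p) (hq : 1 < q) {f : SpT d → ℝ}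
    (hf : Measurable f) (h : morreyE d p q β (fun z => ‖f z‖ₑ) ≠ ⊤) :
    LocallyIntegrable f := by
  intro z
  have := isProbabilityMeasure_cylT one_pos (z.1 - 1 / 2)
  have := isProbabilityMeasure_cylX one_pos z.2
  have h1 : ∫⁻ t, ∫⁻ x, ‖f (t, x)‖ₑ ∂(cylX d 1 z.2) ∂(cylT 1 (z.1 - 1 / 2)) < ⊤ :=
    (((lintegral_le_mixN hp hq hf.enorm).trans (mixN_cyl_le one_pos le_rfl _ _ _)).trans_lt
      (ENNReal.mul_lt_top ENNReal.ofReal_lt_top h.lt_top))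
  refine ⟨Ioo (z.1 - 1 / 2) (z.1 - 1 / 2 + 1 ^ 2) ×ˢ ball z.2 1, ?_, hf.aestronglyMeasurable, ?_⟩
  · rw [← Prod.mk.eta (p := z)]
    exact prod_mem_nhds (Ioo_mem_nhds (by simp) (by norm_num; linarith))
      (ball_mem_nhds _ one_pos)
  · refine lt_of_le_of_lt (lintegral_mono_set (prod_mono_left Ioo_subset_Ico_self)) ?_
    rw [Measure.volume_eq_prod, ← Measure.prod_restrict,
      lintegral_prod _ hf.enorm.aemeasurable]
    simp only [cylT, cylX, lintegral_smul_measure, smul_eq_mul] at h1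
    rw [lintegral_const_mul' _ _ (ENNReal.inv_ne_top.2 (volume_ball_ne_zero one_pos _))] at h1
    have h2 := (ENNReal.mul_lt_top_iff.1 h1)
    rcases h2 with ⟨-, h2⟩ | h2 | h2
    · rcases ENNReal.mul_lt_top_iff.1 h2 with ⟨-, h2⟩ | h2 | h2
      · exact h2
      · exact absurd h2 (ENNReal.inv_ne_zero.2 (volume_ball_ne_top _))
      · rw [h2]; simp
    · simp at h2
    · rcases mul_eq_zero.1 h2 with h2 | h2
      · exact absurd h2 (ENNReal.inv_ne_zero.2 (volume_ball_ne_top _))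
      · rw [h2]; simp

theorem fderiv_convolution_apply {f g : SpT d → ℝ} (hf : LocallyIntegrable f)
    (hg : ContDiff ℝ 1 g) (hcg : HasCompactSupport g) (z e : SpT d) :
    fderiv ℝ (f ⋆[lsmul ℝ ℝ] g) z e = (f ⋆[lsmul ℝ ℝ] fun a => fderiv ℝ g a e) z := by
  rw [(HasCompactSupport.hasFDerivAt_convolution_right (lsmul ℝ ℝ) hcg hf hg z).fderiv,
    convolution_precompR_apply _ hf (hcg.fderiv ℝ) (hg.continuous_fderiv one_ne_zero)]

theorem fderiv_comp_const_sub_apply {g : SpT d → ℝ} (hg : ContDiff ℝ 1 g) (z t e : SpT d) :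
    fderiv ℝ (fun s => g (z - s)) t e = -fderiv ℝ g (z - t) e := by
  have h : HasFDerivAt (fun s => z - s) (-(ContinuousLinearMap.id ℝ (SpT d))) t :=
    (hasFDerivAt_id t).const_sub z
  have h2 : fderiv ℝ (fun s => g (z - s)) t = _ :=
    ((hg.differentiable one_ne_zero (z - t)).hasFDerivAt.comp t h).fderiv
  rw [h2]; simp

theorem hasCompactSupport_comp_const_sub {g : SpT d → ℝ} (hg : HasCompactSupport g) (z : SpT d) :
    HasCompactSupport fun s => g (z - s) :=
  hg.comp_homeomorph (Homeomorph.subLeft z)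

theorem contDiff_fderiv_apply {g : SpT d → ℝ} (hg : ContDiff ℝ (⊤ : ℕ∞) g) (e : SpT d) :
    ContDiff ℝ (⊤ : ℕ∞) fun a => fderiv ℝ g a e :=
  (hg.fderiv_right (m := (⊤ : ℕ∞)) (by norm_cast)).clm_apply contDiff_const

theorem IsWeakDeriv.fderiv_convolution {u v g : SpT d → ℝ} {e : SpT d}
    (h : IsWeakDeriv d u v e) (hu : LocallyIntegrable u)
    (hg : ContDiff ℝ (⊤ : ℕ∞) g) (hcg : HasCompactSupport g) (z : SpT d) :
    fderiv ℝ (u ⋆[lsmul ℝ ℝ] g) z e = (v ⋆[lsmul ℝ ℝ] g) z := by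
  have hg1 : ContDiff ℝ 1 g := hg.of_le (by norm_cast)
  rw [fderiv_convolution_apply hu hg1 hcg, convolution_def, convolution_def]
  have := h (fun t => g (z - t)) (hg.comp (contDiff_const.sub contDiff_id))
    (hasCompactSupport_comp_const_sub hcg z)
  simp only [fderiv_comp_const_sub_apply hg1, mul_neg, integral_neg, neg_inj] at this
  simpa using this

theorem IsWeakDeriv2.fderiv_convolution {u v g : SpT d → ℝ} {e₁ e₂ : SpT d}
    (h : IsWeakDeriv2 d u v e₁ e₂) (hu : LocallyIntegrable u)
    (hg : ContDiff ℝ (⊤ : ℕ∞) g) (hcg : HasCompactSupport g) (z : SpT d) :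
    fderiv ℝ (fun w => fderiv ℝ (u ⋆[lsmul ℝ ℝ] g) w e₁) z e₂ = (v ⋆[lsmul ℝ ℝ] g) z := by
  have hg1 : ContDiff ℝ 1 g := hg.of_le (by norm_cast)
  have hg2 : ContDiff ℝ 1 fun a => fderiv ℝ g a e₁ :=
    (contDiff_fderiv_apply hg e₁).of_le (by norm_cast)
  have e : (fun w => fderiv ℝ (u ⋆[lsmul ℝ ℝ] g) w e₁)
      = u ⋆[lsmul ℝ ℝ] fun a => fderiv ℝ g a e₁ :=
    funext fun w => fderiv_convolution_apply hu hg1 hcg w e₁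
  rw [e, fderiv_convolution_apply hu hg2 (hcg.fderiv_apply ℝ e₁), convolution_def, convolution_def]
  have := h (fun t => g (z - t)) (hg.comp (contDiff_const.sub contDiff_id))
    (hasCompactSupport_comp_const_sub hcg z)
  have e2 : ∀ t, fderiv ℝ (fun w => fderiv ℝ (fun t => g (z - t)) w e₁) t e₂
      = fderiv ℝ (fun a => fderiv ℝ g a e₁) (z - t) e₂ := fun t => by
    have : (fun w => fderiv ℝ (fun t => g (z - t)) w e₁)
        = fun w => (-(fun a => fderiv ℝ g a e₁)) (z - w) :=
      funext fun w => fderiv_comp_const_sub_apply hg1 z w e₁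
    rw [this]
    refine (fderiv_comp_const_sub_apply (g := -fun a => fderiv ℝ g a e₁) hg2.neg z t e₂).trans ?_
    rw [fderiv_neg]; simp
  simp only [e2] at this
  simpa using this

/-- Averaging against a probability density does not increase the Morrey norm. -/
theorem morreyE_convolution_le (hp : 1 < p) (hq : 1 < q) {f g : SpT d → ℝ} (hf : Measurable f)
    (hg : Continuous g) (hg0 : ∀ z, 0 ≤ g z) (hgi : Integrable g) (hg1 : ∫ z, g z = 1) :
    morreyE d p q β (fun z => ‖(f ⋆[lsmul ℝ ℝ] g) z‖ₑ) ≤ morreyE d p q β (fun z => ‖f z‖ₑ) := by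
  set κ : Measure (SpT d) := volume.withDensity fun z => ENNReal.ofReal (g z) with hκ
  have hκ1 : κ univ = 1 := by
    rw [hκ, withDensity_apply _ MeasurableSet.univ, Measure.restrict_univ,
      ← ofReal_integral_eq_lintegral_ofReal hgi (ae_of_all _ hg0), hg1, ENNReal.ofReal_one]
  have : IsProbabilityMeasure κ := ⟨hκ1⟩
  have hpt : ∀ z, ‖(f ⋆[lsmul ℝ ℝ] g) z‖ₑ ≤ ∫⁻ w, ‖f (z - w)‖ₑ ∂κ := fun z => by
    have hm : Measurable fun w => ‖f (z - w)‖ₑ :=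
      (hf.comp (measurable_const.sub measurable_id)).enorm
    rw [convolution_eq_swap, hκ, lintegral_withDensity_eq_lintegral_mul _
      hg.measurable.ennreal_ofReal hm]
    refine (enorm_integral_le_lintegral_enorm _).trans (lintegral_mono fun w => ?_)
    simp only [ContinuousLinearMap.lsmul_apply, smul_eq_mul, Pi.mul_apply, enorm_mul]
    rw [mul_comm, Real.enorm_of_nonneg (hg0 w)]
  refine morreyE_le fun ρ hρ hρ1 t₀ x₀ => ?_
  calc _ ≤ mixN p q (cylT ρ t₀) (cylX d ρ x₀) (fun z => ∫⁻ w, ‖f (z - w)‖ₑ ∂κ) :=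
        mixN_mono hp hq hpt
    _ ≤ ∫⁻ w, mixN p q (cylT ρ t₀) (cylX d ρ x₀) (fun z => ‖f (z - w)‖ₑ) ∂κ := by
        refine mixN_lintegral_le hp hq κ (f := fun w z => ‖f (z - w)‖ₑ) ?_
        exact (hf.comp (measurable_snd.sub measurable_fst)).enorm
    _ ≤ ∫⁻ _, ENNReal.ofReal (ρ ^ (-β)) * morreyE d p q β (fun z => ‖f z‖ₑ) ∂κ := by
        refine lintegral_mono fun w => ?_
        simp only [sub_eq_add_neg]
        rw [mixN_cyl_add ρ t₀ x₀ (fun z => ‖f z‖ₑ) (-w)]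
        exact mixN_cyl_le hρ hρ1 _ _ _
    _ = _ := by simp

/-- A fixed sequence of mollifiers. -/
theorem exists_mollifiers (d : ℕ) : ∃ φ : ℕ → SpT d → ℝ,
    (∀ n, ContDiff ℝ (⊤ : ℕ∞) (φ n)) ∧ (∀ n, HasCompactSupport (φ n)) ∧ (∀ n z, 0 ≤ φ n z) ∧
    (∀ n, ∫ z, φ n z = 1) ∧ ∀ f : SpT d → ℝ, LocallyIntegrable f →
      ∀ᵐ z, Tendsto (fun n => (f ⋆[lsmul ℝ ℝ] φ n) z) atTop (𝓝 (f z)) := by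
  let B : ℕ → ContDiffBump (0 : SpT d) := fun n =>
    ⟨1 / ((n : ℝ) + 1), 2 * (1 / ((n : ℝ) + 1)), by positivity, by
      have : 0 < 1 / ((n : ℝ) + 1) := by positivity
      linarith⟩
  refine ⟨fun n => (B n).normed volume, fun n => (B n).contDiff_normed,
    fun n => (B n).hasCompactSupport_normed, fun n z => (B n).nonneg_normed z,
    fun n => (B n).integral_normed, fun f hf => ?_⟩
  have h := ContDiffBump.ae_convolution_tendsto_right_of_locallyIntegrable (φ := B) (l := atTop)
    (K := 2) ?_ (Eventually.of_forall fun n => le_rfl) hf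
  · filter_upwards [h] with z hz
    refine hz.congr fun n => ?_
    rw [convolution_eq_swap, convolution_def]
    simp only [ContinuousLinearMap.lsmul_apply, smul_eq_mul, mul_comm]
  · simpa [B] using (tendsto_one_div_add_atTop_nhds_zero_nat (𝕜 := ℝ)).const_mul (2 : ℝ)

/-- The drift estimate for functions in the parabolic Sobolev-Morrey class. -/
theorem exists_morreyE_drift_weak_le (d : ℕ) {p q β s R : ℝ} (hp : 1 < p) (hq : 1 < q)
    (hβ : 1 < β) (hps : p < s) (hR : 0 < R) (hR1 : 2 * R ≤ 1) (K : ℝ≥0) :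
    ∃ C : ℝ≥0, ∀ g : Spc d → ℝ≥0∞, Measurable g → (∀ x, g x ≠ ⊤) →
      (∀ r x, 0 < r → r ≤ 2 * R →
        ballAv r (fun x => g x ^ s) x ≤ K * ENNReal.ofReal (r ^ (-s))) →
      ∀ (u ut : SpT d → ℝ) (Du : Fin d → SpT d → ℝ) (D2u : Fin d → Fin d → SpT d → ℝ),
        Measurable ut → (∀ i, Measurable (Du i)) → (∀ i j, Measurable (D2u i j)) →
        LocallyIntegrable u → (∀ i, LocallyIntegrable (Du i)) →
        IsWeakDeriv d u ut (dirT d) → (∀ i, IsWeakDeriv d u (Du i) (dirS d i)) →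
        (∀ i j, IsWeakDeriv2 d u (D2u i j) (dirS d i) (dirS d j)) → ∀ i,
        morreyE d p q β (fun z => g z.2 * ‖Du i z‖ₑ) ≤
          C * (morreyE d p q β (fun z => ‖Du i z‖ₑ) + morreyE d p q β (fun z => ‖ut z‖ₑ) +
            ∑ j, morreyE d p q β (fun z => ‖D2u i j z‖ₑ)) := by
  obtain ⟨C, hC⟩ := exists_morreyE_drift_le d hp hq hβ hps hR hR1 K
  obtain ⟨φ, hφs, hφc, hφ0, hφ1, hφ⟩ := exists_mollifiers d
  refine ⟨C, fun g hg hgt hgs u ut Du D2u hmt hmD hmD2 hu hDu ht hD hD2 i => ?_⟩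
  have hU : ∀ n, ContDiff ℝ (⊤ : ℕ∞) (u ⋆[lsmul ℝ ℝ] φ n) := fun n =>
    (hφc n).contDiff_convolution_right _ hu (hφs n)
  have hav : ∀ n {f : SpT d → ℝ}, Measurable f →
      morreyE d p q β (fun z => ‖(f ⋆[lsmul ℝ ℝ] φ n) z‖ₑ) ≤ morreyE d p q β (fun z => ‖f z‖ₑ) :=
    fun n f hf => morreyE_convolution_le hp hq hf (hφs n).continuous (hφ0 n)
      ((hφs n).continuous.integrable_of_hasCompactSupport (hφc n)) (hφ1 n)
  have hn : ∀ n, morreyE d p q β (fun z => g z.2 * ‖(Du i ⋆[lsmul ℝ ℝ] φ n) z‖ₑ) ≤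
      C * (morreyE d p q β (fun z => ‖Du i z‖ₑ) + morreyE d p q β (fun z => ‖ut z‖ₑ) +
            ∑ j, morreyE d p q β (fun z => ‖D2u i j z‖ₑ)) := fun n => by
    have h := hC g hg hgs _ (hU n) i
    simp only [(hD i).fderiv_convolution hu (hφs n) (hφc n),
      ht.fderiv_convolution hu (hφs n) (hφc n)] at h
    have e2 : ∀ j z, fderiv ℝ (fun w => (Du i ⋆[lsmul ℝ ℝ] φ n) w) z (dirS d j)
        = (D2u i j ⋆[lsmul ℝ ℝ] φ n) z := fun j z => by
      rw [← (hD2 i j).fderiv_convolution hu (hφs n) (hφc n)]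
      simp only [(hD i).fderiv_convolution hu (hφs n) (hφc n)]
    simp only [e2] at h
    refine h.trans (mul_le_mul_right (add_le_add (add_le_add (hav n (hmD i)) (hav n hmt))
      (Finset.sum_le_sum fun j _ => hav n (hmD2 i j))) _)
  refine morreyE_le fun ρ hρ hρ1 t₀ x₀ => ?_
  have hcont : ∀ n, Measurable fun z => ‖(Du i ⋆[lsmul ℝ ℝ] φ n) z‖ₑ := fun n =>
    ((hφc n).continuous_convolution_right _ (hDu i) (hφs n).continuous).enorm.measurable
  refine mixN_le_of_tendsto hp hq (f := fun n z => g z.2 * ‖(Du i ⋆[lsmul ℝ ℝ] φ n) z‖ₑ)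
    (fun n => (hg.comp measurable_snd).mul (hcont n)) ?_
    (fun n => (mixN_cyl_le hρ hρ1 _ _ _).trans (mul_le_mul_right (hn n) _))
  filter_upwards [ae_cyl_of_ae (hφ _ (hDu i)) ρ t₀ x₀] with t h
  filter_upwards [h] with x hx
  exact ENNReal.Tendsto.const_mul hx.enorm (Or.inr (hgt x))

end mollification

section assembly
variable {d : ℕ} {p q β : ℝ}

theorem IsWeakDeriv.congr_ae {u u' v v' : SpT d → ℝ} {e : SpT d} (h : IsWeakDeriv d u v e)
    (hu : u =ᵐ[volume] u') (hv : v =ᵐ[volume] v') : IsWeakDeriv d u' v' e := fun φ hφ hφc => by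
  rw [integral_congr_ae (hu.symm.mono fun z hz => by simp only [hz] :
      (fun z => u' z * fderiv ℝ φ z e) =ᵐ[volume] fun z => u z * fderiv ℝ φ z e),
    integral_congr_ae (hv.symm.mono fun z hz => by simp only [hz] :
      (fun z => v' z * φ z) =ᵐ[volume] fun z => v z * φ z)]
  exact h φ hφ hφc

theorem IsWeakDeriv2.congr_ae {u u' v v' : SpT d → ℝ} {e₁ e₂ : SpT d}
    (h : IsWeakDeriv2 d u v e₁ e₂) (hu : u =ᵐ[volume] u') (hv : v =ᵐ[volume] v') :
    IsWeakDeriv2 d u' v' e₁ e₂ := fun φ hφ hφc => by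
  rw [integral_congr_ae (hu.symm.mono fun z hz => by simp only [hz] :
      (fun z => u' z * fderiv ℝ (fun w => fderiv ℝ φ w e₁) z e₂) =ᵐ[volume]
        fun z => u z * fderiv ℝ (fun w => fderiv ℝ φ w e₁) z e₂),
    integral_congr_ae (hv.symm.mono fun z hz => by simp only [hz] :
      (fun z => v' z * φ z) =ᵐ[volume] fun z => v z * φ z)]
  exact h φ hφ hφc

theorem MemE.congr_ae (hp : 1 < p) (hq : 1 < q) {f f' : SpT d → ℝ} (h : MemE d p q β f)
    (hf : f =ᵐ[volume] f') : MemE d p q β f' := by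
  refine ⟨h.1.congr hf, ne_top_of_le_ne_top h.2 ?_⟩
  rw [morreyNorm_eq, morreyNorm_eq]
  exact morreyE_mono_ae hp hq (hf.mono fun z hz => by simp only [hz, le_refl])

/-- Coordinates of a vector-valued function are controlled by its magnitude. -/
theorem abs_le_gradMag (Du : Fin d → SpT d → ℝ) (i : Fin d) (z : SpT d) :
    |Du i z| ≤ gradMag d Du z :=
  Real.abs_le_sqrt
    (Finset.single_le_sum (f := fun i => Du i z ^ 2) (fun _ _ => sq_nonneg _) (Finset.mem_univ i))

theorem abs_le_hessMag (D2u : Fin d → Fin d → SpT d → ℝ) (i j : Fin d) (z : SpT d) :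
    |D2u i j z| ≤ hessMag d D2u z :=
  Real.abs_le_sqrt <|
    (Finset.single_le_sum (f := fun j => D2u i j z ^ 2) (fun _ _ => sq_nonneg _)
      (Finset.mem_univ j)).trans
    (Finset.single_le_sum (f := fun i => ∑ j, D2u i j z ^ 2)
      (fun _ _ => Finset.sum_nonneg fun _ _ => sq_nonneg _) (Finset.mem_univ i))

theorem sqrt_sum_sq_le {ι : Type*} (s : Finset ι) (f : ι → ℝ) :
    √(∑ i ∈ s, f i ^ 2) ≤ ∑ i ∈ s, |f i| := by
  refine Real.sqrt_le_iff.2 ⟨Finset.sum_nonneg fun _ _ => abs_nonneg _, ?_⟩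
  simpa using Finset.sum_sq_le_sq_sum_of_nonneg (s := s) (f := fun i => |f i|)
    fun _ _ => abs_nonneg _

theorem morreyNorm_mono (hp : 1 < p) (hq : 1 < q) {f g : SpT d → ℝ} (h : ∀ z, |f z| ≤ |g z|) :
    morreyNorm d p q β f ≤ morreyNorm d p q β g := by
  rw [morreyNorm_eq, morreyNorm_eq]
  exact morreyE_mono_ae hp hq (ae_of_all _ fun z => ENNReal.ofReal_le_ofReal (h z))

theorem morreyNorm_ne_top_of_le_sum (hp : 1 < p) (hq : 1 < q) {ι : Type*} [Fintype ι]
    {f : ι → SpT d → ℝ} {g : SpT d → ℝ} (hf : ∀ i, MemE d p q β (f i))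
    (h : ∀ z, |g z| ≤ ∑ i, |f i z|) : morreyNorm d p q β g ≠ ⊤ := by
  have hm : ∀ i, AEMeasurable (fun z => ENNReal.ofReal |f i z|) := fun i =>
    (hf i).1.aemeasurable.abs.ennreal_ofReal
  have hle : morreyNorm d p q β g ≤ ∑ i, morreyNorm d p q β (f i) := by
    calc _ ≤ morreyE d p q β (fun z => ∑ i, (hm i).mk _ z) := by
          rw [morreyNorm_eq]
          refine morreyE_mono_ae hp hq ?_
          filter_upwards [ae_all_iff.2 fun i => (hm i).ae_eq_mk] with z hz
          simp only [← hz, ← ENNReal.ofReal_sum_of_nonneg fun i _ => abs_nonneg (f i z)]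
          exact ENNReal.ofReal_le_ofReal (h z)
      _ ≤ ∑ i, morreyE d p q β ((hm i).mk _) := morreyE_sum_le hp hq fun i => (hm i).measurable_mk
      _ ≤ _ := Finset.sum_le_sum fun i _ => by
          rw [morreyNorm_eq]
          exact morreyE_mono_ae hp hq ((hm i).ae_eq_mk.mono fun z hz => hz.ge)
  exact ne_top_of_le_ne_top (ENNReal.sum_ne_top.2 fun i _ => (hf i).2) hle

theorem norm12_ne_top (hp : 1 < p) (hq : 1 < q) {u ut : SpT d → ℝ} {Du : Fin d → SpT d → ℝ}
    {D2u : Fin d → Fin d → SpT d → ℝ} (h : Mem12 d p q β u Du D2u ut) :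
    norm12 d p q β u Du D2u ut ≠ ⊤ := by
  obtain ⟨hu, -, -, -, hD, hD2, ht⟩ := h
  have h1 : morreyNorm d p q β (gradMag d Du) ≠ ⊤ :=
    morreyNorm_ne_top_of_le_sum hp hq hD fun z => by
      rw [gradMag, abs_of_nonneg (Real.sqrt_nonneg _)]; exact sqrt_sum_sq_le _ _
  have h2 : morreyNorm d p q β (hessMag d D2u) ≠ ⊤ :=
    morreyNorm_ne_top_of_le_sum hp hq (f := fun (k : Fin d × Fin d) => D2u k.1 k.2)
      (fun k => hD2 k.1 k.2) fun z => by
        rw [hessMag, abs_of_nonneg (Real.sqrt_nonneg _), ← Fintype.sum_prod_type']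
        exact sqrt_sum_sq_le _ _
  simp only [norm12]
  exact ENNReal.add_ne_top.2 ⟨ENNReal.add_ne_top.2 ⟨ENNReal.add_ne_top.2 ⟨hu.2, h1⟩, h2⟩, ht.2⟩

/-- Entries of a symmetric form bounded by `c` and nonnegative are bounded by `2 * c`. -/
theorem abs_entry_le {A : Fin d → Fin d → ℝ} {c : ℝ} (hc : 0 ≤ c)
    (hs : ∀ i j, A i j = A j i)
    (h : ∀ ξ : Fin d → ℝ, 0 ≤ ∑ i, ∑ j, A i j * ξ i * ξ j ∧
      ∑ i, ∑ j, A i j * ξ i * ξ j ≤ c * ∑ i, ξ i ^ 2) (i j : Fin d) : |A i j| ≤ 2 * c := by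
  have hd : ∀ i, 0 ≤ A i i := fun i => by
    have := (h (Pi.single i 1)).1
    simpa [Pi.single_apply] using this
  have hε : ∀ ε : ℝ, ε ^ 2 = 1 → A i i + ε * (2 * A i j) + A j j ≤ c * 4 := fun ε hε => by
    have h1 := (h (Pi.single i 1 + ε • Pi.single j 1)).2
    have h2 : ∑ k, (Pi.single i 1 + ε • Pi.single j (1 : ℝ) : Fin d → ℝ) k ^ 2 ≤ 4 := by
      calc _ ≤ ∑ k, (2 * (Pi.single i (1 : ℝ) : Fin d → ℝ) k +
            2 * (Pi.single j (1 : ℝ) : Fin d → ℝ) k) := by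
            refine Finset.sum_le_sum fun k _ => ?_
            simp only [Pi.add_apply, Pi.smul_apply, Pi.single_apply, smul_eq_mul]
            split_ifs <;> nlinarith [sq_nonneg (ε - 1)]
        _ = 4 := by rw [Finset.sum_add_distrib]; simp [← Finset.mul_sum]; norm_num
    have h3 : ∑ k, ∑ l, A k l * (Pi.single i 1 + ε • Pi.single j (1 : ℝ) : Fin d → ℝ) k *
        (Pi.single i 1 + ε • Pi.single j (1 : ℝ) : Fin d → ℝ) l
        = A i i + ε * (2 * A i j) + A j j := by
      simp only [Pi.add_apply, Pi.smul_apply, Pi.single_apply, smul_eq_mul, mul_add, add_mul,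
        Finset.sum_add_distrib, mul_ite, mul_one, mul_zero, ite_mul, zero_mul,
        Finset.sum_ite_eq', Finset.mem_univ, if_true]
      linear_combination ε * hs j i + A j j * hε
    rw [h3] at h1
    exact h1.trans (mul_le_mul_of_nonneg_left h2 hc)
  have h1 := hε 1 (by norm_num)
  have h2 := hε (-1) (by norm_num)
  exact abs_le.2 ⟨by linarith [hd i, hd j], by linarith [hd i, hd j]⟩

theorem ballAv_le_of_average_le {s r : ℝ} (hs : 0 < s) (hr : 0 < r) {M : ℝ≥0}
    {g : Spc d → ℝ≥0∞} {x : Spc d}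
    (h : ENNReal.ofReal r * ((∫⁻ y in ball x r, g y ^ s) / volume (ball x r)) ^ (1 / s) ≤ M) :
    ballAv r (fun x => g x ^ s) x ≤
      ((volume (ball (0 : Spc d) 1)).toNNReal * M ^ s : ℝ≥0) * ENNReal.ofReal (r ^ (-s)) := by
  have h1 : (∫⁻ y in ball x r, g y ^ s) / volume (ball x r) ≤
      M ^ s * ENNReal.ofReal (r ^ (-s)) := by
    calc _ = ((ENNReal.ofReal r)⁻¹ * (ENNReal.ofReal r *
          ((∫⁻ y in ball x r, g y ^ s) / volume (ball x r)) ^ (1 / s))) ^ s := by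
          rw [← mul_assoc, ENNReal.inv_mul_cancel (by simpa using hr) ENNReal.ofReal_ne_top,
            one_mul, ← ENNReal.rpow_mul, one_div, inv_mul_cancel₀ hs.ne', ENNReal.rpow_one]
      _ ≤ ((ENNReal.ofReal r)⁻¹ * M) ^ s := by gcongr
      _ = _ := by
          rw [ENNReal.mul_rpow_of_nonneg _ _ hs.le, mul_comm, ENNReal.inv_rpow, ← ENNReal.rpow_neg,
            ENNReal.ofReal_rpow_of_pos hr]
  rw [ballAv, setLIntegral_ball_eq_cylX hr x fun y => g y ^ s, cylX, lintegral_smul_measure,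
    ENNReal.coe_mul, ENNReal.coe_toNNReal (volume_ball_ne_top _), ENNReal.coe_rpow_of_nonneg _ hs.le,
    mul_assoc, smul_eq_mul, mul_comm (_⁻¹), ← div_eq_mul_inv]
  exact mul_le_mul_right h1 _

end assembly

section elliptic
variable {d : ℕ} {p q β : ℝ}

theorem enorm_operator_le {a : Fin d → Fin d → ℝ} {c : ℝ} (h : ∀ i j, |a i j| ≤ 2 * c)
    (y : Spc d) (D : Fin d → ℝ) (H : Fin d → Fin d → ℝ) :
    ENNReal.ofReal |(1 / 2) * ∑ i, ∑ j, a i j * H i j + ∑ i, y i * D i| ≤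
      ENNReal.ofReal c * (∑ i, ∑ j, ‖H i j‖ₑ) + ∑ i, ‖y‖ₑ * ‖D i‖ₑ := by
  rw [← Real.enorm_eq_ofReal_abs, Finset.mul_sum, Finset.mul_sum]
  refine (enorm_add_le _ _).trans (add_le_add
    ((enorm_sum_le _ _).trans (Finset.sum_le_sum fun i _ => ?_))
    ((enorm_sum_le _ _).trans (Finset.sum_le_sum fun i _ => ?_)))
  · rw [Finset.mul_sum, Finset.mul_sum]
    refine (enorm_sum_le _ _).trans (Finset.sum_le_sum fun j _ => ?_)
    rw [← mul_assoc, enorm_mul]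
    gcongr
    rw [Real.enorm_eq_ofReal_abs, abs_mul, abs_of_pos (by norm_num : (0 : ℝ) < 1 / 2)]
    exact ENNReal.ofReal_le_ofReal (by linarith [h i j])
  · rw [enorm_mul]
    gcongr
    rw [← ofReal_norm, ← ofReal_norm]
    exact ENNReal.ofReal_le_ofReal (PiLp.norm_apply_le y i)

/-- The bound on `ℒu` in terms of measurable representatives. -/
theorem morreyNorm_operator_le (hp : 1 < p) (hq : 1 < q) {c : ℝ} {C : ℝ≥0}
    {a : Spc d → Matrix (Fin d) (Fin d) ℝ} {b : Spc d → Spc d} (hb : Measurable b)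
    (ha : ∀ x i j, |a x i j| ≤ 2 * c) {Du Du' : Fin d → SpT d → ℝ}
    {D2u D2u' : Fin d → Fin d → SpT d → ℝ} (hD : ∀ i, Measurable (Du' i))
    (hD2 : ∀ i j, Measurable (D2u' i j)) (eD : ∀ i, Du i =ᵐ[volume] Du' i)
    (eD2 : ∀ i j, D2u i j =ᵐ[volume] D2u' i j) {L : ℝ≥0∞}
    (h1 : ∀ i, morreyE d p q β (fun z => ‖b z.2‖ₑ * ‖Du' i z‖ₑ) ≤ C * L)
    (h2 : ∀ i j, morreyE d p q β (fun z => ‖D2u' i j z‖ₑ) ≤ L) :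
    morreyNorm d p q β (fun z => (1 / 2) * ∑ i, ∑ j, a z.2 i j * D2u i j z
        + ∑ i, b z.2 i * Du i z) ≤
      (ENNReal.ofReal c * (d * d) + d * C) * L := by
  have m2 : ∀ i, Measurable fun z => ∑ j, ‖D2u' i j z‖ₑ := fun i =>
    Finset.measurable_fun_sum _ fun j _ => (hD2 i j).enorm
  have m1 : ∀ i, Measurable fun z : SpT d => ‖b z.2‖ₑ * ‖Du' i z‖ₑ := fun i =>
    (hb.comp measurable_snd).enorm.mul (hD i).enorm
  rw [morreyNorm_eq]
  calc _ ≤ morreyE d p q β (fun z => ENNReal.ofReal c * (∑ i, ∑ j, ‖D2u' i j z‖ₑ)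
        + ∑ i, ‖b z.2‖ₑ * ‖Du' i z‖ₑ) := by
        refine morreyE_mono_ae hp hq ?_
        filter_upwards [ae_all_iff.2 eD, ae_all_iff.2 fun i => ae_all_iff.2 (eD2 i)] with z e1 e2
        simp only [e1, e2]
        exact enorm_operator_le (ha z.2) (b z.2) _ _
    _ ≤ ENNReal.ofReal c * (∑ _i : Fin d, ∑ _j : Fin d, L) + ∑ _i : Fin d, C * L := by
        refine (morreyE_add_le hp hq ((Finset.measurable_fun_sum _ fun i _ => m2 i).const_mul _)
          (Finset.measurable_fun_sum _ fun i _ => m1 i)).trans (add_le_add ?_ ?_)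
        · refine (morreyE_const_mul_le hp hq ENNReal.ofReal_ne_top _).trans
            (mul_le_mul_right ?_ _)
          refine (morreyE_sum_le hp hq m2).trans (Finset.sum_le_sum fun i _ => ?_)
          exact (morreyE_sum_le hp hq fun j => (hD2 i j).enorm).trans
            (Finset.sum_le_sum fun j _ => h2 i j)
        · exact (morreyE_sum_le hp hq m1).trans (Finset.sum_le_sum fun i _ => h1 i)
    _ = _ := by simp; ring

end elliptic

/-- Theorem 8,23.3: if `a` is a symmetric uniformly elliptic
    matrix field (eigenvalues in `[δ, δ⁻¹]`), and the Morrey quantity `b̂` of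
    `b` (with exponent `p_b ≥ βp`, radii `ρ ≤ ρ_b`) is at most `M < ∞`, then
    `ℒu = (1/2) aⁱʲ D_{ij}u + bⁱ D_i u` maps `E^{1,2}_{p,q,β}` into `E_{p,q,β}`
    with `‖ℒu‖_{E_{p,q,β}} ≤ N‖u‖_{E^{1,2}_{p,q,β}}`. -/
theorem statement10 (d : ℕ) (hd : 1 ≤ d) (δ p q β pb ρb : ℝ)
    (hδ0 : 0 < δ) (hδ1 : δ ≤ 1) (hp : 1 < p) (hq : 1 < q)
    (hβ1 : 1 < β) (hβ : β ≤ (d : ℝ) / p + 2 / q) (hpb : β * p ≤ pb)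
    (hρb0 : 0 < ρb) (hρb1 : ρb ≤ 1) (M : ℝ≥0) :
    ∃ N : ℝ≥0,
      ∀ (a : Spc d → Matrix (Fin d) (Fin d) ℝ) (b : Spc d → Spc d),
        (∀ i j, Measurable fun x => a x i j) →
        (∀ x i j, a x i j = a x j i) →
        (∀ (x : Spc d) (ξ : Fin d → ℝ),
          δ * ∑ i, ξ i ^ 2 ≤ ∑ i, ∑ j, a x i j * ξ i * ξ j ∧
            ∑ i, ∑ j, a x i j * ξ i * ξ j ≤ δ⁻¹ * ∑ i, ξ i ^ 2) →
        Measurable b →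
        (∀ ρ : ℝ, 0 < ρ → ρ ≤ ρb → ∀ x : Spc d,
          ENNReal.ofReal ρ *
              ((∫⁻ y in Metric.ball x ρ, ENNReal.ofReal ‖b y‖ ^ pb) /
                  volume (Metric.ball x ρ)) ^ (1 / pb) ≤ M) →
        ∀ (u : SpT d → ℝ) (Du : Fin d → SpT d → ℝ)
          (D2u : Fin d → Fin d → SpT d → ℝ) (ut : SpT d → ℝ),
          Mem12 d p q β u Du D2u ut →
          MemE d p q β
              (fun z => (1 / 2) * ∑ i, ∑ j, a z.2 i j * D2u i j z
                + ∑ i, b z.2 i * Du i z) ∧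
            morreyNorm d p q β
              (fun z => (1 / 2) * ∑ i, ∑ j, a z.2 i j * D2u i j z
                + ∑ i, b z.2 i * Du i z) ≤
              N * norm12 d p q β u Du D2u ut := by
  have hδi : 0 ≤ δ⁻¹ := by positivity
  have hps : p < pb := lt_of_lt_of_le (by nlinarith) hpb
  have hs : 0 < pb := by linarith
  obtain ⟨C, hC⟩ := exists_morreyE_drift_weak_le d hp hq hβ1 hps (half_pos hρb0) (by linarith)
    ((volume (ball (0 : Spc d) 1)).toNNReal * M ^ pb)
  refine ⟨δ⁻¹.toNNReal * (d * d) + d * (C * (d + 2)), ?_⟩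
  intro a b ham has hae hb hM u Du D2u ut hu
  have hfin := norm12_ne_top hp hq hu
  have hE := hu
  obtain ⟨⟨hum, huE⟩, wD, wD2, wt, hD, hD2, ht⟩ := hE
  set L := norm12 d p q β u Du D2u ut with hL
  have ha : ∀ x i j, |a x i j| ≤ 2 * δ⁻¹ := fun x =>
    abs_entry_le hδi (has x) fun ξ => ⟨le_trans
      (mul_nonneg hδ0.le (Finset.sum_nonneg fun _ _ => sq_nonneg _)) (hae x ξ).1, (hae x ξ).2⟩
  have hmk : ∀ {f : SpT d → ℝ} (hf : AEStronglyMeasurable f volume),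
      morreyE d p q β (fun z => ‖hf.mk f z‖ₑ) = morreyNorm d p q β f := fun {f} hf => by
    rw [morreyNorm_eq]
    simp only [← Real.enorm_eq_ofReal_abs]
    exact le_antisymm (morreyE_mono_ae hp hq (hf.ae_eq_mk.mono fun z hz => by simp only [hz, le_refl]))
      (morreyE_mono_ae hp hq (hf.ae_eq_mk.mono fun z hz => by simp only [hz, le_refl]))
  have hloc : ∀ {f : SpT d → ℝ} (hf : AEStronglyMeasurable f volume),
      morreyNorm d p q β f ≠ ⊤ → LocallyIntegrable (hf.mk f) := fun hf h =>
    locallyIntegrable_of_morreyE hp hq hf.stronglyMeasurable_mk.measurable (by rwa [hmk])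
  have bD : ∀ i, morreyNorm d p q β (Du i) ≤ L := fun i =>
    (morreyNorm_mono hp hq fun z => (abs_le_gradMag Du i z).trans (le_abs_self _)).trans
      (by rw [hL, norm12, add_assoc, add_assoc, add_left_comm]; exact le_self_add)
  have bD2 : ∀ i j, morreyNorm d p q β (D2u i j) ≤ L := fun i j =>
    (morreyNorm_mono hp hq fun z => (abs_le_hessMag D2u i j z).trans (le_abs_self _)).trans
      (by rw [hL, norm12, add_right_comm]; exact le_add_self)
  have bt : morreyNorm d p q β ut ≤ L := by rw [hL, norm12]; exact le_add_self
  have hdrift : ∀ i, morreyE d p q β (fun z => ‖b z.2‖ₑ * ‖(hD i).1.mk (Du i) z‖ₑ) ≤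
      (C * (d + 2) : ℝ≥0) * L := fun i => by
    refine (hC (fun x => ‖b x‖ₑ) hb.enorm (fun _ => enorm_ne_top) (fun r x hr hr2 => ?_)
      (hum.mk u) (ht.1.mk ut) (fun i => (hD i).1.mk (Du i)) (fun i j => (hD2 i j).1.mk (D2u i j))
      ht.1.stronglyMeasurable_mk.measurable (fun i => (hD i).1.stronglyMeasurable_mk.measurable)
      (fun i j => (hD2 i j).1.stronglyMeasurable_mk.measurable) (hloc hum huE)
      (fun i => hloc (hD i).1 (hD i).2) (wt.congr_ae hum.ae_eq_mk ht.1.ae_eq_mk)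
      (fun i => (wD i).congr_ae hum.ae_eq_mk (hD i).1.ae_eq_mk)
      (fun i j => (wD2 i j).congr_ae hum.ae_eq_mk (hD2 i j).1.ae_eq_mk) i).trans ?_
    · have h := hM r hr (by linarith) x
      simp only [ofReal_norm] at h
      exact ballAv_le_of_average_le hs hr h
    · simp only [hmk]
      calc _ ≤ (C : ℝ≥0∞) * (L + L + ∑ _j : Fin d, L) :=
            mul_le_mul_right (add_le_add (add_le_add (bD i) bt)
              (Finset.sum_le_sum fun j _ => bD2 i j)) _
        _ = _ := by simp; ring
  have hmain := morreyNorm_operator_le (a := a) hp hq hb ha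
    (fun i => (hD i).1.stronglyMeasurable_mk.measurable)
    (fun i j => (hD2 i j).1.stronglyMeasurable_mk.measurable) (fun i => (hD i).1.ae_eq_mk)
    (fun i j => (hD2 i j).1.ae_eq_mk) hdrift (fun i j => (hmk (hD2 i j).1).trans_le (bD2 i j))
  have hmain' : morreyNorm d p q β (fun z => (1 / 2) * ∑ i, ∑ j, a z.2 i j * D2u i j z
      + ∑ i, b z.2 i * Du i z) ≤ (δ⁻¹.toNNReal * (d * d) + d * (C * (d + 2)) : ℝ≥0) * L := by
    refine hmain.trans_eq ?_
    push_cast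
    rfl
  refine ⟨⟨?_, ne_top_of_le_ne_top (ENNReal.mul_ne_top ENNReal.coe_ne_top hfin) hmain'⟩, hmain'⟩
  have hbm : ∀ i, Measurable fun x => b x i := fun i => by fun_prop
  refine AEStronglyMeasurable.add (AEStronglyMeasurable.const_mul
    (Finset.aestronglyMeasurable_fun_sum _ fun i _ => Finset.aestronglyMeasurable_fun_sum _
      fun j _ => ?_) _) (Finset.aestronglyMeasurable_fun_sum _ fun i _ => ?_)
  · exact (((ham i j).comp measurable_snd).aestronglyMeasurable).mul (hD2 i j).1
  · exact (((hbm i).comp measurable_snd).aestronglyMeasurable).mul (hD i).1
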